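/- Let g ≥ 0, n ≥ 1, a, b ≥ 0 be integers, and let r_1,…,r_a ≥ 0, s_1,…,s_b ≥ 0, d_1,…,d_n ≥ 1 be integers with Σ_j r_j + Σ_j s_j + Σ_j d_j = g+n. Then the coefficient of y^{2g−4+a+b} Π_{j=1}^a z_j^{r_j} Π_{j=1}^b w_j^{s_j} Π_{j=1}^n x_j^{d_j} in L_g(y; z_1,…,z_a; w_1,…,w_b; x_1,…,x_n) equals (1/(Π_{j=1}^a (2r_j+1)!! Π_{j=1}^b (2s_j+1)!!)) · (−1)^b (2g−3+n+a+b)!/(4^g (2g−3+a+b)! Π_{j=1}^n (2d_j−1)!!), where (2g−3+n+a+b)!/(2g−3+a+b)! is to be read as the product Π_{i=1}^{n} (2g−3+a+b+i). -/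

import Mathlib

open MvPolynomial Finset

noncomputable section

/-- The polynomial ring `ℚ[x_1,…,x_n]`. -/
abbrev R (n : ℕ) : Type := MvPolynomial (Fin n) ℚ

/-- The field of rational functions `ℚ(x_1,…,x_n)`. -/
abbrev K (n : ℕ) : Type := FractionRing (R n)

/-- `x_1 + ⋯ + x_n` as an element of `K n`. -/
def SX (n : ℕ) : K n := algebraMap (R n) (K n) (∑ j, X j)

/-- `x_1^3 + ⋯ + x_n^3` as an element of `K n`. -/
def SX3 (n : ℕ) : K n := algebraMap (R n) (K n) (∑ j, (X j)^3)

/-- `Δ(x_1,…,x_n) = ((Σ x_j)^3 − Σ x_j^3)/3`. -/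
def Dlt (n : ℕ) : K n := ((SX n)^3 - SX3 n) / 3

/-- The ring homomorphism `ℚ[x_1,…,x_{|I|}] → ℚ(x_1,…,x_n)` substituting the variables
of the subset `I` (in increasing order). -/
def embRH {n : ℕ} (I : Finset (Fin n)) : R I.card →+* K n :=
  (algebraMap (R n) (K n)).comp
    (MvPolynomial.rename (fun i : Fin I.card => ((I.orderIsoOfFin rfl) i : Fin n))).toRingHom

lemma embRH_inj {n : ℕ} (I : Finset (Fin n)) : Function.Injective (embRH I) := by
  have h1 : Function.Injective (fun i : Fin I.card => ((I.orderIsoOfFin rfl) i : Fin n)) := by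
    intro i j hij
    exact (I.orderIsoOfFin rfl).injective (Subtype.val_injective hij)
  have h2 := (IsFractionRing.injective (R n) (K n)).comp (MvPolynomial.rename_injective _ h1)
  simpa [embRH, RingHom.coe_comp] using h2

/-- The field embedding `ℚ(x_1,…,x_{|I|}) → ℚ(x_1,…,x_n)` substituting the variables
of the subset `I` (in increasing order).  Used for expressions like `G_{r'}(x_I)`. -/
def emb {n : ℕ} (I : Finset (Fin n)) : K I.card →+* K n :=
  IsFractionRing.lift (embRH_inj I)

/-- The normalized `n`-point functions `G_g(x_1,…,x_n)`, defined with a fuel parameter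
(first argument) for structural recursion; for `fuel ≥ n` this computes the recursively
defined normalized `n`-point function:  `G_0(x) = x^{-2}`, `G_g(x) = 0` for `g ≥ 1`, and
for `n ≥ 2`,
`G_g = Σ_{r+s=g} ((2r+n−3)!!/(4^s(2r+2s+n−1)!!)) P_r Δ^s` where
`P_r = (1/(2Σx_j)) Σ_{I⊔J={1..n}, I,J≠∅} (Σ_I x)²(Σ_J x)² Σ_{r'≤r} G_{r'}(x_I)G_{r−r'}(x_J)`. -/
def Gf : (fuel : ℕ) → (n : ℕ) → ℕ → K n
  | _, 0, _ => 0
  | _, 1, 0 => (algebraMap (R 1) (K 1) (X 0)) ^ (-2 : ℤ)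
  | _, 1, _+1 => 0
  | 0, _+2, _ => 0
  | fuel+1, n+2, g =>
      ∑ s ∈ Finset.range (g+1),
        (((Nat.doubleFactorial (2*(g-s)+(n+2)-3) : ℚ) /
          (4^s * (Nat.doubleFactorial (2*g+(n+2)-1) : ℚ))) : K (n+2)) *
        ((2 * SX (n+2))⁻¹ *
          ∑ I : Finset (Fin (n+2)),
            if I ≠ ∅ ∧ I ≠ univ then
              (algebraMap (R (n+2)) (K (n+2)) (∑ i ∈ I, X i))^2 *
              (algebraMap (R (n+2)) (K (n+2)) (∑ i ∈ Iᶜ, X i))^2 *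
              ∑ r' ∈ Finset.range ((g-s)+1),
                emb I (Gf fuel I.card r') * emb Iᶜ (Gf fuel Iᶜ.card ((g-s) - r'))
            else 0) *
        (Dlt (n+2))^s

/-- The normalized `n`-point function `G_g(x_1,…,x_n)` as an element of `ℚ(x_1,…,x_n)`. -/
def Gnpt (n g : ℕ) : K n := Gf n n g

/-- `P_r(x_1,…,x_n)`. -/
def Ppoly (n r : ℕ) : K n :=
  (2 * SX n)⁻¹ *
    ∑ I : Finset (Fin n),
      if I ≠ ∅ ∧ I ≠ univ then
        (algebraMap (R n) (K n) (∑ i ∈ I, X i))^2 *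
        (algebraMap (R n) (K n) (∑ i ∈ Iᶜ, X i))^2 *
        ∑ r' ∈ Finset.range (r+1), emb I (Gnpt I.card r') * emb Iᶜ (Gnpt Iᶜ.card (r - r'))
      else 0

/-- The `n`-point function `F_g(x_1,…,x_n) = Σ_{h+d=g} (1/d!)((Σx_j^3)/24)^d G_h(x_1,…,x_n)`. -/
def Fnpt (n g : ℕ) : K n :=
  ∑ d ∈ Finset.range (g+1),
    ((1 / (Nat.factorial d : ℚ)) : K n) * (SX3 n / 24)^d * Gnpt n (g-d)

open Classical in
/-- The coefficient of the monomial `Π x_j^{d_j}` of an element of `ℚ(x_1,…,x_n)` which is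
a polynomial (junk value `0` otherwise). -/
def coeffK {n : ℕ} (f : K n) (d : Fin n → ℕ) : ℚ :=
  if h : ∃ p : R n, algebraMap (R n) (K n) p = f then
    MvPolynomial.coeff (Finsupp.equivFunOnFinite.symm d) h.choose
  else 0

/-- The intersection index `⟨τ_{d_1} ⋯ τ_{d_n}⟩_g`, i.e. the coefficient of `Π x_j^{d_j}`
in `F_g(x_1,…,x_n)`.  For `(g,n) = (0,1), (0,2)` and nonnegative `d_j` the value is `0`
(the conventional values `⟨τ_{-2}⟩_0 = 1`, `⟨τ_k τ_{-1-k}⟩_0 = (-1)^k` have a negative index). -/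
def bracket (g : ℕ) {n : ℕ} (d : Fin n → ℕ) : ℚ :=
  if g = 0 ∧ n ≤ 2 then 0 else coeffK (Fnpt n g) d

/-- `⟨τ_j Π_{i ∈ I} τ_{d_i}⟩_g` for a subset `I ⊆ {1,…,n}`. -/
def bracketI (g : ℕ) {n : ℕ} (j : ℕ) (I : Finset (Fin n)) (d : Fin n → ℕ) : ℚ :=
  bracket g (Fin.cons j (fun i : Fin I.card => d ((I.orderIsoOfFin rfl) i)))


/-! ### Laurent expansions in `y` (formal series in `ℚ[x_1,…,x_n][[y,y⁻¹]]` of bounded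
`y`-degree, realized as Hahn/Laurent series in the variable `t = y⁻¹`, so that the
coefficient of `y^k` is the Hahn coefficient at `-k`). -/

/-- Laurent series in `t = y⁻¹` with coefficients in `ℚ[x_1,…,x_n]`. -/
abbrev Lau (n : ℕ) : Type := LaurentSeries (R n)

/-- The generalized binomial coefficient `C(p,k) = p(p−1)⋯(p−k+1)/k!` for `p : ℤ`, `k : ℕ`. -/
def binomZ (p : ℤ) (k : ℕ) : ℚ := (∏ i ∈ Finset.range k, ((p : ℚ) - i)) / (Nat.factorial k)

/-- The expansion of `(y + c)^m = Σ_{k≥0} C(m,k) c^k y^{m−k}` as a Laurent series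
in `t = y⁻¹` (for `m ≥ 0` this is the usual binomial expansion of the polynomial). -/
def yExpAdd {n : ℕ} (c : R n) (m : ℤ) : Lau n :=
  (HahnSeries.single (-m) (1 : R n)) *
    HahnSeries.ofPowerSeries ℤ (R n)
      (PowerSeries.mk fun k => MvPolynomial.C (binomZ m k) * c^k)

/-- The expansion of `(±y + c)^m`, where the sign is `+` if `σ = true` and `−` otherwise;
it is computed as `(±1)^m (y ± c)^m`. -/
def LExp {n : ℕ} (σ : Bool) (c : R n) (m : ℤ) : Lau n :=
  (if σ then 1 else if Even m then 1 else -1 : Lau n) *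
    yExpAdd ((if σ then 1 else -1 : R n) * c) m

open Classical in
/-- The polynomial representing an element of `ℚ(x_1,…,x_n)` lying in `ℚ[x_1,…,x_n]`
(junk value `0` otherwise). -/
def polyOf {n : ℕ} (f : K n) : R n :=
  if h : ∃ p : R n, algebraMap (R n) (K n) p = f then h.choose else 0

/-- `±y` as a Laurent series in `t = y⁻¹`. -/
def yLau (n : ℕ) (σ : Bool) : Lau n :=
  (if σ then 1 else -1 : Lau n) * HahnSeries.single (-1 : ℤ) (1 : R n)

/-- The expansion of `F_g(±y, x_I)` as a Laurent series in `t = y⁻¹` with coefficients in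
`ℚ[x_1,…,x_n]`: for `(g,|I|+1) = (0,1)` it is `(±y)^{-2} = y^{-2}`, for `(g,|I|+1) = (0,2)`
it is `1/(±y + x_i) = Σ_{k≥0} (−1)^k x_i^k (±y)^{−k−1}`, and otherwise it is obtained by
substituting `±y` and the variables of `I` into the polynomial `F_g`. -/
def FExp {n : ℕ} (σ : Bool) (g : ℕ) (I : Finset (Fin n)) : Lau n :=
  if g = 0 ∧ I.card = 0 then HahnSeries.single (2 : ℤ) (1 : R n)
  else if g = 0 ∧ I.card = 1 then LExp σ (∑ i ∈ I, X i) (-1)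
  else
    MvPolynomial.eval₂ ((HahnSeries.C).comp (algebraMap ℚ (R n)))
      (Fin.cons (yLau n σ)
        (fun i : Fin I.card => HahnSeries.C (X ((I.orderIsoOfFin rfl) i : Fin n))))
      (polyOf (Fnpt (I.card + 1) g))

/-- `L_g^{a,b}(y, x_1,…,x_n) = Σ_{g'=0}^{g} Σ_{I⊔J={1,…,n}} (y+Σ_I x)^a (−y+Σ_J x)^b
F_{g'}(y,x_I) F_{g−g'}(−y,x_J)` as a Laurent series in `t = y⁻¹`. -/
def LL (g n : ℕ) (a b : ℤ) : Lau n :=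
  ∑ gp ∈ Finset.range (g+1), ∑ I : Finset (Fin n),
    LExp true (∑ i ∈ I, X i) a * LExp false (∑ i ∈ Iᶜ, X i) b *
      FExp true gp I * FExp false (g - gp) Iᶜ

/-- The coefficient of `y^k Π_j x_j^{d_j}` in a Laurent series in `t = y⁻¹` with coefficients
in `ℚ[x_1,…,x_n]`. -/
def coeffL {n : ℕ} (f : Lau n) (k : ℤ) (d : Fin n → ℕ) : ℚ :=
  MvPolynomial.coeff (Finsupp.equivFunOnFinite.symm d) (f.coeff (-k))

/-- The index of the variable `z_i` among the `a + b + n` variables `z, w, x`. -/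
def zIdx (a b n : ℕ) (i : Fin a) : Fin (a+b+n) := ⟨i.1, by have := i.2; omega⟩

/-- The index of the variable `w_i` among the `a + b + n` variables `z, w, x`. -/
def wIdx (a b n : ℕ) (i : Fin b) : Fin (a+b+n) := ⟨a + i.1, by have := i.2; omega⟩

/-- The index of the variable `x_i` among the `a + b + n` variables `z, w, x`. -/
def xIdx (a b n : ℕ) (i : Fin n) : Fin (a+b+n) := ⟨a + b + i.1, by have := i.2; omega⟩

/-- `L_g(y; z_1,…,z_a; w_1,…,w_b; x_1,…,x_n)
 = Σ_{g'=0}^{g} Σ_{I⊔J={1,…,n}} F_{g'}(y, z, x_I) F_{g−g'}(−y, w, x_J)`,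
as a Laurent series in `t = y⁻¹` with coefficients in `ℚ[z,w,x]`. -/
def LLm (g n a b : ℕ) : Lau (a+b+n) :=
  ∑ gp ∈ Finset.range (g+1), ∑ I : Finset (Fin n),
    FExp true gp ((univ.image (zIdx a b n)) ∪ I.image (xIdx a b n)) *
    FExp false (g - gp) ((univ.image (wIdx a b n)) ∪ Iᶜ.image (xIdx a b n))

/-- The exponent vector of the monomial `Π z_j^{r_j} Π w_j^{s_j} Π x_j^{d_j}`. -/
def expVec (a b n : ℕ) (r : Fin a → ℕ) (s : Fin b → ℕ) (d : Fin n → ℕ) :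
    Fin (a+b+n) → ℕ :=
  fun v =>
    if h : v.1 < a then r ⟨v.1, h⟩
    else if h2 : v.1 < a + b then s ⟨v.1 - a, by omega⟩
    else d ⟨v.1 - (a+b), by have := v.2; omega⟩

lemma sum_powerset_map {ι ι' M : Type*} [AddCommMonoid M] (e : ι ↪ ι') (I : Finset ι)
    (f : Finset ι' → M) :
    ∑ J ∈ (I.map e).powerset, f J = ∑ J ∈ I.powerset, f (J.map e) := by
  have : (I.map e).powerset = I.powerset.map (mapEmbedding e).toEmbedding := by
    ext J
    simp only [mem_powerset, mem_map, subset_map_iff, RelEmbedding.coe_toEmbedding,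
      mapEmbedding_apply]
    exact ⟨fun ⟨t, h1, h2⟩ => ⟨t, h1, h2.symm⟩, fun ⟨t, h1, h2⟩ => ⟨t, h1, h2.symm⟩⟩
  rw [this, sum_map]
  rfl

section SubsetSums

variable {ι M : Type*} [DecidableEq ι] [AddCommMonoid M]

lemma sum_powerset_compl (I : Finset ι) (f : Finset ι → M) :
    ∑ J ∈ I.powerset, f (I \ J) = ∑ J ∈ I.powerset, f J := by
  refine sum_nbij' (fun J => I \ J) (fun J => I \ J) ?_ ?_ ?_ ?_ ?_
  · intro J _; simp
  · intro J _; simp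
  · intro J hJ; simpa using mem_powerset.1 hJ
  · intro J hJ; simpa using mem_powerset.1 hJ
  · intro J _; rfl

/-- Reassociation of a sum over ordered partitions of `I` into three parts. -/
lemma sum_powerset_powerset (I : Finset ι) (f : Finset ι → Finset ι → Finset ι → M) :
    ∑ J ∈ I.powerset, ∑ A ∈ J.powerset, f A (J \ A) (I \ J)
      = ∑ A ∈ I.powerset, ∑ J ∈ (I \ A).powerset, f A J ((I \ A) \ J) := by
  rw [sum_sigma', sum_sigma']
  refine sum_nbij' (fun p => ⟨p.2, p.1 \ p.2⟩) (fun p => ⟨p.1 ∪ p.2, p.1⟩) ?_ ?_ ?_ ?_ ?_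
  · rintro ⟨J, A⟩ h
    simp only [mem_sigma, mem_powerset] at h ⊢
    exact ⟨h.2.trans h.1, sdiff_subset_sdiff h.1 le_rfl⟩
  · rintro ⟨A, J⟩ h
    simp only [mem_sigma, mem_powerset] at h ⊢
    exact ⟨union_subset h.1 (h.2.trans sdiff_subset), subset_union_left⟩
  · rintro ⟨J, A⟩ h
    simp only [mem_sigma, mem_powerset] at h
    simp [h.2]
  · rintro ⟨A, J⟩ h
    simp only [mem_sigma, mem_powerset] at h
    have : Disjoint A J := (disjoint_sdiff.mono_right h.2)
    simp [union_sdiff_cancel_left this]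
  · rintro ⟨J, A⟩ h
    simp only [mem_sigma, mem_powerset] at h
    have : (I \ A) \ (J \ A) = I \ J := by
      ext i
      have := @h.2 i
      simp only [mem_sdiff]; tauto
    simp [this]

lemma sum_powerset_union {Z X : Finset ι} (h : Disjoint Z X) (f : Finset ι → M) :
    ∑ J ∈ (Z ∪ X).powerset, f J = ∑ A ∈ Z.powerset, ∑ B ∈ X.powerset, f (A ∪ B) := by
  rw [← sum_product']
  refine sum_nbij' (fun J => (J ∩ Z, J ∩ X)) (fun p => p.1 ∪ p.2) ?_ ?_ ?_ ?_ ?_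
  · intro J _; simp
  · rintro ⟨A, B⟩ h'
    simp only [mem_product, mem_powerset] at h' ⊢
    exact union_subset_union h'.1 h'.2
  · intro J hJ
    rw [← inter_union_distrib_left]
    exact inter_eq_left.2 (mem_powerset.1 hJ)
  · rintro ⟨A, B⟩ h'
    simp only [mem_product, mem_powerset] at h'
    have h1 : Disjoint A X := h.mono_left h'.1
    have h2 : Disjoint B Z := (h.mono_right h'.2).symm
    simp [union_inter_distrib_right, inter_eq_left.2 h'.1, inter_eq_left.2 h'.2,
      disjoint_iff_inter_eq_empty.1 h1, disjoint_iff_inter_eq_empty.1 h2]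
  · intro J hJ
    rw [← inter_union_distrib_left, inter_eq_left.2 (mem_powerset.1 hJ)]

end SubsetSums

section GenusSeries

variable {ι ι' B B' : Type*} [DecidableEq ι] [DecidableEq ι'] [CommRing B] [CommRing B']

/-- The derivation `2q d/dq` of `B⟦q⟧`. -/
def genusD (B : Type*) [CommRing B] : Derivation B (PowerSeries B) (PowerSeries B) :=
  (2 * PowerSeries.X : PowerSeries B) • PowerSeries.derivative B

lemma coeff_genusD (f : PowerSeries B) (g : ℕ) :
    PowerSeries.coeff g (genusD B f) = 2 * g * PowerSeries.coeff g f := by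
  have h2 : (2 : PowerSeries B) = PowerSeries.C (2 : B) := (map_ofNat _ 2).symm
  cases g with
  | zero => simp [genusD, mul_assoc, h2]
  | succ g =>
    simp only [genusD, Derivation.smul_apply, smul_eq_mul, mul_assoc, h2,
      PowerSeries.coeff_C_mul, PowerSeries.coeff_succ_X_mul, PowerSeries.coeff_derivative]
    push_cast; ring

lemma genusD_C (c : B) : genusD B (PowerSeries.C c) = 0 := by
  simp [genusD]

lemma genusD_mul (f h : PowerSeries B) :
    genusD B (f * h) = f * genusD B h + h * genusD B f := by
  simp [Derivation.leibniz]

lemma genusD_X : genusD B PowerSeries.X = 2 * PowerSeries.X := by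
  simp [genusD]

lemma genusD_map (φ : B →+* B') (f : PowerSeries B) :
    genusD B' (PowerSeries.map φ f) = PowerSeries.map φ (genusD B f) := by
  ext g; simp [coeff_genusD, map_ofNat]

/-- The sum `∑_{i ∈ I} x_i`. -/
def varSum (x : ι → B) (I : Finset ι) : B := ∑ i ∈ I, x i

lemma varSum_sdiff (x : ι → B) {I J : Finset ι} (h : J ⊆ I) :
    varSum x (I \ J) = varSum x I - varSum x J := by
  rw [varSum, varSum, varSum, eq_sub_iff_add_eq, sum_sdiff h]

lemma varSum_union (x : ι → B) {I J : Finset ι} (h : Disjoint I J) :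
    varSum x (I ∪ J) = varSum x I + varSum x J := sum_union h

lemma varSum_insert (x : ι → B) {I : Finset ι} {e : ι} (h : e ∉ I) :
    varSum x (insert e I) = x e + varSum x I := sum_insert h

omit [DecidableEq ι] in
lemma map_varSum (φ : B →+* B') (x : ι → B) (I : Finset ι) :
    φ (varSum x I) = varSum (φ ∘ x) I := by simp [varSum]

variable [Algebra ℚ B] [Algebra ℚ B']

/-- `(∑_{i ∈ I} x_i)^2 F_g(x_I)` for a family `x` of elements of a `ℚ`-algebra. -/
def uFun (x : ι → B) (I : Finset ι) (g : ℕ) : B :=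
  if I.card = 1 ∧ g = 0 then 1 else
    (12 * (2 * (g : ℚ) + I.card - 1))⁻¹ •
      ((varSum x I) ^ 3 * (match g with
          | 0 => 0
          | h + 1 => uFun x I h)
        + 6 * varSum x I * ∑ J ∈ I.ssubsets.attach, if _ : J.1.Nonempty then
            ∑ h ∈ (antidiagonal g).attach, uFun x J h.1.1 * uFun x (I \ J) h.1.2 else 0)
termination_by (I.card, g)
decreasing_by
  · exact Prod.Lex.right _ (by simp)
  · exact Prod.Lex.left _ _ (card_lt_card (mem_ssubsets.1 J.2))
  · refine Prod.Lex.left _ _ (card_lt_card (sdiff_ssubset (mem_ssubsets.1 J.2).1 ?_))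
    assumption

/-- The genus generating series `∑_g q^g (∑_{i ∈ I} x_i)^2 F_g(x_I)`. -/
def uSer (x : ι → B) (I : Finset ι) : PowerSeries B := PowerSeries.mk (uFun x I)

lemma coeff_uSer (x : ι → B) (I : Finset ι) (g : ℕ) :
    PowerSeries.coeff g (uSer x I) = uFun x I g := by simp [uSer]

lemma uFun_empty (x : ι → B) (g : ℕ) : uFun x ∅ g = 0 := by
  rw [uFun.eq_def]; simp [varSum]

lemma uSer_empty (x : ι → B) : uSer x ∅ = 0 := by
  ext g; simp [coeff_uSer, uFun_empty]

lemma uFun_zero_of_card_eq_one (x : ι → B) {I : Finset ι} (h : I.card = 1) :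
    uFun x I 0 = 1 := by
  rw [uFun.eq_def]; simp [h]

/-- The quadratic sum `∑_{J ⊆ I} f(J) f(I ∖ J)`. -/
def qSum (f : Finset ι → B) (I : Finset ι) : B := ∑ J ∈ I.powerset, f J * f (I \ J)

omit [Algebra ℚ B] in
lemma qSum_singleton (f : Finset ι → B) (h : f ∅ = 0) (i : ι) : qSum f {i} = 0 := by
  have hp : ({i} : Finset ι).powerset = {∅, {i}} := by
    ext J; simp [subset_singleton_iff]
  rw [qSum, hp, sum_pair (by simp)]
  simp [h]

lemma ratCast_smul_cancel {k : ℚ} (hk : k ≠ 0) {a b : B} (h : k • a = k • b) : a = b := by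
  have := congrArg (fun z => k⁻¹ • z) h
  simpa [smul_smul, inv_mul_cancel₀ hk] using this

lemma twelve_mul_cancel {g n : ℕ} (h : ¬ (n = 1 ∧ g = 0)) {a b : B}
    (hab : 12 * (2 * (g : B) + n - 1) * a = 12 * (2 * (g : B) + n - 1) * b) : a = b := by
  have hk : (12 * (2 * (g : ℚ) + n - 1)) ≠ 0 := by
    intro h0
    have h1 : ((2 * g + n : ℕ) : ℚ) = (1 : ℕ) := by push_cast; linarith
    have := Nat.cast_injective h1
    omega
  refine ratCast_smul_cancel hk ?_
  simpa [Algebra.smul_def, map_ofNat] using hab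

omit [Algebra ℚ B] in
lemma coeff_uEquation (f Q : PowerSeries B) (n : ℕ) (S : B) (g : ℕ) :
    (PowerSeries.coeff g (12 * (genusD B f + ((n : PowerSeries B) - 1) * f)) =
      PowerSeries.coeff g (PowerSeries.X * PowerSeries.C (S ^ 3) * f + 6 * PowerSeries.C S * Q))
    ↔ 12 * (2 * (g : B) + n - 1) * PowerSeries.coeff g f =
      S ^ 3 * (match g with
          | 0 => 0
          | h + 1 => PowerSeries.coeff h f) + 6 * S * PowerSeries.coeff g Q := by
  have h1 : (12 * (genusD B f + ((n : PowerSeries B) - 1) * f))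
      = PowerSeries.C (12 : B) * (genusD B f + PowerSeries.C ((n : B) - 1) * f) := by
    simp [map_ofNat]
  have h2 : PowerSeries.X * PowerSeries.C (S ^ 3) * f + 6 * PowerSeries.C S * Q
      = PowerSeries.C (S ^ 3) * (PowerSeries.X * f) + PowerSeries.C (6 * S) * Q := by
    simp only [map_mul, map_ofNat]; ring
  rw [h1, h2]
  simp only [map_add, PowerSeries.coeff_C_mul, coeff_genusD]
  cases g with
  | zero => simp; ring_nf
  | succ g => simp only [PowerSeries.coeff_succ_X_mul]; push_cast; ring_nf

/-- The first equation of the KdV hierarchy for the `n`-point functions. -/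
lemma uSer_equation (x : ι → B) (I : Finset ι) :
    12 * (genusD B (uSer x I) + ((I.card : PowerSeries B) - 1) * uSer x I) =
      PowerSeries.X * PowerSeries.C (varSum x I ^ 3) * uSer x I
        + 6 * PowerSeries.C (varSum x I) * qSum (uSer x) I := by
  have key : ∀ g, PowerSeries.coeff g (qSum (uSer x) I) =
      ∑ J ∈ I.ssubsets.attach, if _ : J.1.Nonempty then
            ∑ h ∈ (antidiagonal g).attach, uFun x J h.1.1 * uFun x (I \ J) h.1.2 else 0 := by
    intro g
    rw [sum_attach I.ssubsets (fun J => if _ : J.Nonempty then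
            ∑ h ∈ (antidiagonal g).attach, uFun x J h.1.1 * uFun x (I \ J) h.1.2 else 0)]
    have h0 : I.ssubsets ⊆ I.powerset := fun J hJ => mem_powerset.2 (mem_ssubsets.1 hJ).1
    rw [qSum, map_sum, ← sum_subset h0]
    · refine sum_congr rfl fun J _ => ?_
      split_ifs with hJ
      · rw [PowerSeries.coeff_mul, ← sum_attach]
        simp [coeff_uSer]
      · rw [not_nonempty_iff_eq_empty.1 hJ, uSer_empty]; simp
    · intro J hJ hJ'
      have : J = I := by
        by_contra hne
        exact hJ' (mem_ssubsets.2 (lt_of_le_of_ne (mem_powerset.1 hJ) hne))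
      simp [this, uSer_empty]
  ext g
  rw [coeff_uEquation, key, coeff_uSer]
  by_cases h : I.card = 1 ∧ g = 0
  · obtain ⟨h1, rfl⟩ := h
    rw [← key]
    obtain ⟨i, rfl⟩ := card_eq_one.1 h1
    have : qSum (uSer x) {i} = 0 :=
      qSum_singleton _ (uSer_empty x) i
    simp [this]
  · have hk : (12 * (2 * (g : ℚ) + I.card - 1)) ≠ 0 := by
      intro h0
      have h1 : ((2 * g + I.card : ℕ) : ℚ) = (1 : ℕ) := by push_cast; linarith
      have := Nat.cast_injective h1
      omega
    have e : (12 * (2 * (g : B) + I.card - 1)) * uFun x I g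
        = (12 * (2 * (g : ℚ) + I.card - 1)) • uFun x I g := by
      simp [Algebra.smul_def, map_ofNat]
    rw [e, uFun.eq_def, if_neg h, smul_smul, mul_inv_cancel₀ hk, one_smul]
    cases g <;> simp [coeff_uSer]

/-- A series satisfying the defining equation of `uSer x I` is equal to it. -/
lemma eq_uSer_of_equation (x : ι → B) (I : Finset ι) (f : PowerSeries B)
    (h1 : I.card = 1 → PowerSeries.constantCoeff f = 1)
    (h : 12 * (genusD B f + ((I.card : PowerSeries B) - 1) * f) =
      PowerSeries.X * PowerSeries.C (varSum x I ^ 3) * f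
        + 6 * PowerSeries.C (varSum x I) * qSum (uSer x) I) :
    f = uSer x I := by
  ext g
  induction g with
  | zero =>
    by_cases hc : I.card = 1
    · simp [h1 hc, coeff_uSer, uFun_zero_of_card_eq_one x hc]
    · have e1 := (coeff_uEquation _ _ _ _ 0).1 (congrArg (PowerSeries.coeff 0) h)
      have e2 := (coeff_uEquation _ _ _ _ 0).1
        (congrArg (PowerSeries.coeff 0) (uSer_equation x I))
      exact twelve_mul_cancel (n := I.card) (g := 0) (by tauto) (e1.trans e2.symm)
  | succ g ih =>
    have e1 := (coeff_uEquation _ _ _ _ (g + 1)).1 (congrArg (PowerSeries.coeff (g + 1)) h)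
    have e2 := (coeff_uEquation _ _ _ _ (g + 1)).1
      (congrArg (PowerSeries.coeff (g + 1)) (uSer_equation x I))
    simp only [ih] at e1
    exact twelve_mul_cancel (n := I.card) (g := g + 1) (by simp) (e1.trans e2.symm)

/-- Naturality of `uSer` in the coefficient ring and the index set. -/
lemma uSer_map (φ : B →+* B') (e : ι ↪ ι') (x : ι → B) (x' : ι' → B')
    (I : Finset ι) (hx : ∀ i ∈ I, x' (e i) = φ (x i)) :
    PowerSeries.map φ (uSer x I) = uSer x' (I.map e) := by
  induction I using Finset.strongInduction with
  | H I ih =>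
    have hS : varSum x' (I.map e) = φ (varSum x I) := by
      simp only [varSum, sum_map, map_sum]
      exact sum_congr rfl hx
    refine eq_uSer_of_equation _ _ _ ?_ ?_
    · intro hc
      rw [card_map] at hc
      rw [← PowerSeries.coeff_zero_eq_constantCoeff_apply]
      simp [coeff_uSer, uFun_zero_of_card_eq_one x hc]
    · have hq : qSum (uSer x') (I.map e) = PowerSeries.map φ (qSum (uSer x) I) := by
        rw [qSum, qSum, sum_powerset_map, map_sum]
        refine sum_congr rfl fun J hJ => ?_
        rw [mem_powerset] at hJ
        rw [← Finset.map_sdiff, map_mul]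
        by_cases h0 : J = ∅
        · simp [h0, uSer_empty]
        by_cases h1 : J = I
        · simp [h1, uSer_empty]
        rw [ih J (lt_of_le_of_ne hJ h1) (fun i hi => hx i (hJ hi)),
          ih (I \ J) (sdiff_ssubset hJ (nonempty_iff_ne_empty.2 h0))
            (fun i hi => hx i (mem_sdiff.1 hi).1)]
      have := congrArg (PowerSeries.map φ) (uSer_equation x I)
      rw [hq, hS, card_map, genusD_map]
      simpa [map_ofNat] using this

lemma uFun_map (φ : B →+* B') (e : ι ↪ ι') (x : ι → B) (x' : ι' → B')
    (I : Finset ι) (hx : ∀ i ∈ I, x' (e i) = φ (x i)) (g : ℕ) :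
    φ (uFun x I g) = uFun x' (I.map e) g := by
  have := congrArg (PowerSeries.coeff g) (uSer_map φ e x x' I hx)
  simpa [coeff_uSer] using this

end GenusSeries

section Divisibility

variable {ι B : Type*} [DecidableEq ι] [CommRing B] [Algebra ℚ B]

/-- Conservation of momentum for the KdV equation: `q`-homogeneous components of the quadratic sum
are divisible by `∑_{i ∈ I} x_i`. -/
lemma qSum_uSer_conservation (x : ι → B) (I : Finset ι) : ∃ w : PowerSeries B,
    12 * (genusD B (qSum (uSer x) I) + ((I.card : PowerSeries B) - 2) * qSum (uSer x) I)
      = PowerSeries.C (varSum x I) * w := by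
  set f := uSer x with hf
  let s : Finset ι → PowerSeries B := fun J => PowerSeries.C (varSum x J)
  have hs : ∀ J ∈ I.powerset, s (I \ J) = s I - s J := fun J hJ => by
    simp only [s, varSum_sdiff x (mem_powerset.1 hJ), map_sub]
  have hc : ∀ J ∈ I.powerset, ((I \ J).card : PowerSeries B) = I.card - J.card := fun J hJ => by
    rw [card_sdiff_of_subset (mem_powerset.1 hJ), Nat.cast_sub (card_le_card (mem_powerset.1 hJ))]
  have eq : ∀ J, 12 * (genusD B (f J) + ((J.card : PowerSeries B) - 1) * f J) =
      PowerSeries.X * s J ^ 3 * f J + 6 * s J * qSum f J := fun J => by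
    simpa [s] using uSer_equation x J
  have h1 : 12 * (genusD B (qSum f I) + ((I.card : PowerSeries B) - 2) * qSum f I)
      = 2 * ∑ J ∈ I.powerset,
        (PowerSeries.X * s J ^ 3 * f J + 6 * s J * qSum f J) * f (I \ J) := by
    have a1 : 12 * (genusD B (qSum f I) + ((I.card : PowerSeries B) - 2) * qSum f I)
        = ∑ J ∈ I.powerset, (PowerSeries.X * s J ^ 3 * f J + 6 * s J * qSum f J) * f (I \ J)
        + ∑ J ∈ I.powerset, (PowerSeries.X * s (I \ J) ^ 3 * f (I \ J)
            + 6 * s (I \ J) * qSum f (I \ J)) * f J := by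
      rw [qSum, map_sum, mul_sum, ← sum_add_distrib, mul_sum, ← sum_add_distrib]
      refine sum_congr rfl fun J hJ => ?_
      rw [← eq J, ← eq (I \ J), genusD_mul, hc J hJ]
      ring
    have a2 := sum_powerset_compl I (fun J =>
      (PowerSeries.X * s J ^ 3 * f J + 6 * s J * qSum f J) * f (I \ J))
    have a3 : ∑ J ∈ I.powerset, (PowerSeries.X * s (I \ J) ^ 3 * f (I \ J)
            + 6 * s (I \ J) * qSum f (I \ J)) * f (I \ (I \ J))
        = ∑ J ∈ I.powerset, (PowerSeries.X * s (I \ J) ^ 3 * f (I \ J)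
            + 6 * s (I \ J) * qSum f (I \ J)) * f J :=
      sum_congr rfl fun J hJ => by rw [Finset.sdiff_sdiff_eq_self (mem_powerset.1 hJ)]
    rw [a1, ← a3, a2]; ring
  have h2 : 2 * ∑ J ∈ I.powerset, s J ^ 3 * (f J * f (I \ J)) = s I *
      ∑ J ∈ I.powerset, (s J ^ 2 - s J * s (I \ J) + s (I \ J) ^ 2) * (f J * f (I \ J)) := by
    have a2 := sum_powerset_compl I (fun J => s J ^ 3 * (f J * f (I \ J)))
    rw [two_mul]
    nth_rewrite 1 [← a2]
    rw [← sum_add_distrib, mul_sum]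
    refine sum_congr rfl fun J hJ => ?_
    rw [Finset.sdiff_sdiff_eq_self (mem_powerset.1 hJ), hs J hJ]
    ring
  have h3 : 3 * ∑ J ∈ I.powerset, s J * qSum f J * f (I \ J)
      = 2 * (s I * ∑ J ∈ I.powerset, qSum f J * f (I \ J)) := by
    have b1 : ∑ J ∈ I.powerset, s J * qSum f J * f (I \ J)
        = 2 * ∑ J ∈ I.powerset, s (I \ J) * qSum f J * f (I \ J) := by
      have c1 : ∀ J ∈ I.powerset, s J * qSum f J
          = 2 * ∑ A ∈ J.powerset, s A * (f A * f (J \ A)) := fun J _ => by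
        have a2 := sum_powerset_compl J (fun A => s A * (f A * f (J \ A)))
        rw [two_mul]
        nth_rewrite 1 [← a2]
        rw [← sum_add_distrib, qSum, mul_sum]
        refine sum_congr rfl fun A hA => ?_
        rw [Finset.sdiff_sdiff_eq_self (mem_powerset.1 hA)]
        simp only [s, varSum_sdiff x (mem_powerset.1 hA), map_sub]
        ring
      rw [sum_congr rfl (fun J hJ => by rw [c1 J hJ])]
      simp only [mul_assoc, ← mul_sum]
      congr 1
      simp only [sum_mul]
      rw [sum_powerset_powerset I (fun A D E => s A * (f A * f D) * f E),
        ← sum_powerset_compl I (fun J => s (I \ J) * (qSum f J * f (I \ J)))]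
      refine sum_congr rfl fun J hJ => ?_
      rw [Finset.sdiff_sdiff_eq_self (mem_powerset.1 hJ), qSum, sum_mul, mul_sum]
      exact sum_congr rfl fun A _ => by ring
    have b2 : s I * ∑ J ∈ I.powerset, qSum f J * f (I \ J)
        = ∑ J ∈ I.powerset, s J * qSum f J * f (I \ J)
          + ∑ J ∈ I.powerset, s (I \ J) * qSum f J * f (I \ J) := by
      rw [← sum_add_distrib, mul_sum]
      refine sum_congr rfl fun J hJ => ?_
      rw [hs J hJ]; ring
    rw [b2]
    linear_combination b1
  refine ⟨PowerSeries.X * ∑ J ∈ I.powerset,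
      (s J ^ 2 - s J * s (I \ J) + s (I \ J) ^ 2) * (f J * f (I \ J))
    + 8 * ∑ J ∈ I.powerset, qSum f J * f (I \ J), ?_⟩
  rw [h1]
  have h4 : ∑ J ∈ I.powerset, (PowerSeries.X * s J ^ 3 * f J + 6 * s J * qSum f J) * f (I \ J)
      = PowerSeries.X * ∑ J ∈ I.powerset, s J ^ 3 * (f J * f (I \ J))
        + 6 * ∑ J ∈ I.powerset, s J * qSum f J * f (I \ J) := by
    rw [mul_sum, mul_sum, ← sum_add_distrib]
    exact sum_congr rfl fun J _ => by ring
  change _ = s I * _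
  rw [h4]
  linear_combination PowerSeries.X * h2 + 4 * h3

/-- The `n`-point functions are polynomials in the stable range. -/
lemma sq_varSum_dvd_uFun (x : ι → B) (I : Finset ι) (g : ℕ) (hI : I.Nonempty)
    (hst : ¬ (g = 0 ∧ I.card ≤ 2)) : varSum x I ^ 2 ∣ uFun x I g := by
  have hpos := hI.card_pos
  obtain ⟨w, hw⟩ := qSum_uSer_conservation x I
  set Q := qSum (uSer x) I
  have h1 : 12 * (2 * (g : B) + I.card - 2) * PowerSeries.coeff g Q
      = varSum x I * PowerSeries.coeff g w := by
    have h2 : 12 * (genusD B Q + ((I.card : PowerSeries B) - 2) * Q)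
        = PowerSeries.C (12 : B) * (genusD B Q + PowerSeries.C ((I.card : B) - 2) * Q) := by
      simp [map_ofNat]
    have := congrArg (PowerSeries.coeff g) hw
    rw [h2] at this
    simp only [map_add, PowerSeries.coeff_C_mul, coeff_genusD] at this
    rw [← this]; ring
  have h2 := (coeff_uEquation _ _ _ _ g).1 (congrArg (PowerSeries.coeff g) (uSer_equation x I))
  have ne1 : (12 * (2 * (g : ℚ) + I.card - 1)) ≠ 0 := by
    have : (2 : ℚ) ≤ 2 * (g : ℚ) + I.card := by exact_mod_cast (by omega : 2 ≤ 2 * g + I.card)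
    linarith
  have ne2 : (12 * (2 * (g : ℚ) + I.card - 2)) ≠ 0 := by
    have : (3 : ℚ) ≤ 2 * (g : ℚ) + I.card := by exact_mod_cast (by omega : 3 ≤ 2 * g + I.card)
    linarith
  have h1' : PowerSeries.coeff g Q = varSum x I *
      ((12 * (2 * (g : ℚ) + I.card - 2))⁻¹ • PowerSeries.coeff g w) := by
    refine ratCast_smul_cancel ne2 ?_
    rw [mul_smul_comm, smul_smul, mul_inv_cancel₀ ne2, one_smul, ← h1]
    simp [Algebra.smul_def, map_ofNat]
  obtain ⟨c, hc⟩ : varSum x I ^ 2 ∣ (12 * (2 * (g : ℚ) + I.card - 1)) • uFun x I g := by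
    have : (12 * (2 * (g : ℚ) + I.card - 1)) • uFun x I g
        = 12 * (2 * (g : B) + I.card - 1) * uFun x I g := by simp [Algebra.smul_def, map_ofNat]
    rw [this, ← coeff_uSer, h2]
    refine dvd_add (Dvd.dvd.mul_right (pow_dvd_pow _ (by norm_num)) _) ?_
    rw [h1']
    exact ⟨6 * ((12 * (2 * (g : ℚ) + I.card - 2))⁻¹ • PowerSeries.coeff g w), by ring⟩
  refine ⟨(12 * (2 * (g : ℚ) + I.card - 1))⁻¹ • c, ?_⟩
  rw [mul_smul_comm, ← hc, smul_smul, inv_mul_cancel₀ ne1, one_smul]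

end Divisibility

section Dilaton

variable {ι B : Type*} [DecidableEq ι] [CommRing B] [Algebra ℚ B]

lemma uSer_singleton_of_sq_eq_zero (x : ι → B) {e : ι} (he : x e ^ 2 = 0) :
    uSer x {e} = 1 := by
  symm
  refine eq_uSer_of_equation _ _ _ (by simp) ?_
  have h3 : x e ^ 3 = 0 := by rw [pow_succ, he, zero_mul]
  simp [qSum_singleton _ (uSer_empty x), varSum, h3]

omit [DecidableEq ι] [Algebra ℚ B] in
lemma insert_equation_aux {s ε X f f' f'' Q Q' n : B} (h : ε ^ 2 = 0)
    (E : 12 * (f' + (n - 1) * f) = X * s ^ 3 * f + 6 * s * Q)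
    (E' : 12 * (f'' + (n - 1) * f') = X * s ^ 3 * f' + 2 * X * s ^ 3 * f + 6 * s * Q') :
    12 * (s * f' + ε * (f'' + n * f') + n * (s * f + ε * (f' + n * f))) =
      X * (ε + s) ^ 3 * (s * f + ε * (f' + n * f))
        + 6 * (ε + s) * (2 * f + s * Q + ε * (Q' + n * Q)) := by
  linear_combination (s + n * ε + ε) * E + ε * E'
      - (X * (3 * s + ε) * (s * f + ε * (f' + n * f))
        + 3 * X * s ^ 2 * (f' + n * f)
        + 6 * (Q' + n * Q)) * h

/-- The string and dilaton equations. -/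
lemma uSer_insert_of_sq_eq_zero (x : ι → B) {e : ι} (he : x e ^ 2 = 0) (I : Finset ι)
    (hI : e ∉ I) (hne : I.Nonempty) :
    uSer x (insert e I) = PowerSeries.C (varSum x I) * uSer x I
      + PowerSeries.C (x e) * (genusD B (uSer x I) + I.card * uSer x I) := by
  induction I using Finset.strongInduction with
  | H I ih =>
    symm
    set f := uSer x with hf
    refine eq_uSer_of_equation _ _ _ ?_ ?_
    · intro hc
      rw [card_insert_of_notMem hI] at hc
      have := hne.card_pos
      omega
    set s : Finset ι → PowerSeries B := fun J => PowerSeries.C (varSum x J) with hs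
    set ε : PowerSeries B := PowerSeries.C (x e) with hε
    have hε2 : ε ^ 2 = 0 := by rw [hε, ← map_pow, he, map_zero]
    let Φ : Finset ι → PowerSeries B := fun J =>
      s J * f J + ε * (genusD B (f J) + J.card * f J)
    have hsym : 2 * ∑ J ∈ I.powerset, Φ J * f (I \ J)
        = s I * qSum f I + ε * (genusD B (qSum f I) + I.card * qSum f I) := by
      rw [two_mul]
      nth_rewrite 1 [← sum_powerset_compl I (fun J => Φ J * f (I \ J))]
      rw [← sum_add_distrib, qSum, map_sum, mul_sum, mul_sum, ← sum_add_distrib, mul_sum,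
        ← sum_add_distrib]
      refine sum_congr rfl fun J hJ => ?_
      have hJ' := mem_powerset.1 hJ
      rw [Finset.sdiff_sdiff_eq_self hJ', genusD_mul]
      simp only [Φ, hs, varSum_sdiff x hJ', map_sub]
      rw [card_sdiff_of_subset hJ', Nat.cast_sub (card_le_card hJ')]
      ring
    have hins : ∑ J ∈ I.powerset, f (insert e J) * f (I \ J)
        = f I + ∑ J ∈ I.powerset, Φ J * f (I \ J) := by
      have h0 : ∑ J ∈ I.powerset, (if J = ∅ then f I else 0) = f I := by
        rw [sum_ite_eq' I.powerset ∅ (fun _ => f I)]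
        simp
      rw [← h0, ← sum_add_distrib]
      refine sum_congr rfl fun J hJ => ?_
      have hJ' := mem_powerset.1 hJ
      by_cases hJ0 : J = ∅
      · subst hJ0
        simp [Φ, hf, uSer_empty, uSer_singleton_of_sq_eq_zero x he]
      by_cases hJI : J = I
      · subst hJI
        simp [hJ0, hf, uSer_empty]
      rw [ih J (lt_of_le_of_ne hJ' hJI) (fun h => hI (hJ' h)) (nonempty_iff_ne_empty.2 hJ0)]
      simp [hJ0, Φ, s]
    have hq : qSum f (insert e I) = 2 * f I + s I * qSum f I
        + ε * (genusD B (qSum f I) + I.card * qSum f I) := by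
      rw [qSum, sum_powerset_insert hI]
      have h1 : ∑ J ∈ I.powerset, f J * f (insert e I \ J)
          = ∑ J ∈ I.powerset, f (insert e J) * f (I \ J) := by
        rw [← sum_powerset_compl I (fun J => f (insert e J) * f (I \ J))]
        refine sum_congr rfl fun J hJ => ?_
        have hJ' := mem_powerset.1 hJ
        rw [Finset.sdiff_sdiff_eq_self hJ', insert_sdiff_of_notMem _ (fun h => hI (hJ' h))]
        ring
      have h2 : ∑ J ∈ I.powerset, f (insert e J) * f (insert e I \ insert e J)
          = ∑ J ∈ I.powerset, f (insert e J) * f (I \ J) := by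
        refine sum_congr rfl fun J hJ => ?_
        rw [insert_sdiff_insert, sdiff_insert_of_notMem hI]
      rw [h1, h2, hins]
      linear_combination hsym
    have E := uSer_equation x I
    have E' := congrArg (genusD B) E
    have hX : genusD B (PowerSeries.X * PowerSeries.C (varSum x I ^ 3) * f I)
        = PowerSeries.X * s I ^ 3 * genusD B (f I) + 2 * PowerSeries.X * s I ^ 3 * f I := by
      rw [genusD_mul, genusD_mul, genusD_C, genusD_X, map_pow]
      simp only [hs]; ring
    have hnum : ∀ (k : PowerSeries B) (_ : genusD B k = 0) (h : PowerSeries B),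
        genusD B (k * h) = k * genusD B h := fun k hk h => by
      rw [genusD_mul, hk]; ring
    have e12 : genusD B (12 : PowerSeries B) = 0 := Derivation.map_natCast _ 12
    have e6 : genusD B (6 * s I) = 0 := by
      rw [hnum 6 (Derivation.map_natCast _ 6), hs, genusD_C, mul_zero]
    have en : genusD B ((I.card : PowerSeries B) - 1) = 0 := by
      rw [map_sub, Derivation.map_natCast, Derivation.map_one_eq_zero, sub_zero]
    rw [hnum 12 e12, map_add, hnum _ en, map_add, hX, hnum _ e6] at E'
    have hεs : PowerSeries.C (x e + varSum x I) = ε + s I := by rw [map_add]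
    have hsI : PowerSeries.C (varSum x I) = s I := rfl
    rw [hq, card_insert_of_notMem hI, varSum_insert x hI, map_pow, hεs, hsI]
    have d1 : genusD B (s I * f I + ε * (genusD B (f I) + I.card * f I))
        = s I * genusD B (f I) + ε * (genusD B (genusD B (f I)) + I.card * genusD B (f I)) := by
      rw [map_add, hnum _ (genusD_C _), hnum ε (genusD_C _), map_add,
        hnum _ (Derivation.map_natCast _ _)]
    rw [map_pow, hsI] at E
    rw [d1, Nat.cast_add, Nat.cast_one, add_sub_cancel_right]
    exact insert_equation_aux hε2 E E'

lemma sq_dvd_uFun_insert_sub (x : ι → B) {e : ι} (I : Finset ι) (hI : e ∉ I)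
    (hne : I.Nonempty) (g : ℕ) :
    x e ^ 2 ∣ uFun x (insert e I) g - (varSum x I + x e * (2 * g + I.card)) * uFun x I g := by
  let φ := Ideal.Quotient.mk (Ideal.span {x e ^ 2})
  have he : (φ ∘ x) e ^ 2 = 0 := by
    rw [Function.comp_apply, ← map_pow, Ideal.Quotient.eq_zero_iff_mem]
    exact Ideal.mem_span_singleton_self _
  have nat : ∀ J g, φ (uFun x J g) = uFun (φ ∘ x) J g := fun J g => by
    have := uFun_map φ (Function.Embedding.refl ι) x (φ ∘ x) J (fun _ _ => rfl) g
    simpa using this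
  have h := congrArg (PowerSeries.coeff g) (uSer_insert_of_sq_eq_zero (φ ∘ x) he I hI hne)
  have hn : (I.card : PowerSeries (B ⧸ Ideal.span {x e ^ 2}))
      = PowerSeries.C (I.card : B ⧸ Ideal.span {x e ^ 2}) := by simp
  rw [hn] at h
  simp only [map_add, PowerSeries.coeff_C_mul, coeff_genusD, coeff_uSer] at h
  rw [← Ideal.mem_span_singleton, ← Ideal.Quotient.eq_zero_iff_mem]
  change φ _ = 0
  simp only [map_sub, map_mul, map_add, nat, map_varSum, map_natCast, map_ofNat, h,
    Function.comp_apply]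
  ring

end Dilaton

section PSExp

variable {B B' : Type*} [CommRing B] [Algebra ℚ B] [CommRing B'] [Algebra ℚ B']

/-- The series `exp(cq)`. -/
def expSer (c : B) : PowerSeries B := PowerSeries.rescale c (PowerSeries.exp B)

lemma coeff_expSer (c : B) (d : ℕ) :
    PowerSeries.coeff d (expSer c) = c ^ d * algebraMap ℚ B (1 / d.factorial) := by
  simp [expSer, PowerSeries.coeff_rescale, PowerSeries.coeff_exp]

lemma constantCoeff_expSer (c : B) : PowerSeries.constantCoeff (expSer c) = 1 := by
  rw [← PowerSeries.coeff_zero_eq_constantCoeff_apply, coeff_expSer]; simp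

lemma expSer_add (c d : B) : expSer (c + d) = expSer c * expSer d := by
  rw [expSer, expSer, expSer, PowerSeries.exp_mul_exp_eq_exp_add]

lemma genusD_expSer (c : B) :
    genusD B (expSer c) = PowerSeries.C (2 * c) * (PowerSeries.X * expSer c) := by
  ext g
  rw [coeff_genusD, PowerSeries.coeff_C_mul]
  cases g with
  | zero => simp
  | succ g =>
    rw [PowerSeries.coeff_succ_X_mul, coeff_expSer, coeff_expSer]
    have : algebraMap ℚ B (1 / g.factorial)
        = ((g + 1 : ℕ) : B) * algebraMap ℚ B (1 / (g + 1).factorial) := by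
      rw [← map_natCast (algebraMap ℚ B), ← map_mul]
      congr 1
      rw [Nat.factorial_succ]; push_cast
      field_simp
    rw [this]; ring

lemma map_expSer (φ : B →+* B') (c : B) :
    PowerSeries.map φ (expSer c) = expSer (φ c) := by
  ext d
  have := RingHom.congr_fun (Subsingleton.elim (φ.comp (algebraMap ℚ B)) (algebraMap ℚ B'))
    (1 / d.factorial)
  rw [RingHom.comp_apply] at this
  rw [PowerSeries.coeff_map, coeff_expSer, coeff_expSer, map_mul, map_pow, this]

end PSExp

section Normalized

/-- The variables of `ℚ(x_1,…,x_n)`. -/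
def varK (n : ℕ) (j : Fin n) : K n := algebraMap (R n) (K n) (X j)

lemma SX_eq (n : ℕ) : SX n = varSum (varK n) univ := by simp [SX, varSum, varK]

/-- The order embedding of `I`. -/
def ordEmb {n : ℕ} (I : Finset (Fin n)) : Fin I.card ↪ Fin n :=
  (I.orderEmbOfFin rfl).toEmbedding

lemma ordEmb_apply {n : ℕ} (I : Finset (Fin n)) (i : Fin I.card) :
    ordEmb I i = ((I.orderIsoOfFin rfl) i : Fin n) := rfl

lemma univ_map_ordEmb {n : ℕ} (I : Finset (Fin n)) : univ.map (ordEmb I) = I := by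
  simp [ordEmb]

lemma emb_algebraMap {n : ℕ} (I : Finset (Fin n)) (p : R I.card) :
    emb I (algebraMap _ _ p) = embRH I p := IsFractionRing.lift_algebraMap _ _

lemma emb_varK {n : ℕ} (I : Finset (Fin n)) (i : Fin I.card) :
    emb I (varK I.card i) = varK n (ordEmb I i) := by
  rw [varK, emb_algebraMap]
  simp [embRH, varK, ordEmb_apply]

lemma emb_SX {n : ℕ} (I : Finset (Fin n)) : emb I (SX I.card) = varSum (varK n) I := by
  rw [SX_eq, map_varSum]
  conv_rhs => rw [← univ_map_ordEmb I]
  simp [varSum, emb_varK]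

lemma emb_SX3 {n : ℕ} (I : Finset (Fin n)) : emb I (SX3 I.card) = ∑ i ∈ I, varK n i ^ 3 := by
  have : SX3 I.card = ∑ j, varK I.card j ^ 3 := by simp [SX3, varK]
  rw [this]
  conv_rhs => rw [← univ_map_ordEmb I]
  simp [emb_varK]

/-- The genus generating series of the normalized functions. -/
def gSer (fuel n : ℕ) : PowerSeries (K n) := PowerSeries.mk (Gf fuel n)

/-- The genus generating series of `P_r`. -/
def pSer (fuel n : ℕ) : PowerSeries (K n) := PowerSeries.C (2 * SX n)⁻¹ *
  ∑ I : Finset (Fin n), if I ≠ ∅ ∧ I ≠ univ then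
    PowerSeries.C (varSum (varK n) I ^ 2 * varSum (varK n) Iᶜ ^ 2) *
      (PowerSeries.map (emb I) (gSer fuel I.card) *
        PowerSeries.map (emb Iᶜ) (gSer fuel Iᶜ.card)) else 0

lemma Gf_eq (fuel m g : ℕ) : Gf (fuel + 1) (m + 2) g =
    ∑ s ∈ range (g + 1),
      (((Nat.doubleFactorial (2*(g-s)+(m+2)-3) : ℚ) /
          (4^s * (Nat.doubleFactorial (2*g+(m+2)-1) : ℚ))) : K (m+2)) *
      PowerSeries.coeff (g - s) (pSer fuel (m + 2)) * (Dlt (m + 2)) ^ s := by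
  rw [Gf]
  refine sum_congr rfl fun s _ => ?_
  congr 2
  rw [pSer, PowerSeries.coeff_C_mul, map_sum]
  congr 1
  refine sum_congr rfl fun I _ => ?_
  split_ifs
  · rw [PowerSeries.coeff_C_mul, PowerSeries.coeff_mul,
      Finset.Nat.sum_antidiagonal_eq_sum_range_succ_mk]
    simp [varSum, varK, gSer]
  · simp

lemma Gf_coeff_recursion (fuel m g : ℕ) :
    (2 * (g : K (m + 2)) + m + 1) * Gf (fuel + 1) (m + 2) g
      = Dlt (m + 2) / 4 * (match g with
          | 0 => 0
          | h + 1 => Gf (fuel + 1) (m + 2) h) + PowerSeries.coeff g (pSer fuel (m + 2)) := by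
  have hdf : ∀ k : ℕ, (2 * (k : K (m + 2)) + m + 1) *
      (((Nat.doubleFactorial (2*k+(m+2)-1) : ℚ)⁻¹ : ℚ) : K (m + 2))
      = (((Nat.doubleFactorial (2*k+(m+2)-3) : ℚ)⁻¹ : ℚ) : K (m + 2)) := by
    intro k
    have h0 : ∀ j : ℕ, (Nat.doubleFactorial j : ℚ) ≠ 0 := fun j => by
      exact_mod_cast (Nat.doubleFactorial_pos j).ne'
    have h1 : Nat.doubleFactorial (2*k+(m+2)-1)
        = (2 * k + m + 1) * Nat.doubleFactorial (2*k+(m+2)-3) := by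
      rcases Nat.eq_zero_or_pos (2 * k + m) with h | h
      · obtain ⟨rfl, rfl⟩ : k = 0 ∧ m = 0 := by omega
        rfl
      · obtain ⟨t, ht⟩ : ∃ t, 2 * k + m = t + 1 := ⟨2 * k + m - 1, by omega⟩
        have e1 : 2*k+(m+2)-1 = t + 2 := by omega
        have e2 : 2*k+(m+2)-3 = t := by omega
        rw [e1, e2, Nat.doubleFactorial_add_two, ht]
    have h2 : (2 * (k : K (m + 2)) + m + 1) = ((2 * k + m + 1 : ℚ) : K (m + 2)) := by
      push_cast; ring
    rw [h2, ← Rat.cast_mul]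
    congr 1
    rw [h1]
    have : (2 * k + m + 1 : ℚ) ≠ 0 := by positivity
    have := h0 (2*k+(m+2)-3)
    push_cast
    field_simp
  have hterm : ∀ s ≤ g, ((((Nat.doubleFactorial (2*(g-s)+(m+2)-3) : ℚ) : K (m + 2)) /
          (4^s * ((Nat.doubleFactorial (2*g+(m+2)-1) : ℚ) : K (m + 2)))))
      = ((Nat.doubleFactorial (2*(g-s)+(m+2)-3) : ℚ) : K (m + 2)) * ((1 / 4) ^ s) *
        (((Nat.doubleFactorial (2*g+(m+2)-1) : ℚ)⁻¹ : ℚ) : K (m + 2)) := by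
    intro s _
    push_cast
    rw [div_eq_mul_inv, mul_inv, one_div, inv_pow]; ring
  have key : (2 * (g : K (m + 2)) + m + 1) * Gf (fuel + 1) (m + 2) g = ∑ s ∈ range (g + 1),
      ((Nat.doubleFactorial (2*(g-s)+(m+2)-3) : ℚ) : K (m + 2)) * ((1 / 4) ^ s) *
        (((Nat.doubleFactorial (2*g+(m+2)-3) : ℚ)⁻¹ : ℚ) : K (m + 2)) *
      PowerSeries.coeff (g - s) (pSer fuel (m + 2)) * (Dlt (m + 2)) ^ s := by
    rw [Gf_eq, mul_sum]
    refine sum_congr rfl fun s hs => ?_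
    rw [hterm s (by simp at hs; omega), ← hdf g]
    ring
  have hone : ((Nat.doubleFactorial (2*g+(m+2)-3) : ℚ) : K (m + 2)) *
      (((Nat.doubleFactorial (2*g+(m+2)-3) : ℚ)⁻¹ : ℚ) : K (m + 2)) = 1 := by
    rw [← Rat.cast_mul, mul_inv_cancel₀, Rat.cast_one]
    exact_mod_cast (Nat.doubleFactorial_pos _).ne'
  rw [key, sum_range_succ']
  congr 1
  · cases g with
    | zero => simp
    | succ g =>
      dsimp only
      rw [Gf_eq, mul_sum]
      refine sum_congr rfl fun s hs => ?_
      rw [Nat.succ_sub_succ]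
      have e : 2*(g+1)+(m+2)-3 = 2*g+(m+2)-1 := by omega
      rw [e]
      push_cast
      simp only [div_eq_mul_inv, mul_inv, one_mul, inv_pow]
      ring
  · simp only [Nat.sub_zero, pow_zero, mul_one]
    rw [hone, one_mul]

lemma Gf_recursion (fuel m : ℕ) :
    12 * (genusD _ (gSer (fuel + 1) (m + 2))
        + (((m + 2 : ℕ) : PowerSeries (K (m + 2))) - 1) * gSer (fuel + 1) (m + 2))
      = PowerSeries.X * PowerSeries.C (3 * Dlt (m + 2)) * gSer (fuel + 1) (m + 2)
        + 12 * pSer fuel (m + 2) := by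
  have h12 : (12 : PowerSeries (K (m + 2))) = PowerSeries.C 12 := by simp [map_ofNat]
  have hn : (((m + 2 : ℕ) : PowerSeries (K (m + 2))) - 1) =
      PowerSeries.C ((m : K (m + 2)) + 1) := by
    push_cast; simp; ring
  have := Gf_coeff_recursion fuel m
  obtain ⟨c, hc⟩ : ∃ c, c = (m : K (m + 2)) + 1 := ⟨_, rfl⟩
  rw [h12, hn, ← hc, mul_comm PowerSeries.X, mul_assoc]
  ext g
  simp only [map_add, PowerSeries.coeff_C_mul, coeff_genusD, gSer, PowerSeries.coeff_mk]
  replace this := this g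
  rw [add_assoc, ← hc] at this
  cases g with
  | zero =>
    simp only [PowerSeries.coeff_zero_X_mul] at this ⊢
    linear_combination 12 * this
  | succ g =>
    simp only [PowerSeries.coeff_succ_X_mul, PowerSeries.coeff_mk] at this ⊢
    linear_combination 12 * this

lemma varSum_varK_ne_zero {n : ℕ} (I : Finset (Fin n)) (hI : I.Nonempty) :
    varSum (varK n) I ≠ 0 := by
  have : varSum (varK n) I = algebraMap (R n) (K n) (∑ i ∈ I, X i) := by simp [varSum, varK]
  rw [this, Ne, IsFractionRing.to_map_eq_zero_iff]
  intro h
  obtain ⟨i, hi⟩ := hI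
  have h2 := congrArg (MvPolynomial.eval (fun j => if j = i then (1 : ℚ) else 0)) h
  simp [hi] at h2

lemma gSer_eq_uSer (n : ℕ) : ∀ fuel, n ≤ fuel →
    PowerSeries.C (SX n ^ 2) * (expSer (SX3 n / 24) * gSer fuel n) = uSer (varK n) univ := by
  induction n using Nat.strong_induction_on with
  | _ n ih =>
    intro fuel hfuel
    match n, fuel, hfuel with
    | 0, fuel, _ =>
      have : (univ : Finset (Fin 0)) = ∅ := rfl
      rw [this, uSer_empty]
      have : SX 0 = 0 := by simp [SX]
      simp [this]
    | 1, fuel, _ =>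
      have hu : (univ : Finset (Fin 1)) = {0} := rfl
      have hg : gSer fuel 1 = PowerSeries.C (SX 1 ^ 2)⁻¹ := by
        ext g
        cases g with
        | zero => simp [gSer, Gf, SX, zpow_neg]
        | succ g => simp [gSer, Gf]
      have hne : SX 1 ≠ 0 := by rw [SX_eq]; exact varSum_varK_ne_zero _ (by simp)
      have h0 : PowerSeries.C (SX 1 ^ 2) * (expSer (SX3 1 / 24) * gSer fuel 1)
          = expSer (SX3 1 / 24) := by
        rw [hg, mul_left_comm, ← map_mul, mul_inv_cancel₀ (pow_ne_zero 2 hne), map_one, mul_one]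
      rw [h0]
      refine eq_uSer_of_equation _ _ _ (fun _ => constantCoeff_expSer _) ?_
      have h3 : varSum (varK 1) {0} ^ 3 = 24 * (SX3 1 / 24) := by
        simp [varSum, varK, SX3]
        ring
      rw [hu, qSum_singleton _ (uSer_empty _), h3, genusD_expSer]
      simp only [card_singleton, map_mul, map_ofNat]
      push_cast; ring
    | m + 2, fuel + 1, hfuel =>
      set n := m + 2 with hn
      set S := SX n with hS
      set E := expSer (SX3 n / 24) with hE
      have hne : S ≠ 0 := by rw [hS, SX_eq]; exact varSum_varK_ne_zero _ (by simp)
      refine eq_uSer_of_equation _ _ _ (by simp [hn]) ?_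
      have hQ : qSum (uSer (varK n)) univ = PowerSeries.C (2 * S) * (E * pSer fuel n) := by
        have hI : ∀ I : Finset (Fin n), I ≠ univ → uSer (varK n) I =
            PowerSeries.C (varSum (varK n) I ^ 2) *
              (expSer ((∑ i ∈ I, varK n i ^ 3) / 24) *
                PowerSeries.map (emb I) (gSer fuel I.card)) := by
          intro I hI
          have hc : I.card < n := by
            simpa using card_lt_card (lt_of_le_of_ne (subset_univ I) hI)
          have h1 := congrArg (PowerSeries.map (emb I)) (ih I.card hc fuel (by omega))
          rw [uSer_map (emb I) (ordEmb I) (varK I.card) (varK n) univ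
            (fun i _ => (emb_varK I i).symm), univ_map_ordEmb] at h1
          rw [← h1, map_mul, map_mul, map_expSer, PowerSeries.map_C, map_pow, emb_SX, map_div₀,
            emb_SX3, map_ofNat]
        rw [pSer, mul_left_comm E, ← mul_assoc, ← map_mul, mul_inv_cancel₀ (by simpa using hne),
          map_one, one_mul, qSum, mul_sum, powerset_univ]
        refine sum_congr rfl fun I _ => ?_
        split_ifs with h
        · have h2 : Iᶜ ≠ univ := by simpa using h.1
          rw [← compl_eq_univ_sdiff, hI I h.2, hI Iᶜ h2, hE]
          have h3 : SX3 n / 24 = (∑ i ∈ I, varK n i ^ 3) / 24 + (∑ i ∈ Iᶜ, varK n i ^ 3) / 24 := by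
            rw [← add_div, sum_add_sum_compl]
            simp [SX3, varK]
          rw [h3, expSer_add, map_mul]
          ring
        · rw [not_and_or, not_not, not_not] at h
          rcases h with h | h <;> simp [h, uSer_empty]
      have hrec := Gf_recursion fuel m
      have hd : genusD (K n) (PowerSeries.C (S ^ 2) * (E * gSer (fuel + 1) n))
          = PowerSeries.C (S ^ 2) * (E * genusD _ (gSer (fuel + 1) n)
            + PowerSeries.C (2 * (SX3 n / 24)) * (PowerSeries.X * E) * gSer (fuel + 1) n) := by
        rw [genusD_mul, genusD_mul, genusD_C, hE, genusD_expSer]; ring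
      have hΔ : PowerSeries.C (3 * Dlt n) = PowerSeries.C S ^ 3
          - 12 * PowerSeries.C (2 * (SX3 n / 24)) := by
        have : 3 * Dlt n = S ^ 3 - 12 * (2 * (SX3 n / 24)) := by rw [Dlt]; ring
        rw [this]; simp [map_ofNat]
      rw [hΔ] at hrec
      rw [hQ, hd, card_univ, Fintype.card_fin, ← SX_eq, map_mul PowerSeries.C 2 S, map_pow, map_pow,
        map_ofNat]
      linear_combination PowerSeries.C S ^ 2 * E * hrec

/-- The functions `F_g(x_1,…,x_n)` in terms of `uFun`. -/
lemma SX_sq_mul_Fnpt (n g : ℕ) : SX n ^ 2 * Fnpt n g = uFun (varK n) univ g := by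
  rw [← coeff_uSer, ← gSer_eq_uSer n n le_rfl, PowerSeries.coeff_C_mul, PowerSeries.coeff_mul,
    Finset.Nat.sum_antidiagonal_eq_sum_range_succ_mk, Fnpt]
  congr 1
  refine sum_congr rfl fun d _ => ?_
  rw [coeff_expSer]
  simp [gSer, Gnpt]
  left; ring

/-- Evaluation of the polynomial `F_g(x_1,…,x_n)`. -/
lemma eval_polyOf {B : Type*} [CommRing B] [Algebra ℚ B] (n g : ℕ) (hn : 1 ≤ n)
    (hst : ¬ (g = 0 ∧ n ≤ 2)) (φ : R n →+* B) (x : Fin n → B) (hx : ∀ i, φ (X i) = x i) :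
    varSum x univ ^ 2 * φ (polyOf (Fnpt n g)) = uFun x univ g := by
  have hc : (univ : Finset (Fin n)).card = n := by simp
  obtain ⟨p, hp⟩ := sq_varSum_dvd_uFun (fun i : Fin n => (X i : R n)) univ g
    (card_pos.1 (by omega)) (by rwa [hc])
  have nat1 : algebraMap (R n) (K n) (uFun (fun i : Fin n => (X i : R n)) univ g)
      = uFun (varK n) univ g := by
    simpa using uFun_map (algebraMap (R n) (K n)) (Function.Embedding.refl _)
      (fun i : Fin n => (X i : R n)) (varK n) univ (fun i _ => rfl) g
  have nat2 : φ (uFun (fun i : Fin n => (X i : R n)) univ g) = uFun x univ g := by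
    simpa using uFun_map φ (Function.Embedding.refl _)
      (fun i : Fin n => (X i : R n)) x univ (fun i _ => (hx i).symm) g
  have hne : SX n ≠ 0 := by rw [SX_eq]; exact varSum_varK_ne_zero _ (card_pos.1 (by omega))
  have hS : algebraMap (R n) (K n) (varSum (fun i : Fin n => (X i : R n)) univ) = SX n := by
    rw [map_varSum, SX_eq]; rfl
  have hF : algebraMap (R n) (K n) p = Fnpt n g := by
    refine mul_left_cancel₀ (pow_ne_zero 2 hne) ?_
    rw [SX_sq_mul_Fnpt, ← nat1, hp, map_mul, map_pow, hS]
  have hex : ∃ p : R n, algebraMap (R n) (K n) p = Fnpt n g := ⟨p, hF⟩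
  have : polyOf (Fnpt n g) = p := by
    rw [polyOf, dif_pos hex]
    exact IsFractionRing.injective (R n) (K n) (hex.choose_spec.trans hF.symm)
  rw [this, ← nat2, hp, map_mul, map_pow, map_varSum]
  congr 2
  simp [varSum, hx]

end Normalized

section TopCoefficient

variable {A : Type*} [CommRing A]

/-- `f` has `y`-degree at most `D`, and `a` is the coefficient of `y^D` in `f`
(where `y = t⁻¹`). -/
def HasTop (f : LaurentSeries A) (D : ℤ) (a : A) : Prop :=
  ∃ p : PowerSeries A, f = HahnSeries.single (-D) 1 * HahnSeries.ofPowerSeries ℤ A p ∧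
    PowerSeries.constantCoeff p = a

namespace HasTop

variable {f h : LaurentSeries A} {D E : ℤ} {a b : A}

lemma coeff_eq (hf : HasTop f D a) : f.coeff (-D) = a := by
  obtain ⟨p, rfl, rfl⟩ := hf
  have := HahnSeries.coeff_single_mul_add (r := (1 : A)) (x := HahnSeries.ofPowerSeries ℤ A p)
    (a := 0) (b := -D)
  rw [zero_add] at this
  rw [this, one_mul]
  have := HahnSeries.ofPowerSeries_apply_coeff (Γ := ℤ) p 0
  simpa using this

lemma unique (hf : HasTop f D a) (hf' : HasTop f D b) : a = b :=
  hf.coeff_eq.symm.trans hf'.coeff_eq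

lemma cast (hf : HasTop f D a) {f' : LaurentSeries A} {D' : ℤ} {a' : A} (h1 : f' = f)
    (h2 : D' = D) (h3 : a' = a) : HasTop f' D' a' := by
  subst h1 h2 h3; exact hf

lemma add (hf : HasTop f D a) (hh : HasTop h D b) : HasTop (f + h) D (a + b) := by
  obtain ⟨p, rfl, rfl⟩ := hf
  obtain ⟨q, rfl, rfl⟩ := hh
  exact ⟨p + q, by rw [map_add, mul_add], map_add _ _ _⟩

lemma mul (hf : HasTop f D a) (hh : HasTop h E b) : HasTop (f * h) (D + E) (a * b) := by
  obtain ⟨p, rfl, rfl⟩ := hf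
  obtain ⟨q, rfl, rfl⟩ := hh
  refine ⟨p * q, ?_, map_mul _ _ _⟩
  rw [map_mul, mul_mul_mul_comm, HahnSeries.single_mul_single, one_mul, neg_add]

lemma const (a : A) : HasTop (HahnSeries.C a) 0 a :=
  ⟨PowerSeries.C a, by simp, by simp⟩

lemma const_mul (c : A) (hf : HasTop f D a) : HasTop (HahnSeries.C c * f) D (c * a) :=
  ((const c).mul hf).cast rfl (by ring) rfl

lemma neg (hf : HasTop f D a) : HasTop (-f) D (-a) :=
  (hf.const_mul (-1)).cast (by simp) rfl (by simp)

lemma sub (hf : HasTop f D a) (hh : HasTop h D b) : HasTop (f - h) D (a - b) :=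
  (hf.add hh.neg).cast (sub_eq_add_neg _ _) rfl (sub_eq_add_neg _ _)

lemma zero : HasTop (0 : LaurentSeries A) D 0 := ⟨0, by simp, by simp⟩

lemma lower (hf : HasTop f D a) (hD : D < E) : HasTop f E 0 := by
  obtain ⟨p, rfl, rfl⟩ := hf
  obtain ⟨k, rfl⟩ : ∃ k : ℕ, E = D + (k + 1) := ⟨(E - D - 1).toNat, by omega⟩
  refine ⟨PowerSeries.X ^ (k + 1) * p, ?_, by simp [pow_succ]⟩
  rw [map_mul, HahnSeries.ofPowerSeries_X_pow, ← mul_assoc, HahnSeries.single_mul_single, one_mul]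
  congr 3
  push_cast; ring

lemma le (hf : HasTop f D a) (hD : D ≤ E) : ∃ b, HasTop f E b := by
  rcases hD.eq_or_lt with rfl | hD
  · exact ⟨a, hf⟩
  · exact ⟨0, hf.lower hD⟩

lemma self (hf : HasTop f D a) : HasTop f D (f.coeff (-D)) := by
  rwa [hf.coeff_eq]

lemma sum {κ : Type*} (s : Finset κ) {f : κ → LaurentSeries A} {a : κ → A}
    (hf : ∀ i ∈ s, HasTop (f i) D (a i)) : HasTop (∑ i ∈ s, f i) D (∑ i ∈ s, a i) := by
  classical
  induction s using Finset.induction_on with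
  | empty => simpa using zero
  | insert i s hi ih =>
    rw [sum_insert hi, sum_insert hi]
    exact (hf _ (mem_insert_self _ _)).add (ih fun j hj => hf j (mem_insert_of_mem hj))

lemma exists_degree (f : LaurentSeries A) : ∃ D a, HasTop f D a :=
  ⟨-f.order, _, LaurentSeries.powerSeriesPart f, by
    rw [neg_neg, LaurentSeries.single_order_mul_powerSeriesPart], rfl⟩

lemma exists_degree_family {κ : Type*} (s : Finset κ) (f : κ → LaurentSeries A) :
    ∃ D, ∀ i ∈ s, ∃ a, HasTop (f i) D a := by
  classical
  induction s using Finset.induction_on with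
  | empty => exact ⟨0, by simp⟩
  | insert i s hi ih =>
    obtain ⟨D, hD⟩ := ih
    obtain ⟨E, b, hE⟩ := exists_degree (f i)
    refine ⟨max D E, fun j hj => ?_⟩
    rcases mem_insert.1 hj with rfl | hj
    · exact hE.le (le_max_right _ _)
    · obtain ⟨a, ha⟩ := hD j hj
      exact ha.le (le_max_left _ _)

end HasTop

/-- `y` as a Laurent series in `t = y⁻¹`. -/
def yV (A : Type*) [CommRing A] : LaurentSeries A := HahnSeries.single (-1 : ℤ) (1 : A)

lemma yV_add_C (c : A) : yV A + HahnSeries.C c = HahnSeries.single (-1 : ℤ) (1 : A) *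
    HahnSeries.ofPowerSeries ℤ A (1 + PowerSeries.C c * PowerSeries.X) := by
  rw [map_add, map_one (HahnSeries.ofPowerSeries ℤ A), map_mul, HahnSeries.ofPowerSeries_X,
    HahnSeries.ofPowerSeries_C, mul_add, mul_one, mul_left_comm, HahnSeries.single_mul_single]
  simp [yV]

lemma exists_unit_yV_add (c : A) :
    ∃ u : (LaurentSeries A)ˣ, (u : LaurentSeries A) = yV A + HahnSeries.C c := by
  have h2 : IsUnit (HahnSeries.single (-1 : ℤ) (1 : A)) :=
    IsUnit.of_mul_eq_one (HahnSeries.single (1 : ℤ) (1 : A)) (by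
      rw [HahnSeries.single_mul_single]; simp)
  have h3 : IsUnit (1 + PowerSeries.C c * PowerSeries.X : PowerSeries A) := by
    rw [PowerSeries.isUnit_iff_constantCoeff]; simp
  have : IsUnit (yV A + HahnSeries.C c) := by
    rw [yV_add_C]; exact h2.mul (h3.map _)
  exact ⟨this.unit, this.unit_spec⟩

/-- The unit `y + c`. -/
def yUnit (c : A) : (LaurentSeries A)ˣ := (exists_unit_yV_add c).choose

lemma coe_yUnit (c : A) : (yUnit c : LaurentSeries A) = yV A + HahnSeries.C c :=
  (exists_unit_yV_add c).choose_spec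

/-- The power `(y + c)^k`. -/
def yPow (c : A) (k : ℤ) : LaurentSeries A := ((yUnit c ^ k : (LaurentSeries A)ˣ) : LaurentSeries A)

lemma yPow_zero (c : A) : yPow c 0 = 1 := by simp [yPow]

lemma yPow_one (c : A) : yPow c 1 = yV A + HahnSeries.C c := by simp [yPow, coe_yUnit]

lemma yPow_add (c : A) (j k : ℤ) : yPow c (j + k) = yPow c j * yPow c k := by
  simp [yPow, zpow_add]

lemma yPow_mul_neg (c : A) (k : ℤ) : yPow c k * yPow c (-k) = 1 := by
  rw [← yPow_add, add_neg_cancel, yPow_zero]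

lemma yPow_add_one (c : A) (k : ℤ) :
    yPow c (k + 1) = yPow c k * (yV A + HahnSeries.C c) := by rw [yPow_add, yPow_one]

lemma hasTop_yPow (c : A) (k : ℤ) : HasTop (yPow c k) k 1 := by
  have h1 : HasTop (yV A) 1 1 := ⟨1, by simp [yV], by simp⟩
  have h2 : HasTop (yPow c 1) 1 1 := by
    rw [yPow_one]
    exact (h1.add ((HasTop.const c).lower one_pos)).cast rfl rfl (by simp)
  have h3 : HasTop (yPow c (-1)) (-1) 1 := by
    obtain ⟨p, hp, hp1⟩ := h2
    have hu : IsUnit p := by rw [PowerSeries.isUnit_iff_constantCoeff, hp1]; exact isUnit_one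
    obtain ⟨w, rfl⟩ := hu
    refine ⟨(w⁻¹ : (PowerSeries A)ˣ), ?_, ?_⟩
    · have e1 := yPow_mul_neg c 1
      have e2 : (HahnSeries.single (-1 : ℤ) (1 : A) * HahnSeries.ofPowerSeries ℤ A w) *
          (HahnSeries.single (- -1 : ℤ) (1 : A) * HahnSeries.ofPowerSeries ℤ A
            ((w⁻¹ : (PowerSeries A)ˣ) : PowerSeries A)) = 1 := by
        rw [mul_mul_mul_comm, HahnSeries.single_mul_single, ← map_mul, Units.mul_inv]
        simp
      rw [← hp] at e2
      exact left_inv_eq_right_inv (by rw [mul_comm]; exact e1) e2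
    · have := congrArg PowerSeries.constantCoeff (Units.inv_mul w)
      rwa [map_mul, hp1, mul_one, map_one] at this
  induction k using Int.induction_on with
  | zero => rw [yPow_zero]; exact (HasTop.const 1).cast (by simp) rfl rfl
  | succ k ih => rw [yPow_add]; exact (ih.mul h2).cast rfl rfl (by simp)
  | pred k ih => rw [sub_eq_add_neg, yPow_add]; exact (ih.mul h3).cast rfl rfl (by simp)

/-- Two-parameter arrays satisfying a Pascal recursion: the top coefficients depend only on
the sum of the indices. -/
lemma HasTop.pascal (e : ℤ → ℤ → LaurentSeries A) (s : A)
    (he : ∀ k j, e (k + 1) j = e k (j + 1) + HahnSeries.C s * e k j)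
    (hb : ∃ D', ∀ k j, ∃ a, HasTop (e k j) (k + j + D') a)
    (D : ℤ) (a : ℤ → A) (h0 : ∀ j, HasTop (e 0 j) (j + D) (a j)) :
    (∀ k j, HasTop (e k j) (k + j + D) (a (k + j))) ∧
    ∀ k j, HasTop (e k j - e 0 (k + j)) (k + j - 1 + D) (k * s * a (k + j - 1)) := by
  have hbD : ∀ N : ℕ, (∀ k j, ∃ a, HasTop (e k j) (k + j + (D + N)) a) →
      ∀ k j, ∃ a, HasTop (e k j) (k + j + D) a := by
    intro N
    induction N with
    | zero => intro h; simpa using h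
    | succ N ih =>
      intro h
      refine ih fun k => ?_
      induction k using Int.induction_on with
      | zero => intro j; exact (h0 j).le (by omega)
      | succ k ihk =>
        intro j
        obtain ⟨a1, h1⟩ := ihk (j + 1)
        obtain ⟨a2, h2⟩ := h k j
        exact ⟨_, ((h1.cast rfl (D' := k + 1 + j + (D + N)) (by ring) rfl).add
          ((h2.const_mul s).cast rfl (by push_cast; ring) rfl)).cast (he _ _) rfl rfl⟩
      | pred k ihk =>
        intro j
        obtain ⟨a1, h1⟩ := ihk (j - 1)
        obtain ⟨a2, h2⟩ := h (-k - 1) (j - 1)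
        have e1 := he (-k - 1) (j - 1)
        rw [sub_add_cancel, sub_add_cancel] at e1
        exact ⟨_, ((h1.cast rfl (D' := -k - 1 + j + (D + N)) (by ring) rfl).sub
          ((h2.const_mul s).cast rfl (by push_cast; ring) rfl)).cast (by rw [e1]; ring) rfl rfl⟩
  have hB : ∀ k j, ∃ a, HasTop (e k j) (k + j + D) a := by
    obtain ⟨D', hD'⟩ := hb
    refine hbD (D' - D).toNat fun k j => ?_
    obtain ⟨a, ha⟩ := hD' k j
    exact ha.le (by omega)
  have h1 : ∀ k j, HasTop (e k j) (k + j + D) (a (k + j)) := by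
    intro k
    induction k using Int.induction_on with
    | zero => intro j; exact (h0 j).cast rfl (by ring) (by simp)
    | succ k ihk =>
      intro j
      obtain ⟨a2, h2⟩ := hB k j
      exact (((ihk (j + 1)).cast rfl (D' := k + 1 + j + D) (by ring) rfl).add
        ((h2.const_mul s).lower (by linarith))).cast (he _ _) (by rfl)
          (by rw [add_zero]; congr 1; ring)
    | pred k ihk =>
      intro j
      obtain ⟨a2, h2⟩ := hB (-k - 1) (j - 1)
      have e1 := he (-k - 1) (j - 1)
      rw [sub_add_cancel, sub_add_cancel] at e1
      exact (((ihk (j - 1)).cast rfl (D' := -k - 1 + j + D) (by ring) rfl).sub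
        ((h2.const_mul s).lower (by linarith))).cast (by rw [e1]; ring) (by rfl)
          (by rw [sub_zero]; congr 1; ring)
  refine ⟨h1, fun k => ?_⟩
  induction k using Int.induction_on with
  | zero => intro j; exact HasTop.zero.cast (by simp) rfl (by simp)
  | succ k ihk =>
    intro j
    refine (((ihk (j + 1)).cast rfl (D' := k + j + D) (by ring) rfl).add
      (((h1 k j).const_mul s).cast rfl (D' := k + j + D) (by ring) rfl)).cast ?_ (by ring) ?_
    · rw [he]; ring_nf
    · have e1 : (k : ℤ) + 1 + j - 1 = k + j := by ring
      have e2 : (k : ℤ) + (j + 1) - 1 = k + j := by ring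
      rw [e1, e2]; push_cast; ring
  | pred k ihk =>
    intro j
    have e0 := he (-k - 1) (j - 1)
    rw [sub_add_cancel, sub_add_cancel] at e0
    refine (((ihk (j - 1)).cast rfl (D' := -k + (j - 1) - 1 + D) (by ring) rfl).sub
      (((h1 (-k - 1) (j - 1)).const_mul s).cast rfl
        (by ring) rfl)).cast ?_ (by ring) ?_
    · rw [e0]; ring_nf
    · have e1 : -(k : ℤ) - 1 + j - 1 = -k - 1 + (j - 1) := by ring
      have e2 : -(k : ℤ) + (j - 1) - 1 = -k - 1 + (j - 1) := by ring
      rw [e1, e2]; push_cast; ring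

lemma yPow_succ_shift (c s : A) (k : ℤ) :
    yPow (c + s) (k + 1) = yPow (c + s) k * (yPow c 1 + HahnSeries.C s) := by
  rw [yPow_add_one, yPow_one, map_add, add_assoc]

lemma yPow_add_sub_dvd (c s : A) (k : ℤ) :
    HahnSeries.C s ^ 2 ∣ yPow (c + s) k - yPow c k - (k : LaurentSeries A) *
      HahnSeries.C s * yPow c (k - 1) := by
  have step : ∀ k : ℤ, yPow (c + s) (k + 1) - yPow c (k + 1)
        - ((k + 1 : ℤ) : LaurentSeries A) * HahnSeries.C s * yPow c k
      = (yPow c 1 + HahnSeries.C s) * (yPow (c + s) k - yPow c k - (k : LaurentSeries A) *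
      HahnSeries.C s * yPow c (k - 1))
        + HahnSeries.C s ^ 2 * ((k : LaurentSeries A) * yPow c (k - 1)) := by
    intro k
    have e1 : yPow c k = yPow c (k - 1) * yPow c 1 := by rw [← yPow_add, sub_add_cancel]
    rw [yPow_succ_shift, yPow_add c k, e1]
    push_cast; ring
  induction k using Int.induction_on with
  | zero => simp [yPow_zero]
  | succ k ih =>
    have := step k
    rw [add_sub_cancel_right, this]
    exact dvd_add (ih.mul_left _) (dvd_mul_right _ _)
  | pred k ih =>
    have h1 := step (-k - 1)
    rw [sub_add_cancel] at h1
    rw [h1, dvd_add_left (dvd_mul_right _ _)] at ih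
    have h2 : IsUnit (yPow c 1 + HahnSeries.C s) := by
      rw [yPow_one, add_assoc, ← map_add, ← yPow_one]
      exact Units.isUnit _
    exact (h2.dvd_mul_left).1 ih

end TopCoefficient

section InsertEquation

variable {ι B : Type*} [DecidableEq ι] [CommRing B] [Algebra ℚ B]

lemma uSer_insert_equation (x : ι → B) {e : ι} (I : Finset ι) (hI : e ∉ I) :
    12 * (genusD B (uSer x (insert e I)) + (I.card : PowerSeries B) * uSer x (insert e I)) =
      PowerSeries.X * PowerSeries.C (varSum x (insert e I)) ^ 3 * uSer x (insert e I)
        + 12 * PowerSeries.C (varSum x (insert e I)) *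
          ∑ J ∈ I.powerset, uSer x J * uSer x (insert e (I \ J)) := by
  have h := uSer_equation x (insert e I)
  have hq : qSum (uSer x) (insert e I)
      = 2 * ∑ J ∈ I.powerset, uSer x J * uSer x (insert e (I \ J)) := by
    rw [qSum, sum_powerset_insert hI, two_mul]
    congr 1
    · refine sum_congr rfl fun J hJ => ?_
      rw [insert_sdiff_of_notMem _ (fun h => hI (mem_powerset.1 hJ h))]
    · rw [← sum_powerset_compl I]
      refine sum_congr rfl fun J hJ => ?_
      rw [insert_sdiff_insert, sdiff_insert_of_notMem hI,
        Finset.sdiff_sdiff_eq_self (mem_powerset.1 hJ), mul_comm]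
  rw [hq, card_insert_of_notMem hI, map_pow] at h
  push_cast at h
  rw [add_sub_cancel_right] at h
  rw [h]; ring

end InsertEquation

section MSeries

variable {σ A : Type*} [DecidableEq σ] [CommRing A] [Algebra ℚ A] (c : σ → A)

/-- The family consisting of `y`, `-y` and the constants `c_i`. -/
def ptV : Bool ⊕ σ → LaurentSeries A
  | Sum.inl true => yV A
  | Sum.inl false => -yV A
  | Sum.inr i => HahnSeries.C (c i)

/-- The genus series of `(±y + ∑_{i ∈ I} c_i)^2 F_g(±y, c_I)`. -/
def yuSer (ε : Bool) (I : Finset σ) : PowerSeries (LaurentSeries A) :=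
  uSer (ptV c) (insert (Sum.inl ε) (I.map Function.Embedding.inr))

/-- Constants in `A((t))[[q]]`. -/
def cC (A : Type*) [CommRing A] : A →+* PowerSeries (LaurentSeries A) :=
  PowerSeries.C.comp HahnSeries.C

/-- The series `(y + a)^k` in `A((t))[[q]]`. -/
def pC (a : A) (k : ℤ) : PowerSeries (LaurentSeries A) := PowerSeries.C (yPow a k)

omit [Algebra ℚ A] in
lemma pC_add (a : A) (j k : ℤ) : pC a (j + k) = pC a j * pC a k := by
  rw [pC, yPow_add, map_mul]; rfl

omit [Algebra ℚ A] in
lemma pC_add_one (a s : A) : pC (a + s) 1 = pC a 1 + cC A s := by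
  simp [pC, cC, yPow_one, add_assoc]

lemma uSer_ptV_map_inr (K : Finset σ) :
    uSer (ptV c) (K.map Function.Embedding.inr) = PowerSeries.map HahnSeries.C (uSer c K) :=
  (uSer_map HahnSeries.C Function.Embedding.inr c (ptV c) K (fun _ _ => rfl)).symm

omit [DecidableEq σ] [Algebra ℚ A] in
lemma inl_notMem_map_inr (ε : Bool) (I : Finset σ) :
    (Sum.inl ε : Bool ⊕ σ) ∉ I.map Function.Embedding.inr := by simp

omit [DecidableEq σ] [Algebra ℚ A] in
lemma varSum_ptV_map_inr (I : Finset σ) :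
    varSum (ptV c) (I.map Function.Embedding.inr) = HahnSeries.C (varSum c I) := by
  rw [map_varSum]; simp [varSum, ptV]

omit [Algebra ℚ A] in
lemma varSum_ptV_true (I : Finset σ) :
    varSum (ptV c) (insert (Sum.inl true) (I.map Function.Embedding.inr))
      = yPow (varSum c I) 1 := by
  rw [varSum_insert _ (by simp), varSum_ptV_map_inr, yPow_one]; rfl

omit [Algebra ℚ A] in
lemma varSum_ptV_false (I : Finset σ) :
    varSum (ptV c) (insert (Sum.inl false) (I.map Function.Embedding.inr))
      = -yPow (-varSum c I) 1 := by
  rw [varSum_insert _ (by simp), varSum_ptV_map_inr, yPow_one]; simp [ptV]; ring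

lemma yuSer_equation (ε : Bool) (I : Finset σ) {u : PowerSeries (LaurentSeries A)}
    (hu : u = PowerSeries.C
      (varSum (ptV c) (insert (Sum.inl ε) (I.map Function.Embedding.inr)))) :
    12 * (genusD _ (yuSer c ε I) + (I.card : PowerSeries (LaurentSeries A)) * yuSer c ε I) =
      PowerSeries.X * u ^ 3 * yuSer c ε I
        + 12 * u * ∑ J ∈ I.powerset,
            PowerSeries.map HahnSeries.C (uSer c J) * yuSer c ε (I \ J) := by
  have h := uSer_insert_equation (ptV c) (I.map Function.Embedding.inr) (inl_notMem_map_inr ε I)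
  rw [← hu, sum_powerset_map, card_map] at h
  rw [yuSer, h]
  congr 2
  refine sum_congr rfl fun J _ => ?_
  rw [uSer_ptV_map_inr, yuSer, Finset.map_sdiff]

/-- The sums `∑_{I ⊔ J = X} (y + s + ∑ c_{Z ∪ I})^k (y + ∑ c_{Z ∪ I})^j P(Z ∪ I) N(W ∪ J)`. -/
def mSer₂ (s : A) (k j : ℤ) (Z W X : Finset σ) : PowerSeries (LaurentSeries A) :=
  ∑ I ∈ X.powerset, pC (varSum c (Z ∪ I) + s) k * pC (varSum c (Z ∪ I)) j *
    (yuSer c true (Z ∪ I) * yuSer c false (W ∪ (X \ I)))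

/-- The sums `∑_{I ⊔ J = X} (y + ∑ c_{Z ∪ I})^m P(Z ∪ I) N(W ∪ J)`. -/
def mSer (m : ℤ) (Z W X : Finset σ) : PowerSeries (LaurentSeries A) :=
  ∑ I ∈ X.powerset, pC (varSum c (Z ∪ I)) m *
    (yuSer c true (Z ∪ I) * yuSer c false (W ∪ (X \ I)))

lemma mSer₂_zero (s : A) (j : ℤ) (Z W X : Finset σ) : mSer₂ c s 0 j Z W X = mSer c j Z W X := by
  simp [mSer₂, mSer, pC, yPow_zero]

lemma mSer₂_succ (s : A) (k j : ℤ) (Z W X : Finset σ) :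
    mSer₂ c s (k + 1) j Z W X = mSer₂ c s k (j + 1) Z W X + cC A s * mSer₂ c s k j Z W X := by
  rw [mSer₂, mSer₂, mSer₂, mul_sum, ← sum_add_distrib]
  refine sum_congr rfl fun I _ => ?_
  rw [pC_add, pC_add _ j, pC_add_one]; ring

/-- The recursion for the sums `mSer`. -/
lemma mSer_equation (m : ℤ) (Z W X : Finset σ) (hZX : Disjoint Z X) (hWX : Disjoint W X) {T : A}
    (hT : T = varSum c Z + varSum c W + varSum c X) :
    12 * (genusD _ (mSer c m Z W X)
        + ((X.card + Z.card + W.card : ℕ) : PowerSeries (LaurentSeries A)) * mSer c m Z W X) =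
      PowerSeries.X * (cC A T * (3 * mSer c (m + 2) Z W X - 3 * cC A T * mSer c (m + 1) Z W X
          + cC A T ^ 2 * mSer c m Z W X))
      + 12 * (∑ A' ∈ Z.powerset, ∑ B ∈ X.powerset, PowerSeries.map HahnSeries.C (uSer c (A' ∪ B)) *
          mSer₂ c (varSum c (A' ∪ B)) (m + 1) 0 (Z \ A') W (X \ B)
        + ∑ A' ∈ W.powerset, ∑ B ∈ X.powerset, PowerSeries.map HahnSeries.C (uSer c (A' ∪ B)) *
          (cC A T * mSer c m Z (W \ A') (X \ B) - mSer c (m + 1) Z (W \ A') (X \ B))) := by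
  set u : Finset σ → PowerSeries (LaurentSeries A) := fun I => pC (varSum c (Z ∪ I)) 1 with hu
  set U : Finset σ → PowerSeries (LaurentSeries A) := fun K =>
    PowerSeries.map HahnSeries.C (uSer c K) with hU
  set P := yuSer c true with hP
  set N := yuSer c false with hN
  have hdZ : ∀ I ∈ X.powerset, Disjoint Z I := fun I hI => hZX.mono_right (mem_powerset.1 hI)
  have hdW : ∀ I ∈ X.powerset, Disjoint W (X \ I) := fun I _ => hWX.mono_right sdiff_subset
  have hp : ∀ I (j : ℕ), pC (varSum c (Z ∪ I)) (m + j) = pC (varSum c (Z ∪ I)) m * u I ^ j := by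
    intro I j
    rw [pC_add]
    congr 1
    simp [hu, pC, yPow]
  have hp1 : ∀ I, pC (varSum c (Z ∪ I)) (m + 1) = pC (varSum c (Z ∪ I)) m * u I := fun I => by
    simpa using hp I 1
  have hp2 : ∀ I, pC (varSum c (Z ∪ I)) (m + 2) = pC (varSum c (Z ∪ I)) m * u I ^ 2 := fun I => by
    simpa using hp I 2
  have hv : ∀ I ∈ X.powerset, cC A T - u I = PowerSeries.C
      (varSum (ptV c) (insert (Sum.inl false) ((W ∪ (X \ I)).map Function.Embedding.inr))) := by
    intro I hI
    rw [varSum_ptV_false, hT, varSum_union c (hdW I hI), varSum_sdiff c (mem_powerset.1 hI)]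
    simp only [hu, pC, cC, RingHom.comp_apply, ← map_sub]
    congr 1
    rw [yPow_one, yPow_one, varSum_union c (hdZ I hI)]
    simp only [map_add, map_sub, map_neg]
    ring
  have hterm : ∀ I ∈ X.powerset, 12 * (genusD _ (P (Z ∪ I) * N (W ∪ (X \ I)))
        + ((X.card + Z.card + W.card : ℕ) : PowerSeries (LaurentSeries A)) *
          (P (Z ∪ I) * N (W ∪ (X \ I))))
      = PowerSeries.X * (cC A T * (3 * u I ^ 2 - 3 * cC A T * u I + cC A T ^ 2)) *
          (P (Z ∪ I) * N (W ∪ (X \ I)))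
        + 12 * (u I * (∑ K ∈ (Z ∪ I).powerset, U K * P ((Z ∪ I) \ K)) * N (W ∪ (X \ I))
        + (cC A T - u I) * P (Z ∪ I) *
          ∑ K ∈ (W ∪ (X \ I)).powerset, U K * N ((W ∪ (X \ I)) \ K)) := by
    intro I hI
    have e1 := yuSer_equation c true (Z ∪ I) (u := u I) (by rw [varSum_ptV_true]; rfl)
    have e2 := yuSer_equation c false (W ∪ (X \ I)) (hv I hI)
    have hcard : (X.card + Z.card + W.card : ℕ) = (Z ∪ I).card + (W ∪ (X \ I)).card := by
      rw [card_union_of_disjoint (hdZ I hI), card_union_of_disjoint (hdW I hI)]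
      have := card_sdiff_add_card_eq_card (mem_powerset.1 hI)
      omega
    rw [hcard, genusD_mul]
    push_cast
    linear_combination N (W ∪ (X \ I)) * e1 + P (Z ∪ I) * e2
  have hL : 12 * (genusD _ (mSer c m Z W X)
        + ((X.card + Z.card + W.card : ℕ) : PowerSeries (LaurentSeries A)) * mSer c m Z W X)
      = ∑ I ∈ X.powerset, pC (varSum c (Z ∪ I)) m * (12 * (genusD _ (P (Z ∪ I) * N (W ∪ (X \ I)))
        + ((X.card + Z.card + W.card : ℕ) : PowerSeries (LaurentSeries A)) *
          (P (Z ∪ I) * N (W ∪ (X \ I))))) := by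
    rw [mSer, map_sum, mul_sum, ← sum_add_distrib, mul_sum]
    refine sum_congr rfl fun I _ => ?_
    rw [genusD_mul, pC, genusD_C]; ring
  have h1 : ∑ A' ∈ Z.powerset, ∑ B ∈ X.powerset, U (A' ∪ B) *
          mSer₂ c (varSum c (A' ∪ B)) (m + 1) 0 (Z \ A') W (X \ B)
      = ∑ I ∈ X.powerset, pC (varSum c (Z ∪ I)) m *
        (u I * (∑ K ∈ (Z ∪ I).powerset, U K * P ((Z ∪ I) \ K)) * N (W ∪ (X \ I))) := by
    have s1 : ∀ I ∈ X.powerset, pC (varSum c (Z ∪ I)) m *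
        (u I * (∑ K ∈ (Z ∪ I).powerset, U K * P ((Z ∪ I) \ K)) * N (W ∪ (X \ I)))
        = ∑ A' ∈ Z.powerset, ∑ B ∈ I.powerset,
          pC (varSum c (Z ∪ (B ∪ (I \ B)))) (m + 1) * U (A' ∪ B) *
            P ((Z \ A') ∪ (I \ B)) * N (W ∪ (X \ I)) := by
      intro I hI
      have hd := hdZ I hI
      rw [sum_powerset_union hd, mul_sum, sum_mul, mul_sum]
      refine sum_congr rfl fun A' hA => ?_
      rw [mul_sum, sum_mul, mul_sum]
      refine sum_congr rfl fun B hB => ?_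
      have hs : (Z ∪ I) \ (A' ∪ B) = (Z \ A') ∪ (I \ B) := by
        ext i
        have n1 : i ∈ Z → i ∉ I := fun a b => disjoint_left.1 hd a b
        have n2 : i ∈ A' → i ∈ Z := fun h => mem_powerset.1 hA h
        have n3 : i ∈ B → i ∈ I := fun h => mem_powerset.1 hB h
        simp only [mem_union, mem_sdiff]
        tauto
      rw [hs, union_sdiff_of_subset (mem_powerset.1 hB), hp1]; ring
    rw [sum_congr rfl s1]
    conv_rhs => rw [sum_comm]
    refine sum_congr rfl fun A' hA => ?_
    rw [sum_powerset_powerset X (fun B J E => pC (varSum c (Z ∪ (B ∪ J))) (m + 1) * U (A' ∪ B) *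
            P ((Z \ A') ∪ J) * N (W ∪ E))]
    refine sum_congr rfl fun B hB => ?_
    rw [mSer₂, mul_sum]
    refine sum_congr rfl fun J hJ => ?_
    have hA' := mem_powerset.1 hA
    have hB' := mem_powerset.1 hB
    have hJ' := mem_powerset.1 hJ
    have hs : varSum c ((Z \ A') ∪ J) + varSum c (A' ∪ B) = varSum c (Z ∪ (B ∪ J)) := by
      have d1 : Disjoint (Z \ A') J :=
        disjoint_of_subset_left sdiff_subset (hZX.mono_right (hJ'.trans sdiff_subset))
      have d2 : Disjoint A' B := hZX.mono hA' hB'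
      have d3 : Disjoint B J := disjoint_sdiff.mono_right hJ'
      have d4 : Disjoint Z (B ∪ J) := hZX.mono_right (union_subset hB' (hJ'.trans sdiff_subset))
      rw [varSum_union c d1, varSum_union c d2, varSum_union c d4, varSum_union c d3,
        varSum_sdiff c hA']
      ring
    have h0 : pC (varSum c ((Z \ A') ∪ J)) 0 = 1 := by simp [pC, yPow_zero]
    rw [hs, h0]; ring
  have h2 : ∑ A' ∈ W.powerset, ∑ B ∈ X.powerset, U (A' ∪ B) *
          (cC A T * mSer c m Z (W \ A') (X \ B) - mSer c (m + 1) Z (W \ A') (X \ B))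
      = ∑ I ∈ X.powerset, pC (varSum c (Z ∪ I)) m *
        ((cC A T - u I) * P (Z ∪ I) *
          ∑ K ∈ (W ∪ (X \ I)).powerset, U K * N ((W ∪ (X \ I)) \ K)) := by
    rw [← sum_powerset_compl X]
    have s1 : ∀ I ∈ X.powerset, pC (varSum c (Z ∪ (X \ I))) m *
        ((cC A T - u (X \ I)) * P (Z ∪ (X \ I)) *
          ∑ K ∈ (W ∪ (X \ (X \ I))).powerset, U K * N ((W ∪ (X \ (X \ I))) \ K))
        = ∑ A' ∈ W.powerset, ∑ B ∈ I.powerset,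
          U (A' ∪ B) * (pC (varSum c (Z ∪ (X \ I))) m *
            ((cC A T - u (X \ I)) * P (Z ∪ (X \ I)) * N ((W \ A') ∪ (I \ B)))) := by
      intro I hI
      have hd : Disjoint W I := hWX.mono_right (mem_powerset.1 hI)
      rw [Finset.sdiff_sdiff_eq_self (mem_powerset.1 hI), sum_powerset_union hd, mul_sum, mul_sum]
      refine sum_congr rfl fun A' hA => ?_
      rw [mul_sum, mul_sum]
      refine sum_congr rfl fun B hB => ?_
      have hs : (W ∪ I) \ (A' ∪ B) = (W \ A') ∪ (I \ B) := by
        ext i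
        have n1 : i ∈ W → i ∉ I := fun a b => disjoint_left.1 hd a b
        have n2 : i ∈ A' → i ∈ W := fun h => mem_powerset.1 hA h
        have n3 : i ∈ B → i ∈ I := fun h => mem_powerset.1 hB h
        simp only [mem_union, mem_sdiff]
        tauto
      rw [hs]; ring
    rw [sum_congr rfl s1]
    conv_rhs => rw [sum_comm]
    refine sum_congr rfl fun A' hA => ?_
    rw [sum_powerset_powerset X (fun B J E => U (A' ∪ B) * (pC (varSum c (Z ∪ E)) m *
            ((cC A T - u E) * P (Z ∪ E) * N ((W \ A') ∪ J))))]
    refine sum_congr rfl fun B hB => ?_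
    rw [← mul_sum, ← sum_powerset_compl (X \ B)]
    congr 1
    rw [mSer, mSer, mul_sum, ← sum_sub_distrib]
    refine sum_congr rfl fun J hJ => ?_
    rw [Finset.sdiff_sdiff_eq_self (mem_powerset.1 hJ), hp1]; ring
  rw [h1, h2, hL, sum_congr rfl (fun I hI => by rw [hterm I hI]), ← sum_add_distrib, mSer, mSer,
    mSer, mul_sum, mul_sum, mul_sum, ← sum_sub_distrib, ← sum_add_distrib, mul_sum, mul_sum,
    mul_sum, ← sum_add_distrib]
  refine sum_congr rfl fun I _ => ?_
  rw [hp1, hp2]; ring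

end MSeries

section GradedTop

variable {A : Type*} [CommRing A]

/-- The coefficient of `q^g` in `f` has `y`-degree at most `2g + D`, the coefficient of `y^{2g+D}`
being given by `τ`. -/
def QTop (f : PowerSeries (LaurentSeries A)) (D : ℤ) (τ : PowerSeries A) : Prop :=
  ∀ g : ℕ, HasTop (PowerSeries.coeff g f) (2 * g + D) (PowerSeries.coeff g τ)

namespace QTop

variable {f h : PowerSeries (LaurentSeries A)} {D E : ℤ} {τ ρ : PowerSeries A}

lemma unique (hf : QTop f D τ) (hh : QTop f D ρ) : τ = ρ :=
  PowerSeries.ext fun g => (hf g).unique (hh g)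

lemma cast (hf : QTop f D τ) {f' : PowerSeries (LaurentSeries A)} {D' : ℤ} {τ' : PowerSeries A}
    (h1 : f' = f) (h2 : D' = D) (h3 : τ' = τ) : QTop f' D' τ' := by
  subst h1 h2 h3; exact hf

lemma add (hf : QTop f D τ) (hh : QTop h D ρ) : QTop (f + h) D (τ + ρ) := fun g =>
  ((hf g).add (hh g)).cast (map_add _ _ _) rfl (map_add _ _ _)

lemma sub (hf : QTop f D τ) (hh : QTop h D ρ) : QTop (f - h) D (τ - ρ) := fun g =>
  ((hf g).sub (hh g)).cast (map_sub _ _ _) rfl (map_sub _ _ _)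

lemma mul (hf : QTop f D τ) (hh : QTop h E ρ) : QTop (f * h) (D + E) (τ * ρ) := fun g => by
  rw [PowerSeries.coeff_mul, PowerSeries.coeff_mul]
  refine HasTop.sum _ fun p hp => ?_
  refine ((hf p.1).mul (hh p.2)).cast rfl ?_ rfl
  rw [← mem_antidiagonal.1 hp]; push_cast; ring

lemma lower (hf : QTop f D τ) (hD : D < E) : QTop f E 0 := fun g =>
  ((hf g).lower (by linarith)).cast rfl rfl (by simp)

lemma sum {κ : Type*} (s : Finset κ) {f : κ → PowerSeries (LaurentSeries A)}
    {τ : κ → PowerSeries A} (hf : ∀ i ∈ s, QTop (f i) D (τ i)) :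
    QTop (∑ i ∈ s, f i) D (∑ i ∈ s, τ i) := fun g =>
  (HasTop.sum s fun i hi => hf i hi g).cast (map_sum _ _ _) rfl (map_sum _ _ _)

lemma const (a : A) : QTop (cC A a) 0 (PowerSeries.C a) := fun g => by
  rw [cC, RingHom.comp_apply, PowerSeries.coeff_C, PowerSeries.coeff_C]
  split_ifs with hg
  · subst hg; exact (HasTop.const a).cast rfl (by simp) rfl
  · exact HasTop.zero

lemma natCast (n : ℕ) : QTop (n : PowerSeries (LaurentSeries A)) 0 (n : PowerSeries A) :=
  (const (n : A)).cast (by simp) rfl (by simp)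

lemma X_mul (hf : QTop f D τ) :
    QTop (PowerSeries.X * f) (D - 2) (PowerSeries.X * τ) := fun g => by
  cases g with
  | zero => simpa using HasTop.zero
  | succ g =>
    rw [PowerSeries.coeff_succ_X_mul, PowerSeries.coeff_succ_X_mul]
    exact (hf g).cast rfl (by push_cast; ring) rfl

lemma genusD (hf : QTop f D τ) : QTop (genusD _ f) D (genusD _ τ) := fun g => by
  rw [coeff_genusD, coeff_genusD]
  exact ((hf g).const_mul (2 * g : A)).cast (by rw [map_mul, map_ofNat, map_natCast]) rfl rfl

/-- Series with constant coefficients in positive genus contribute through genus zero only. -/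
lemma map_C (u : PowerSeries A) :
    QTop (PowerSeries.map HahnSeries.C u) 0 (PowerSeries.C (PowerSeries.coeff 0 u)) := fun g => by
  rw [PowerSeries.coeff_map, PowerSeries.coeff_C]
  split_ifs with hg
  · subst hg; exact (HasTop.const _).cast rfl (by simp) rfl
  · exact (HasTop.const _).lower (by omega)

end QTop

end GradedTop

section SumPowerset

lemma sum_powerset_erase_empty {ι M : Type*} [DecidableEq ι] [AddCommMonoid M] (Z : Finset ι)
    (f : Finset ι → M) (hf : ∀ I, 2 ≤ I.card → f I = 0) :
    ∑ I ∈ Z.powerset.erase ∅, f I = ∑ z ∈ Z, f {z} := by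
  have h : ∑ I ∈ Z.powerset.erase ∅, f I = ∑ I ∈ Z.powersetCard 1, f I := by
    symm
    refine sum_subset ?_ ?_
    · intro I hI
      rw [mem_powersetCard] at hI
      rw [mem_erase, mem_powerset]
      refine ⟨?_, hI.1⟩
      rintro rfl
      simp at hI
    · intro I hI hI'
      rw [mem_erase, mem_powerset] at hI
      rw [mem_powersetCard] at hI'
      refine hf I ?_
      have h0 : I.card ≠ 0 := by simpa using hI.1
      have h1 : I.card ≠ 1 := fun h => hI' ⟨hI.2, h⟩
      omega
  rw [h, powersetCard_one, sum_map]
  rfl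

end SumPowerset

section TopRecursion

variable {σ A : Type*} [DecidableEq σ] [CommRing A] [Algebra ℚ A] (c : σ → A)

/-- The top coefficients of the series `mSer`. -/
def tau (m : ℤ) (Z W X : Finset σ) : PowerSeries A := PowerSeries.mk fun g =>
  (PowerSeries.coeff g (mSer c m Z W X)).coeff (-(2 * g + (m + Z.card + W.card)))

/-- The right hand side of the recursion for the top coefficients. -/
def rho (m : ℤ) (Z W X : Finset σ) (T : A) : PowerSeries A :=
  ∑ B ∈ X.powerset, PowerSeries.C (uFun c B 0 * ((m + 1) * varSum c B + T)) * tau c m Z W (X \ B)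
  + ∑ z ∈ Z, ∑ B ∈ X.powerset, PowerSeries.C (uFun c ({z} ∪ B) 0)
      * tau c (m + 1) (Z \ {z}) W (X \ B)
  - ∑ w ∈ W, ∑ B ∈ X.powerset, PowerSeries.C (uFun c ({w} ∪ B) 0)
      * tau c (m + 1) Z (W \ {w}) (X \ B)

/-- The series `mSer` have the expected degree. -/
def MTop (Z W X : Finset σ) : Prop :=
  ∀ m, QTop (mSer c m Z W X) (m + Z.card + W.card) (tau c m Z W X)

variable {c}

omit [Algebra ℚ A] in
lemma coeff_cC_mul (s : A) (f : PowerSeries (LaurentSeries A)) (g : ℕ) :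
    PowerSeries.coeff g (cC A s * f) = HahnSeries.C s * PowerSeries.coeff g f := by
  rw [cC, RingHom.comp_apply, PowerSeries.coeff_C_mul]

lemma MTop.pascal {Z W X : Finset σ} (h : MTop c Z W X) (s : A) (k j : ℤ) :
    QTop (mSer₂ c s k j Z W X) (k + j + Z.card + W.card) (tau c (k + j) Z W X) ∧
    QTop (mSer₂ c s k j Z W X - mSer c (k + j) Z W X) (k + j - 1 + Z.card + W.card)
      (PowerSeries.C (k * s) * tau c (k + j - 1) Z W X) := by
  have key : ∀ g : ℕ, _ := fun g =>
    HasTop.pascal (fun k j => PowerSeries.coeff g (mSer₂ c s k j Z W X)) s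
      (fun k j => by
        simp only [mSer₂_succ]
        rw [map_add, coeff_cC_mul])
      (by
        obtain ⟨D, hD⟩ := HasTop.exists_degree_family X.powerset fun I =>
          PowerSeries.coeff g (yuSer c true (Z ∪ I) * yuSer c false (W ∪ (X \ I)))
        choose! a ha using hD
        refine ⟨D, fun k j => ⟨∑ I ∈ X.powerset, 1 * 1 * a I, ?_⟩⟩
        rw [mSer₂, map_sum]
        refine HasTop.sum _ fun I hI => ?_
        rw [pC, pC, ← map_mul, PowerSeries.coeff_C_mul]
        exact ((hasTop_yPow _ k).mul (hasTop_yPow _ j)).mul (ha I hI))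
      (2 * g + (Z.card + W.card)) (fun j => PowerSeries.coeff g (tau c j Z W X))
      (fun j => (h j g).cast (by simp only [mSer₂_zero]) (by ring) rfl)
  refine ⟨fun g => ((key g).1 k j).cast rfl (by ring) rfl,
    fun g => ((key g).2 k j).cast ?_ (by ring) ?_⟩
  · simp only [mSer₂_zero, map_sub]
  · rw [PowerSeries.coeff_C_mul]

/-- The top coefficients of the quadratic terms of `mSer_equation`. -/
lemma qTop_rho (m : ℤ) (Z W X : Finset σ) (T : A)
    (ih : ∀ Z' W' X', Z' ⊆ Z → W' ⊆ W → X' ⊆ X →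
      Z'.card + W'.card + X'.card < Z.card + W.card + X.card → MTop c Z' W' X') :
    QTop (∑ A' ∈ Z.powerset, ∑ B ∈ X.powerset,
          PowerSeries.map HahnSeries.C (uSer c (A' ∪ B)) *
            mSer₂ c (varSum c (A' ∪ B)) (m + 1) 0 (Z \ A') W (X \ B)
        + ∑ A' ∈ W.powerset, ∑ B ∈ X.powerset,
          PowerSeries.map HahnSeries.C (uSer c (A' ∪ B)) *
          (cC A T * mSer c m Z (W \ A') (X \ B) - mSer c (m + 1) Z (W \ A') (X \ B)))
      (m + Z.card + W.card) (rho c m Z W X T) := by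
  have hU : ∀ K, QTop (PowerSeries.map HahnSeries.C (uSer c K)) 0 (PowerSeries.C (uFun c K 0)) :=
    fun K => by simpa only [coeff_uSer] using QTop.map_C (uSer c K)
  rw [← add_sum_erase Z.powerset _ (empty_mem_powerset Z),
    ← add_sum_erase W.powerset _ (empty_mem_powerset W)]
  have h0 : QTop (∑ B ∈ X.powerset, PowerSeries.map HahnSeries.C (uSer c B) *
        ((mSer₂ c (varSum c B) (m + 1) 0 Z W (X \ B) - mSer c (m + 1 + 0) Z W (X \ B))
          + cC A T * mSer c m Z W (X \ B))) (m + Z.card + W.card)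
      (∑ B ∈ X.powerset, PowerSeries.C (uFun c B 0 * ((m + 1) * varSum c B + T))
        * tau c m Z W (X \ B)) := by
    refine QTop.sum _ fun B hB => ?_
    rcases B.eq_empty_or_nonempty with rfl | hne
    · rw [uSer_empty, uFun_empty]
      exact fun g => by simpa using HasTop.zero
    have hM : MTop c Z W (X \ B) := by
      refine ih _ _ _ subset_rfl subset_rfl sdiff_subset ?_
      have := card_sdiff_add_card_eq_card (mem_powerset.1 hB)
      have := hne.card_pos
      omega
    refine ((hU B).mul ((((hM.pascal (varSum c B) (m + 1) 0).2).cast rfl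
      (D' := m + Z.card + W.card) (by ring) rfl).add
      (((QTop.const T).mul (hM m)).cast rfl (zero_add _).symm rfl))).cast rfl (zero_add _).symm ?_
    rw [show m + 1 + 0 - 1 = m by ring, map_mul, map_add]
    push_cast; ring
  have h1 : QTop (∑ A' ∈ Z.powerset.erase ∅, ∑ B ∈ X.powerset,
          PowerSeries.map HahnSeries.C (uSer c (A' ∪ B)) *
            mSer₂ c (varSum c (A' ∪ B)) (m + 1) 0 (Z \ A') W (X \ B)) (m + Z.card + W.card)
      (∑ z ∈ Z, ∑ B ∈ X.powerset, PowerSeries.C (uFun c ({z} ∪ B) 0)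
        * tau c (m + 1) (Z \ {z}) W (X \ B)) := by
    have e := sum_powerset_erase_empty Z (fun A' => if A'.card = 1 then
      ∑ B ∈ X.powerset, PowerSeries.C (uFun c (A' ∪ B) 0)
        * tau c (m + 1) (Z \ A') W (X \ B) else 0) (fun I hI => if_neg (by omega))
    simp only [card_singleton, if_true] at e
    rw [← e]
    refine QTop.sum _ fun A' hA => ?_
    rw [mem_erase, mem_powerset] at hA
    have hc := card_sdiff_add_card_eq_card hA.2
    have hp := (nonempty_iff_ne_empty.2 hA.1).card_pos
    have hB : ∀ B ∈ X.powerset, QTop (PowerSeries.map HahnSeries.C (uSer c (A' ∪ B)) *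
            mSer₂ c (varSum c (A' ∪ B)) (m + 1) 0 (Z \ A') W (X \ B))
        (m + 1 + (Z \ A').card + W.card) (PowerSeries.C (uFun c (A' ∪ B) 0)
        * tau c (m + 1) (Z \ A') W (X \ B)) := by
      intro B hB
      have hM : MTop c (Z \ A') W (X \ B) := by
        refine ih _ _ _ sdiff_subset subset_rfl sdiff_subset ?_
        have := card_sdiff_add_card_eq_card (mem_powerset.1 hB)
        omega
      exact ((hU _).mul (hM.pascal (varSum c (A' ∪ B)) (m + 1) 0).1).cast rfl (by ring)
        (by rw [add_zero])
    split_ifs with h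
    · exact (QTop.sum _ hB).cast rfl (by omega) rfl
    · exact (QTop.sum _ hB).lower (by omega)
  have h2 : QTop (∑ A' ∈ W.powerset.erase ∅, ∑ B ∈ X.powerset,
          PowerSeries.map HahnSeries.C (uSer c (A' ∪ B)) *
          (cC A T * mSer c m Z (W \ A') (X \ B) - mSer c (m + 1) Z (W \ A') (X \ B)))
      (m + Z.card + W.card)
      (∑ w ∈ W, ∑ B ∈ X.powerset, -(PowerSeries.C (uFun c ({w} ∪ B) 0)
        * tau c (m + 1) Z (W \ {w}) (X \ B))) := by
    have e := sum_powerset_erase_empty W (fun A' => if A'.card = 1 then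
      ∑ B ∈ X.powerset, -(PowerSeries.C (uFun c (A' ∪ B) 0)
        * tau c (m + 1) Z (W \ A') (X \ B)) else 0) (fun I hI => if_neg (by omega))
    simp only [card_singleton, if_true] at e
    rw [← e]
    refine QTop.sum _ fun A' hA => ?_
    rw [mem_erase, mem_powerset] at hA
    have hc := card_sdiff_add_card_eq_card hA.2
    have hp := (nonempty_iff_ne_empty.2 hA.1).card_pos
    have hB : ∀ B ∈ X.powerset, QTop (PowerSeries.map HahnSeries.C (uSer c (A' ∪ B)) *
            (cC A T * mSer c m Z (W \ A') (X \ B) - mSer c (m + 1) Z (W \ A') (X \ B)))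
        (m + 1 + Z.card + (W \ A').card) (-(PowerSeries.C (uFun c (A' ∪ B) 0)
        * tau c (m + 1) Z (W \ A') (X \ B))) := by
      intro B hB
      have hM : MTop c Z (W \ A') (X \ B) := by
        refine ih _ _ _ subset_rfl sdiff_subset sdiff_subset ?_
        have := card_sdiff_add_card_eq_card (mem_powerset.1 hB)
        omega
      exact ((hU _).mul ((((QTop.const T).mul (hM m)).lower (by omega)).sub (hM (m + 1)))).cast
        rfl (by ring) (by ring)
    split_ifs with h
    · exact (QTop.sum _ hB).cast rfl (by omega) rfl
    · exact (QTop.sum _ hB).lower (by omega)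
  refine ((h0.add h1).add h2).cast ?_ rfl ?_
  · simp only [empty_union, sdiff_empty, add_zero, mul_add, mul_sub, sum_add_distrib,
      sum_sub_distrib]
    ring
  · simp only [rho, sum_neg_distrib, sub_eq_add_neg]

lemma HasTop.of_natCast_mul {f : LaurentSeries A} {D : ℤ} {a : A} {k : ℕ} (hk : k ≠ 0)
    (h : HasTop ((k : LaurentSeries A) * f) D a) : ∃ b, HasTop f D b := by
  refine ⟨_, (h.const_mul (algebraMap ℚ A (k : ℚ)⁻¹)).cast ?_ rfl rfl⟩
  have e : (algebraMap ℚ A (k : ℚ)⁻¹) * (k : A) = 1 := by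
    rw [← map_natCast (algebraMap ℚ A) k, ← map_mul,
      inv_mul_cancel₀ (by exact_mod_cast hk), map_one]
  rw [← mul_assoc, ← map_natCast (HahnSeries.C : A →+* LaurentSeries A) k, ← map_mul, e, map_one,
    one_mul]

lemma hasTop_coeff_zero_mSer_empty (m : ℤ) :
    HasTop (PowerSeries.coeff 0 (mSer c m ∅ ∅ ∅)) m 1 := by
  have h : ∀ ε, PowerSeries.coeff 0 (yuSer c ε ∅) = 1 := fun ε => by
    rw [yuSer, coeff_uSer]; exact uFun_zero_of_card_eq_one _ (by simp)
  rw [mSer]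
  simp only [powerset_empty, sum_singleton, empty_union, sdiff_empty]
  rw [pC, PowerSeries.coeff_C_mul, PowerSeries.coeff_zero_eq_constantCoeff_apply, map_mul,
    ← PowerSeries.coeff_zero_eq_constantCoeff_apply,
    ← PowerSeries.coeff_zero_eq_constantCoeff_apply, h, h, one_mul, mul_one]
  exact hasTop_yPow _ m

lemma mTop (Z W X : Finset σ) (hZX : Disjoint Z X) (hWX : Disjoint W X) : MTop c Z W X := by
  induction hN : Z.card + W.card + X.card using Nat.strong_induction_on generalizing Z W X with
  | _ N ih =>
  have ih' : ∀ Z' W' X', Z' ⊆ Z → W' ⊆ W → X' ⊆ X →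
      Z'.card + W'.card + X'.card < Z.card + W.card + X.card → MTop c Z' W' X' :=
    fun Z' W' X' hZ hW hX hlt => ih _ (by omega) Z' W' X' (hZX.mono hZ hX) (hWX.mono hW hX) rfl
  suffices h : ∀ (g : ℕ) (m : ℤ), ∃ a,
      HasTop (PowerSeries.coeff g (mSer c m Z W X)) (2 * g + (m + Z.card + W.card)) a by
    intro m g
    obtain ⟨a, ha⟩ := h g m
    rw [tau, PowerSeries.coeff_mk]
    exact ha.self
  intro g
  induction g with
  | zero =>
    intro m
    by_cases h0 : N = 0
    · obtain ⟨hZ, hW, hX⟩ : Z.card = 0 ∧ W.card = 0 ∧ X.card = 0 := by omega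
      rw [card_eq_zero] at hZ hW hX
      subst hZ hW hX
      exact ⟨1, (hasTop_coeff_zero_mSer_empty m).cast rfl (by simp) rfl⟩
    · have e := congrArg (PowerSeries.coeff 0) (mSer_equation c m Z W X hZX hWX rfl)
      have hr := qTop_rho m Z W X (varSum c Z + varSum c W + varSum c X) ih' 0
      refine HasTop.of_natCast_mul (k := 12 * N) (by omega)
        (D := 2 * (0 : ℕ) + (m + Z.card + W.card)) ((hr.const_mul 12).cast ?_ rfl rfl)
      have hk : X.card + Z.card + W.card = N := by omega
      rw [hk] at e
      have h12 : (12 : PowerSeries (LaurentSeries A)) = PowerSeries.C 12 :=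
      (map_ofNat PowerSeries.C 12).symm
      have hNC : (N : PowerSeries (LaurentSeries A)) = PowerSeries.C (N : LaurentSeries A) :=
      (map_natCast PowerSeries.C N).symm
      rw [h12, hNC, PowerSeries.coeff_C_mul, map_add, coeff_genusD, PowerSeries.coeff_C_mul,
        map_add, PowerSeries.coeff_zero_X_mul, PowerSeries.coeff_C_mul] at e
      have h12' : (HahnSeries.C (12 : A) : LaurentSeries A) = 12 := map_ofNat _ 12
      rw [zero_add] at e
      rw [h12', ← e]
      push_cast; ring
  | succ g ihg =>
    intro m
    obtain ⟨T, hT⟩ : ∃ T, T = varSum c Z + varSum c W + varSum c X := ⟨_, rfl⟩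
    have e := congrArg (PowerSeries.coeff (g + 1)) (mSer_equation c m Z W X hZX hWX hT)
    have hr := qTop_rho m Z W X T ih' (g + 1)
    obtain ⟨a2, h2⟩ := ihg (m + 2)
    obtain ⟨a1, h1⟩ := ihg (m + 1)
    obtain ⟨a0, h0⟩ := ihg m
    have hx := ((((h2.const_mul 3).cast rfl
        (D' := 2 * (g + 1 : ℕ) + (m + Z.card + W.card)) (by push_cast; ring) rfl).sub
      (((h1.const_mul T).const_mul 3).lower
        (E := 2 * (g + 1 : ℕ) + (m + Z.card + W.card)) (by push_cast; omega))).add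
      (((h0.const_mul T).const_mul T).lower
        (E := 2 * (g + 1 : ℕ) + (m + Z.card + W.card)) (by push_cast; omega))).const_mul T
    refine HasTop.of_natCast_mul (k := 12 * (2 * (g + 1) + N)) (by omega)
      ((hx.add (hr.const_mul 12)).cast ?_ rfl rfl)
    have hk : X.card + Z.card + W.card = N := by omega
    rw [hk] at e
    have h12 : (12 : PowerSeries (LaurentSeries A)) = PowerSeries.C 12 :=
      (map_ofNat PowerSeries.C 12).symm
    have h3 : (3 : PowerSeries (LaurentSeries A)) = cC A 3 := (map_ofNat _ 3).symm
    have hNC : (N : PowerSeries (LaurentSeries A)) = PowerSeries.C (N : LaurentSeries A) :=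
      (map_natCast PowerSeries.C N).symm
    rw [h12, hNC, h3, pow_two, PowerSeries.coeff_C_mul, map_add, coeff_genusD,
      PowerSeries.coeff_C_mul, map_add, PowerSeries.coeff_succ_X_mul, PowerSeries.coeff_C_mul,
      coeff_cC_mul, map_add, map_sub, mul_assoc (cC A 3), mul_assoc (cC A T), coeff_cC_mul,
      coeff_cC_mul, coeff_cC_mul, coeff_cC_mul, coeff_cC_mul] at e
    have h12' : (HahnSeries.C (12 : A) : LaurentSeries A) = 12 := map_ofNat _ 12
    rw [h12', ← e]
    push_cast; ring

/-- The recursion for the top coefficients. -/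
lemma tau_equation (m : ℤ) (Z W X : Finset σ) (hZX : Disjoint Z X) (hWX : Disjoint W X) {T : A}
    (hT : T = varSum c Z + varSum c W + varSum c X) :
    12 * (genusD _ (tau c m Z W X)
        + ((X.card + Z.card + W.card : ℕ) : PowerSeries A) * tau c m Z W X) =
      PowerSeries.X * (PowerSeries.C (3 * T) * tau c (m + 2) Z W X)
        + 12 * rho c m Z W X T := by
  have h := mTop (c := c) Z W X hZX hWX
  have h12 : QTop (12 : PowerSeries (LaurentSeries A)) 0 (12 : PowerSeries A) := by
    simpa using QTop.natCast (A := A) 12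
  have e1 := (h12.mul ((h m).genusD.add (((QTop.natCast (X.card + Z.card + W.card)).mul
    (h m)).cast rfl (zero_add _).symm rfl))).cast rfl
      (D' := m + Z.card + W.card) (zero_add _).symm rfl
  rw [mSer_equation c m Z W X hZX hWX hT] at e1
  have h3 : QTop (3 : PowerSeries (LaurentSeries A)) 0 (3 : PowerSeries A) := by
    simpa using QTop.natCast (A := A) 3
  have hx := (((QTop.const T).mul ((((h3.mul (h (m + 2))).cast rfl
      (D' := m + 2 + Z.card + W.card) (by ring) rfl).sub
      (((h3.mul (QTop.const T)).mul (h (m + 1))).lower (E := m + 2 + Z.card + W.card)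
        (by omega))).add
      ((((QTop.const T).mul (QTop.const T)).mul (h m)).lower (E := m + 2 + Z.card + W.card)
        (by omega)))).X_mul)
  have hr := h12.mul (qTop_rho m Z W X T fun Z' W' X' hZ _ hX _ =>
    mTop (c := c) Z' W' X' (hZX.mono hZ hX) (hWX.mono ‹_› hX))
  have e2 := (hx.cast rfl (D' := m + Z.card + W.card) (by ring) rfl).add
    (hr.cast rfl (D' := m + Z.card + W.card) (by ring) rfl)
  refine (e1.unique (e2.cast ?_ rfl rfl)).trans ?_
  · ring
  · rw [map_mul, map_ofNat]; ring

lemma coeff_zero_tau_empty (m : ℤ) : PowerSeries.coeff 0 (tau c m ∅ ∅ ∅) = 1 :=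
  (mTop (c := c) ∅ ∅ ∅ (by simp) (by simp) m 0).unique
    ((hasTop_coeff_zero_mSer_empty m).cast rfl (by simp) rfl)

end TopRecursion

section TopDilaton

variable {σ A : Type*} [DecidableEq σ] [CommRing A] [Algebra ℚ A] {c : σ → A}

lemma PowerSeries.C_dvd_of_forall_coeff {B : Type*} [CommRing B] {a : B} {f : PowerSeries B}
    (h : ∀ g, a ∣ PowerSeries.coeff g f) : PowerSeries.C a ∣ f := by
  choose b hb using h
  exact ⟨PowerSeries.mk b, by ext g; simp [hb]⟩

lemma yuSer_insert_sub_dvd (ε : Bool) {e : σ} (I : Finset σ) (he : e ∉ I)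
    {u : PowerSeries (LaurentSeries A)}
    (hu : u = PowerSeries.C
      (varSum (ptV c) (insert (Sum.inl ε) (I.map Function.Embedding.inr)))) :
    cC A (c e) ^ 2 ∣ yuSer c ε (insert e I) - (u * yuSer c ε I + cC A (c e) *
      (genusD _ (yuSer c ε I)
        + ((I.card + 1 : ℕ) : PowerSeries (LaurentSeries A)) * yuSer c ε I)) := by
  rw [← map_pow, cC, RingHom.comp_apply]
  refine PowerSeries.C_dvd_of_forall_coeff fun g => ?_
  have h := sq_dvd_uFun_insert_sub (ptV c) (e := Sum.inr e)
    (insert (Sum.inl ε) (I.map Function.Embedding.inr)) (by simpa using he)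
    ⟨_, mem_insert_self _ _⟩ g
  have h1 : (insert (Sum.inr e) (insert (Sum.inl ε) (I.map Function.Embedding.inr)) :
      Finset (Bool ⊕ σ)) = insert (Sum.inl ε) ((insert e I).map Function.Embedding.inr) := by
    rw [map_insert, insert_comm]; rfl
  rw [h1, card_insert_of_notMem (inl_notMem_map_inr ε I), card_map] at h
  rw [map_pow]
  refine h.trans (dvd_of_eq ?_)
  have hn : ((I.card + 1 : ℕ) : PowerSeries (LaurentSeries A))
      = PowerSeries.C ((I.card + 1 : ℕ) : LaurentSeries A) := (map_natCast PowerSeries.C _).symm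
  rw [map_sub, map_add, hu, hn, RingHom.comp_apply, PowerSeries.coeff_C_mul,
    PowerSeries.coeff_C_mul, map_add, coeff_genusD, PowerSeries.coeff_C_mul, yuSer, yuSer,
    coeff_uSer, coeff_uSer]
  simp only [ptV]
  ring

omit [Algebra ℚ A] in
lemma pC_add_sub_dvd (a s : A) (k : ℤ) :
    cC A s ^ 2 ∣ pC (a + s) k - (pC a k + (k : PowerSeries (LaurentSeries A)) * cC A s
      * pC a (k - 1)) := by
  obtain ⟨w, hw⟩ := yPow_add_sub_dvd a s k
  refine ⟨PowerSeries.C w, ?_⟩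
  have := congrArg (PowerSeries.C : LaurentSeries A →+* _) hw
  simp only [map_sub, map_mul, map_pow, map_intCast] at this
  simp only [cC, pC, RingHom.comp_apply]
  rw [← this]; ring

omit [DecidableEq σ] in
lemma insert_dvd_aux {B : Type*} [CommRing B] {E T u pm pm' P P' N N' DP DN m k₁ k₂ : B}
    (hP : E ^ 2 ∣ P' - (u * P + E * (DP + k₁ * P)))
    (hN : E ^ 2 ∣ N' - ((T - u) * N + E * (DN + k₂ * N)))
    (hp : E ^ 2 ∣ pm' - (pm * u + m * E * pm)) :
    E ^ 2 ∣ pm * u * (P * N') + pm' * (P' * N) - (T * (pm * u * (P * N)) +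
      E * (pm * u * (P * DN + N * DP) + (m + (k₁ + k₂)) * (pm * u * (P * N)))) := by
  obtain ⟨p, hp'⟩ := hP
  obtain ⟨q, hq⟩ := hN
  obtain ⟨r, hr⟩ := hp
  refine ⟨pm * u * P * q + (pm * u * p + m * pm * (DP + k₁ * P) + m * E * pm * p
      + r * P') * N, ?_⟩
  linear_combination (pm * u * P) * hq + P' * N * hr + (pm * u * N + m * E * pm * N) * hp'

lemma mSer_term_insert_dvd (m : ℤ) {K L : Finset σ} {e : σ} (hK : e ∉ K) (hL : e ∉ L) {T : A}
    (hT : T = varSum c K + varSum c L) :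
    cC A (c e) ^ 2 ∣
      pC (varSum c K) m * (yuSer c true K * yuSer c false (insert e L)) +
      pC (varSum c K + c e) m * (yuSer c true (insert e K) * yuSer c false L)
      - (cC A T * (pC (varSum c K) m * (yuSer c true K * yuSer c false L))
        + cC A (c e) * (genusD _ (pC (varSum c K) m * (yuSer c true K * yuSer c false L))
          + ((m + (K.card + L.card + 2) : ℤ) : PowerSeries (LaurentSeries A)) *
            (pC (varSum c K) m * (yuSer c true K * yuSer c false L)))) := by
  have hv : cC A T - pC (varSum c K) 1 = PowerSeries.C (varSum (ptV c)
      (insert (Sum.inl false) (L.map Function.Embedding.inr))) := by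
    rw [varSum_ptV_false, hT]
    simp only [pC, cC, RingHom.comp_apply, ← map_sub]
    congr 1
    rw [yPow_one, yPow_one]
    simp only [map_add, map_neg]
    ring
  have hp := yuSer_insert_sub_dvd true (c := c) K hK
    (u := pC (varSum c K) 1) (by rw [varSum_ptV_true]; rfl)
  have hq := yuSer_insert_sub_dvd false (c := c) L hL hv
  have hr := pC_add_sub_dvd (varSum c K) (c e) m
  have hpm : pC (varSum c K) m = pC (varSum c K) (m - 1) * pC (varSum c K) 1 := by
    rw [← pC_add, sub_add_cancel]
  have hD : genusD _ (pC (varSum c K) m * (yuSer c true K * yuSer c false L))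
      = pC (varSum c K) m * (yuSer c true K * genusD _ (yuSer c false L)
        + yuSer c false L * genusD _ (yuSer c true K)) := by
    rw [genusD_mul, genusD_mul, pC, genusD_C]; ring
  have hk : ((m + (K.card + L.card + 2) : ℤ) : PowerSeries (LaurentSeries A))
      = m + (((K.card + 1 : ℕ) : PowerSeries (LaurentSeries A)) + ((L.card + 1 : ℕ))) := by
    push_cast; ring
  rw [hD, hk, hpm]
  rw [hpm] at hr
  exact insert_dvd_aux hp hq hr

lemma mSer_insert (m : ℤ) (Z W X : Finset σ) {e : σ} (heZ : e ∉ Z) (heX : e ∉ X) :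
    mSer c m Z W (insert e X) = ∑ I ∈ X.powerset,
      (pC (varSum c (Z ∪ I)) m *
        (yuSer c true (Z ∪ I) * yuSer c false (insert e (W ∪ (X \ I)))) +
      pC (varSum c (Z ∪ I) + c e) m *
        (yuSer c true (insert e (Z ∪ I)) * yuSer c false (W ∪ (X \ I)))) := by
  rw [mSer, sum_powerset_insert heX, sum_add_distrib]
  refine congrArg₂ (· + ·) (sum_congr rfl fun I hI => ?_) (sum_congr rfl fun I hI => ?_)
  · rw [insert_sdiff_of_notMem _ (fun h => heX (mem_powerset.1 hI h)), union_insert]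
  · have : e ∉ Z ∪ I := by
      rw [mem_union]; exact not_or.2 ⟨heZ, fun h => heX (mem_powerset.1 hI h)⟩
    rw [insert_sdiff_insert, sdiff_insert_of_notMem heX, union_insert,
      varSum_insert c this, add_comm (c e)]

/-- The dilaton equation for the series `mSer`. -/
lemma mSer_insert_sub_dvd (m : ℤ) (Z W X : Finset σ) {e : σ} (heZ : e ∉ Z) (heW : e ∉ W)
    (heX : e ∉ X) (hZX : Disjoint Z X) (hWX : Disjoint W X) {T : A}
    (hT : T = varSum c Z + varSum c W + varSum c X) :
    cC A (c e) ^ 2 ∣ mSer c m Z W (insert e X) - (cC A T * mSer c m Z W X + cC A (c e) *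
      (genusD _ (mSer c m Z W X) + ((m + (Z.card + W.card + X.card + 2) : ℤ) :
        PowerSeries (LaurentSeries A)) * mSer c m Z W X)) := by
  rw [mSer_insert m Z W X heZ heX, mSer, map_sum, mul_sum, mul_sum, ← sum_add_distrib, mul_sum,
    ← sum_add_distrib, ← sum_sub_distrib]
  refine dvd_sum fun I hI => ?_
  have hIX := mem_powerset.1 hI
  have hd1 : Disjoint Z I := hZX.mono_right hIX
  have hd2 : Disjoint W (X \ I) := hWX.mono_right sdiff_subset
  have h1 : e ∉ Z ∪ I := by
    rw [mem_union]; exact not_or.2 ⟨heZ, fun h => heX (hIX h)⟩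
  have h2 : e ∉ W ∪ (X \ I) := by
    rw [mem_union]; exact not_or.2 ⟨heW, fun h => heX (sdiff_subset h)⟩
  have h := mSer_term_insert_dvd (c := c) m h1 h2 (T := T) (by
    rw [hT, varSum_union c hd1, varSum_union c hd2, varSum_sdiff c hIX]; ring)
  have hcard := card_sdiff_add_card_eq_card hIX
  have hc : (m + ((Z ∪ I).card + (W ∪ (X \ I)).card + 2) : ℤ)
      = m + (Z.card + W.card + X.card + 2) := by
    rw [card_union_of_disjoint hd1, card_union_of_disjoint hd2, ← hcard]
    push_cast; ring
  rw [hc] at h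
  exact h

/-- The dilaton equation for the top coefficients. -/
lemma tau_insert_sub_dvd (m : ℤ) (Z W X : Finset σ) {e : σ} (heZ : e ∉ Z) (heW : e ∉ W)
    (heX : e ∉ X) (hZX : Disjoint Z X) (hWX : Disjoint W X) {T : A}
    (hT : T = varSum c Z + varSum c W + varSum c X) (g : ℕ) :
    c e ^ 2 ∣ PowerSeries.coeff g (tau c m Z W (insert e X)) -
      (T + c e * ((2 * g + (m + (Z.card + W.card + X.card + 2)) : ℤ) : A)) *
        PowerSeries.coeff g (tau c m Z W X) := by
  have hm := mTop (c := c) Z W X hZX hWX m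
  have hm' := mTop (c := c) Z W (insert e X) (disjoint_insert_right.2 ⟨heZ, hZX⟩)
    (disjoint_insert_right.2 ⟨heW, hWX⟩) m
  have hi : QTop ((m + (Z.card + W.card + X.card + 2) : ℤ) : PowerSeries (LaurentSeries A)) 0
      ((m + (Z.card + W.card + X.card + 2) : ℤ) : PowerSeries A) :=
    (QTop.const (A := A) ((m + (Z.card + W.card + X.card + 2) : ℤ) : A)).cast
      (map_intCast _ _).symm rfl (map_intCast _ _).symm
  have h := hm'.sub ((((QTop.const T).mul hm).cast rfl (zero_add _).symm rfl).add
    (((QTop.const (c e)).mul (hm.genusD.add ((hi.mul hm).cast rfl (zero_add _).symm rfl))).cast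
      rfl (zero_add _).symm rfl)) g
  obtain ⟨w, hw⟩ := mSer_insert_sub_dvd (c := c) m Z W X heZ heW heX hZX hWX hT
  rw [hw, pow_two, mul_assoc, coeff_cC_mul, coeff_cC_mul] at h
  refine ⟨(PowerSeries.coeff g w).coeff (-(2 * g + (m + Z.card + W.card))), ?_⟩
  have e1 := h.coeff_eq
  rw [HahnSeries.C_mul_eq_smul, HahnSeries.C_mul_eq_smul, HahnSeries.coeff_smul,
    HahnSeries.coeff_smul, smul_eq_mul, smul_eq_mul, ← mul_assoc, ← pow_two] at e1
  rw [e1]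
  have hC : ((m + (Z.card + W.card + X.card + 2) : ℤ) : PowerSeries A)
      = PowerSeries.C ((m + (Z.card + W.card + X.card + 2) : ℤ) : A) := (map_intCast _ _).symm
  rw [map_sub, map_add, PowerSeries.coeff_C_mul, PowerSeries.coeff_C_mul, map_add, coeff_genusD,
    hC, PowerSeries.coeff_C_mul]
  push_cast
  ring

end TopDilaton

section Supports

variable {σ : Type*} [DecidableEq σ]

omit [DecidableEq σ] in
lemma coeff_mul_eq_zero_of_totalDegree_lt {f h : MvPolynomial σ ℚ} {K S : Finset σ}
    (hh : h ∈ supported ℚ (S : Set σ)) (hKS : Disjoint K S) {e : σ →₀ ℕ}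
    (hf : f.totalDegree < ∑ i ∈ K, e i) : coeff e (f * h) = 0 := by
  classical
  rw [coeff_mul]
  refine sum_eq_zero fun p hp => ?_
  rw [HasAntidiagonal.mem_antidiagonal] at hp
  by_contra hne
  obtain ⟨h1, h2⟩ := mul_ne_zero_iff.1 hne
  rw [mem_supported] at hh
  have hz : ∀ i ∈ K, p.2 i = 0 := by
    intro i hi
    by_contra hi0
    have : i ∈ h.vars :=
      (mem_vars_iff_mem_support i).2 ⟨p.2, MvPolynomial.mem_support_iff.2 h2,
        Finsupp.mem_support_iff.2 hi0⟩
    exact disjoint_left.1 hKS hi (hh this)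
  have hs : ∑ i ∈ K, e i = ∑ i ∈ K, p.1 i := by
    refine sum_congr rfl fun i hi => ?_
    rw [← hp, Finsupp.add_apply, hz i hi, add_zero]
  have hle := le_totalDegree (MvPolynomial.mem_support_iff.2 h1)
  have : ∑ i ∈ K, p.1 i ≤ p.1.sum fun _ k => k := by
    rw [Finsupp.sum]
    calc ∑ i ∈ K, p.1 i ≤ ∑ i ∈ K ∪ p.1.support, p.1 i :=
          sum_le_sum_of_subset subset_union_left
      _ = ∑ i ∈ p.1.support, p.1 i := by
          refine (sum_subset subset_union_right fun i _ hi => ?_).symm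
          simpa using hi
  omega

omit [DecidableEq σ] in
lemma varSum_X_mem_supported {I S : Finset σ} (h : I ⊆ S) :
    varSum (X : σ → MvPolynomial σ ℚ) I ∈ supported ℚ (S : Set σ) :=
  sum_mem fun _ hi => X_mem_supported.2 (h hi)

lemma uFun_X_mem_supported {I S : Finset σ} (h : I ⊆ S) (g : ℕ) :
    uFun (X : σ → MvPolynomial σ ℚ) I g ∈ supported ℚ (S : Set σ) := by
  have e := uFun_map (rename (R := ℚ) (Subtype.val : I → σ)).toRingHom
    (Function.Embedding.subtype (· ∈ I)) (X : I → MvPolynomial I ℚ) (X : σ → MvPolynomial σ ℚ)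
    I.attach (fun i _ => by simp) g
  rw [attach_map_val] at e
  refine supported_mono (coe_subset.2 h) ?_
  rw [← e, supported_eq_range_rename]
  exact ⟨_, rfl⟩

lemma uFun_zero_equation (x : σ → MvPolynomial σ ℚ) (I : Finset σ) :
    uFun x I 0 * (2 * (I.card - 1)) = varSum x I *
      ∑ J ∈ I.powerset, uFun x J 0 * uFun x (I \ J) 0 := by
  have h := (coeff_uEquation (uSer x I) (qSum (uSer x) I) I.card (varSum x I) 0).1
    (congrArg _ (uSer_equation x I))
  simp only [coeff_uSer, qSum, map_sum, PowerSeries.coeff_mul, Finset.Nat.antidiagonal_zero,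
    sum_singleton] at h
  refine ratCast_smul_cancel (k := 6) (by norm_num) ?_
  rw [MvPolynomial.smul_eq_C_mul, MvPolynomial.smul_eq_C_mul, map_ofNat]
  push_cast at h
  linear_combination h

lemma totalDegree_uFun_zero_le (I : Finset σ) :
    (uFun (X : σ → MvPolynomial σ ℚ) I 0).totalDegree ≤ I.card - 1 := by
  induction I using Finset.strongInduction with
  | H I ih =>
  rcases Nat.lt_trichotomy I.card 1 with h | h | h
  · rw [card_eq_zero.1 (by omega : I.card = 0), uFun_empty, totalDegree_zero]
    omega
  · rw [uFun_zero_of_card_eq_one _ h, totalDegree_one]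
    omega
  have e := uFun_zero_equation (X : σ → MvPolynomial σ ℚ) I
  have hk : (2 * (I.card - 1) : MvPolynomial σ ℚ) = C (2 * (I.card - 1) : ℚ) := by
    simp only [map_mul, map_sub, map_natCast, map_one, map_ofNat]
  have hk0 : (2 * (I.card - 1) : ℚ) ≠ 0 := by
    have : (1 : ℚ) < I.card := by exact_mod_cast h
    nlinarith
  have e' : uFun (X : σ → MvPolynomial σ ℚ) I 0 = C (2 * (I.card - 1) : ℚ)⁻¹ *
      (varSum X I * ∑ J ∈ I.powerset, uFun X J 0 * uFun X (I \ J) 0) := by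
    rw [← e, hk, mul_comm (uFun X I 0), ← mul_assoc, ← map_mul, inv_mul_cancel₀ hk0, map_one,
      one_mul]
  rw [e']
  refine (totalDegree_mul _ _).trans ?_
  rw [totalDegree_C, zero_add]
  refine (totalDegree_mul _ _).trans ?_
  have h1 : (varSum (X : σ → MvPolynomial σ ℚ) I).totalDegree ≤ 1 :=
    totalDegree_finsetSum_le fun i _ => (totalDegree_X i).le
  have h2 : (∑ J ∈ I.powerset, uFun (X : σ → MvPolynomial σ ℚ) J 0 *
      uFun X (I \ J) 0).totalDegree ≤ I.card - 2 := by
    refine totalDegree_finsetSum_le fun J hJ => ?_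
    have hJI := mem_powerset.1 hJ
    have hc := card_sdiff_add_card_eq_card hJI
    rcases J.eq_empty_or_nonempty with rfl | hJ1
    · simp [uFun_empty]
    rcases (I \ J).eq_empty_or_nonempty with hJ2 | hJ2
    · simp [hJ2, uFun_empty]
    have p1 := hJ1.card_pos
    have p2 := hJ2.card_pos
    have d1 := ih J (hJI.ssubset_of_ne (by rintro rfl; simp at hJ2))
    have d2 := ih (I \ J) (sdiff_ssubset hJI hJ1)
    refine (totalDegree_mul _ _).trans ?_
    omega
  omega

lemma tau_mem_supported (g : ℕ) (m : ℤ) (Z W Y S : Finset σ) (hZY : Disjoint Z Y)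
    (hWY : Disjoint W Y) (hZ : Z ⊆ S) (hW : W ⊆ S) (hY : Y ⊆ S) :
    PowerSeries.coeff g (tau (X : σ → MvPolynomial σ ℚ) m Z W Y) ∈ supported ℚ (S : Set σ) := by
  induction hN : g + Z.card + W.card + Y.card using Nat.strong_induction_on
    generalizing g m Z W Y with
  | _ N ih =>
  by_cases h0 : N = 0
  · obtain ⟨rfl, hZ0, hW0, hY0⟩ : g = 0 ∧ Z.card = 0 ∧ W.card = 0 ∧ Y.card = 0 := by omega
    rw [card_eq_zero] at hZ0 hW0 hY0
    subst hZ0 hW0 hY0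
    rw [coeff_zero_tau_empty]
    exact one_mem _
  have e := congrArg (PowerSeries.coeff g) (tau_equation (c := (X : σ → MvPolynomial σ ℚ))
    m Z W Y hZY hWY rfl)
  have hT : varSum (X : σ → MvPolynomial σ ℚ) Z + varSum X W + varSum X Y ∈
      supported ℚ (S : Set σ) := add_mem (add_mem (varSum_X_mem_supported hZ)
        (varSum_X_mem_supported hW)) (varSum_X_mem_supported hY)
  generalize varSum (X : σ → MvPolynomial σ ℚ) Z + varSum X W + varSum X Y = T at e hT
  have h12 : (12 : PowerSeries (MvPolynomial σ ℚ)) = PowerSeries.C 12 :=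
    (map_ofNat PowerSeries.C 12).symm
  have hk : ((Y.card + Z.card + W.card : ℕ) : PowerSeries (MvPolynomial σ ℚ))
      = PowerSeries.C ((Y.card + Z.card + W.card : ℕ) : MvPolynomial σ ℚ) :=
    (map_natCast PowerSeries.C _).symm
  rw [h12, hk, PowerSeries.coeff_C_mul, map_add, coeff_genusD, PowerSeries.coeff_C_mul, map_add,
    PowerSeries.coeff_C_mul] at e
  have hX : PowerSeries.coeff g (PowerSeries.X * (PowerSeries.C (3 * T) *
      tau (X : σ → MvPolynomial σ ℚ) (m + 2) Z W Y)) ∈ supported ℚ (S : Set σ) := by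
    cases g with
    | zero => rw [PowerSeries.coeff_zero_X_mul]; exact zero_mem _
    | succ g =>
      rw [PowerSeries.coeff_succ_X_mul, PowerSeries.coeff_C_mul]
      exact mul_mem (mul_mem (ofNat_mem _ 3) hT)
        (ih _ (by omega) g (m + 2) Z W Y hZY hWY hZ hW hY rfl)
  have hR : PowerSeries.coeff g (rho (X : σ → MvPolynomial σ ℚ) m Z W Y T) ∈
      supported ℚ (S : Set σ) := by
    have hz1 : ∀ z ∈ Z, (Z \ {z}).card < Z.card := fun z hz =>
      card_lt_card (sdiff_ssubset (singleton_subset_iff.2 hz) (singleton_nonempty z))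
    have hw1 : ∀ w ∈ W, (W \ {w}).card < W.card := fun w hw =>
      card_lt_card (sdiff_ssubset (singleton_subset_iff.2 hw) (singleton_nonempty w))
    have hB1 : ∀ B, (Y \ B).card ≤ Y.card := fun B => card_le_card sdiff_subset
    rw [rho, map_sub, map_add, map_sum, map_sum, map_sum]
    refine sub_mem (add_mem (sum_mem fun B hB => ?_) (sum_mem fun z hz => ?_))
      (sum_mem fun w hw => ?_)
    · rw [PowerSeries.coeff_C_mul]
      rcases B.eq_empty_or_nonempty with rfl | hne
      · rw [uFun_empty, zero_mul, zero_mul]; exact zero_mem _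
      have hBY := (mem_powerset.1 hB)
      have := card_lt_card (sdiff_ssubset hBY hne)
      exact mul_mem (mul_mem (uFun_X_mem_supported (hBY.trans hY) 0)
        (add_mem (mul_mem (add_mem (intCast_mem _ m) (one_mem _))
          (varSum_X_mem_supported (hBY.trans hY))) hT))
        (ih _ (by omega) g m Z W (Y \ B) (hZY.mono_right sdiff_subset)
          (hWY.mono_right sdiff_subset) hZ hW (sdiff_subset.trans hY) rfl)
    · rw [map_sum]
      refine sum_mem fun B hB => ?_
      rw [PowerSeries.coeff_C_mul]
      have := hz1 z hz
      have := hB1 B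
      exact mul_mem (uFun_X_mem_supported (union_subset (singleton_subset_iff.2 (hZ hz))
        ((mem_powerset.1 hB).trans hY)) 0)
        (ih _ (by omega) g (m + 1) (Z \ {z}) W (Y \ B) (hZY.mono sdiff_subset sdiff_subset)
          (hWY.mono_right sdiff_subset) (sdiff_subset.trans hZ) hW (sdiff_subset.trans hY) rfl)
    · rw [map_sum]
      refine sum_mem fun B hB => ?_
      rw [PowerSeries.coeff_C_mul]
      have := hw1 w hw
      have := hB1 B
      exact mul_mem (uFun_X_mem_supported (union_subset (singleton_subset_iff.2 (hW hw))
        ((mem_powerset.1 hB).trans hY)) 0)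
        (ih _ (by omega) g (m + 1) Z (W \ {w}) (Y \ B) (hZY.mono_right sdiff_subset)
          (hWY.mono sdiff_subset sdiff_subset) hZ (sdiff_subset.trans hW)
          (sdiff_subset.trans hY) rfl)
  have hq : (12 * (2 * g + (Y.card + Z.card + W.card)) : ℚ) ≠ 0 := by
    have : 0 < 12 * (2 * g + (Y.card + Z.card + W.card)) := by omega
    exact_mod_cast this.ne'
  have hm := (supported ℚ (S : Set σ)).smul_mem
    (add_mem hX (mul_mem (ofNat_mem _ 12) hR)) (12 * (2 * g + (Y.card + Z.card + W.card)) : ℚ)⁻¹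
  rw [← e] at hm
  convert hm using 1
  rw [eq_inv_smul_iff₀ hq, MvPolynomial.smul_eq_C_mul]
  simp only [map_mul, map_add, map_natCast, map_ofNat]
  push_cast
  ring

end Supports

section TopCoefficient

variable {σ : Type*} [DecidableEq σ]

lemma coeff_varSum_X_mul (I : Finset σ) (f : MvPolynomial σ ℚ) (e : σ →₀ ℕ) :
    coeff e (varSum X I * f) =
      ∑ v ∈ I, if e v ≠ 0 then coeff (e - Finsupp.single v 1) f else 0 := by
  rw [varSum, sum_mul, coeff_sum]
  refine sum_congr rfl fun v _ => ?_
  rw [coeff_X_mul']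
  simp only [Finsupp.mem_support_iff]

lemma coeff_rho (g : ℕ) (m : ℤ) (Z W Y : Finset σ) (hZY : Disjoint Z Y) (hWY : Disjoint W Y)
    (hZW : Disjoint Z W) (e : σ →₀ ℕ) (he : ∀ v ∈ Y, 2 ≤ e v) :
    coeff e (PowerSeries.coeff g (rho (X : σ → MvPolynomial σ ℚ) m Z W Y
        (varSum X Z + varSum X W + varSum X Y))) =
      (∑ z ∈ Z, if e z = 0 then
        coeff e (PowerSeries.coeff g (tau (X : σ → MvPolynomial σ ℚ) (m + 1) (Z \ {z}) W Y)) else 0)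
      - ∑ w ∈ W, if e w = 0 then coeff e (PowerSeries.coeff g
          (tau (X : σ → MvPolynomial σ ℚ) (m + 1) Z (W \ {w}) Y)) else 0 := by
  have hB2 : ∀ B ⊆ Y, 2 * B.card ≤ ∑ v ∈ B, e v := fun B hB => by
    rw [mul_comm, ← smul_eq_mul]
    exact card_nsmul_le_sum _ _ _ fun v hv => he v (hB hv)
  have hpair : ∀ (v : σ) (Z' W' : Finset σ), v ∉ Z' → v ∉ W' → v ∉ Y → Disjoint Z' Y →
      Disjoint W' Y → (∑ B ∈ Y.powerset, coeff e (PowerSeries.coeff g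
        (PowerSeries.C (uFun (X : σ → MvPolynomial σ ℚ) ({v} ∪ B) 0) *
          tau X (m + 1) Z' W' (Y \ B)))) =
      if e v = 0 then coeff e (PowerSeries.coeff g
        (tau (X : σ → MvPolynomial σ ℚ) (m + 1) Z' W' Y)) else 0 := by
    intro v Z' W' hvZ hvW hvY hZ' hW'
    rw [sum_eq_single ∅]
    · rw [union_empty, uFun_zero_of_card_eq_one _ (card_singleton v), sdiff_empty, map_one,
        one_mul]
      split_ifs with h0
      · rfl
      rw [← one_mul (PowerSeries.coeff g _)]
      refine coeff_mul_eq_zero_of_totalDegree_lt (K := {v}) (S := Z' ∪ W' ∪ Y)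
        (tau_mem_supported g _ _ _ _ _ hZ' hW' (fun _ h => by simp [h]) (fun _ h => by simp [h])
          (fun _ h => by simp [h])) (by simp [hvZ, hvW, hvY]) ?_
      rw [totalDegree_one, sum_singleton]
      omega
    · intro B hB hB0
      have hBY := mem_powerset.1 hB
      rw [PowerSeries.coeff_C_mul]
      refine coeff_mul_eq_zero_of_totalDegree_lt (K := {v} ∪ B) (S := Z' ∪ W' ∪ (Y \ B))
        (tau_mem_supported g _ _ _ _ _ (hZ'.mono_right sdiff_subset)
          (hW'.mono_right sdiff_subset) (fun _ h => by simp [h]) (fun _ h => by simp [h])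
          (fun x h => by simp at h; simp [h])) ?_ ?_
      · simp only [disjoint_union_left, disjoint_union_right, disjoint_singleton_left]
        exact ⟨⟨⟨hvZ, (hZ'.mono_right hBY).symm⟩, hvW, (hW'.mono_right hBY).symm⟩,
          fun h => hvY (mem_sdiff.1 h).1, disjoint_sdiff⟩
      · have h1 := totalDegree_uFun_zero_le ({v} ∪ B)
        have h2 : ({v} ∪ B).card ≤ 1 + B.card := by
          simpa using card_union_le {v} B
        have h3 := hB2 B hBY
        have h4 : ∑ i ∈ B, e i ≤ ∑ i ∈ {v} ∪ B, e i := sum_le_sum_of_subset subset_union_right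
        have h5 := (nonempty_iff_ne_empty.2 hB0).card_pos
        omega
    · intro h; simp at h
  have hfirst : ∀ B ∈ Y.powerset, coeff e (PowerSeries.coeff g
      (PowerSeries.C (uFun (X : σ → MvPolynomial σ ℚ) B 0 *
        (((m : MvPolynomial σ ℚ) + 1) * varSum X B +
        (varSum X Z + varSum X W + varSum X Y))) * tau X m Z W (Y \ B))) = 0 := by
    intro B hB
    have hBY := mem_powerset.1 hB
    rcases B.eq_empty_or_nonempty with rfl | hne
    · simp [uFun_empty]
    have hS : PowerSeries.coeff g (tau (X : σ → MvPolynomial σ ℚ) m Z W (Y \ B)) ∈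
        supported ℚ ((Z ∪ W ∪ (Y \ B) : Finset σ) : Set σ) :=
      tau_mem_supported g _ _ _ _ _ (hZY.mono_right sdiff_subset)
          (hWY.mono_right sdiff_subset) (fun _ h => by simp [h]) (fun _ h => by simp [h])
          (fun x h => by simp at h; simp [h])
    have hK : Disjoint B (Z ∪ W ∪ (Y \ B)) := by
      simp only [disjoint_union_right]
      exact ⟨⟨(hZY.mono_right hBY).symm, (hWY.mono_right hBY).symm⟩, disjoint_sdiff⟩
    have hsp : varSum (X : σ → MvPolynomial σ ℚ) Y = varSum X (Y \ B) + varSum X B :=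
      (sum_sdiff hBY).symm
    have h3 := hB2 B hBY
    have h5 := hne.card_pos
    have h1 := totalDegree_uFun_zero_le B
    have hv : (varSum (X : σ → MvPolynomial σ ℚ) B).totalDegree ≤ 1 :=
      totalDegree_finsetSum_le fun i _ => (totalDegree_X i).le
    have hm : (((m + 2 : ℤ) : MvPolynomial σ ℚ)).totalDegree = 0 := by
      rw [← map_intCast (C : ℚ →+* MvPolynomial σ ℚ), totalDegree_C]
    rw [PowerSeries.coeff_C_mul, show ∀ t : MvPolynomial σ ℚ, uFun (X : σ → MvPolynomial σ ℚ) B 0 *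
      (((m : MvPolynomial σ ℚ) + 1) * varSum X B + (varSum X Z + varSum X W + varSum X Y)) * t =
      (uFun X B 0 * (((m + 2 : ℤ) : MvPolynomial σ ℚ) * varSum X B)) * t + uFun X B 0 *
        ((varSum X Z + varSum X W + varSum X (Y \ B)) * t) from fun t => by
          rw [hsp]; push_cast; ring, coeff_add,
      coeff_mul_eq_zero_of_totalDegree_lt hS hK, coeff_mul_eq_zero_of_totalDegree_lt
        (mul_mem (add_mem (add_mem _ _) _) hS) hK, add_zero]
    · omega
    · exact varSum_X_mem_supported fun _ h => by simp [h]
    · exact varSum_X_mem_supported fun _ h => by simp [h]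
    · exact varSum_X_mem_supported fun _ h => by simp at h; simp [h]
    · have h6 := totalDegree_mul (uFun (X : σ → MvPolynomial σ ℚ) B 0)
        (((m + 2 : ℤ) : MvPolynomial σ ℚ) * varSum X B)
      have h7 := totalDegree_mul ((m + 2 : ℤ) : MvPolynomial σ ℚ) (varSum X B)
      omega
  rw [rho]
  simp only [map_add, map_sub, map_sum, coeff_add, coeff_sub, coeff_sum]
  rw [sum_eq_zero hfirst, zero_add]
  congr 1
  · refine sum_congr rfl fun z hz => hpair z _ _ (by simp) (disjoint_left.1 hZW hz)
      (disjoint_left.1 hZY hz) (hZY.mono_left sdiff_subset) hWY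
  · refine sum_congr rfl fun w hw => hpair w _ _ (disjoint_right.1 hZW hw) (by simp)
      (disjoint_left.1 hWY hw) hZY (hWY.mono_left sdiff_subset)

/-- The double factorial attached to the exponent of the variable `v`. -/
def expWeight (Y : Finset σ) (e : σ →₀ ℕ) (v : σ) : ℚ :=
  if v ∈ Y then ((2 * e v - 1).doubleFactorial : ℚ) else ((2 * e v + 1).doubleFactorial : ℚ)

/-- The closed formula for the coefficients of `tau`. -/
def topCoeff (e : σ →₀ ℕ) (g : ℕ) (m : ℤ) (Z W Y : Finset σ) : ℚ :=
  (-1) ^ W.card * (∏ i ∈ range Y.card, ((2 * g + (m + Z.card + W.card) + 2 + i : ℤ) : ℚ)) /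
    (4 ^ g * ∏ v ∈ Z ∪ W ∪ Y, expWeight Y e v)

lemma expWeight_ne_zero (Y : Finset σ) (e : σ →₀ ℕ) (v : σ) : expWeight Y e v ≠ 0 := by
  rw [expWeight]
  split_ifs <;> exact_mod_cast (Nat.doubleFactorial_pos _).ne'

lemma prod_expWeight_ne_zero (Y S : Finset σ) (e : σ →₀ ℕ) : ∏ v ∈ S, expWeight Y e v ≠ 0 :=
  prod_ne_zero_iff.2 fun v _ => expWeight_ne_zero Y e v

lemma topCoeff_lower {e : σ →₀ ℕ} (g : ℕ) (m : ℤ) {Z W Y : Finset σ} {v : σ}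
    (hv : v ∈ Z ∪ W ∪ Y) (h0 : e v ≠ 0) (hY : v ∈ Y → 2 ≤ e v) :
    topCoeff (e - Finsupp.single v 1) g (m + 2) Z W Y =
      4 * (if v ∈ Y then 2 * (e v : ℚ) - 1 else 2 * e v + 1) * topCoeff e (g + 1) m Z W Y := by
  have hw : expWeight Y e v = (if v ∈ Y then 2 * (e v : ℚ) - 1 else 2 * e v + 1) *
      expWeight Y (e - Finsupp.single v 1 : σ →₀ ℕ) v := by
    rw [expWeight, expWeight]
    simp only [Finsupp.coe_tsub, Pi.sub_apply, Finsupp.single_eq_same]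
    split_ifs with h
    · obtain ⟨k, hk⟩ := Nat.exists_eq_add_of_le (hY h)
      rw [hk, show 2 * (2 + k) - 1 = (2 * k + 1) + 2 by omega, Nat.doubleFactorial_add_two,
        show 2 * (2 + k - 1) - 1 = 2 * k + 1 by omega]
      push_cast
      ring
    · obtain ⟨k, hk⟩ := Nat.exists_eq_add_of_le (Nat.one_le_iff_ne_zero.2 h0)
      rw [hk, show 2 * (1 + k) + 1 = (2 * k + 1) + 2 by omega, Nat.doubleFactorial_add_two,
        show 2 * (1 + k - 1) + 1 = 2 * k + 1 by omega]
      push_cast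
      ring
  have hp : ∏ u ∈ Z ∪ W ∪ Y, expWeight Y e u =
      (if v ∈ Y then 2 * (e v : ℚ) - 1 else 2 * e v + 1) *
        ∏ u ∈ Z ∪ W ∪ Y, expWeight Y (e - Finsupp.single v 1 : σ →₀ ℕ) u := by
    rw [← mul_prod_erase _ _ hv, ← mul_prod_erase _ (expWeight Y (e - _)) hv, hw, mul_assoc]
    congr 2
    refine prod_congr rfl fun u hu => ?_
    have : (e - Finsupp.single v 1 : σ →₀ ℕ) u = e u := by
      rw [Finsupp.tsub_apply, Finsupp.single_eq_of_ne (ne_of_mem_erase hu), Nat.sub_zero]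
    rw [expWeight, expWeight, this]
  have hne := prod_expWeight_ne_zero Y (Z ∪ W ∪ Y) e
  rw [topCoeff, topCoeff, hp]
  rw [hp] at hne
  obtain ⟨hk, hq⟩ := mul_ne_zero_iff.1 hne
  have hprod : (∏ i ∈ range Y.card, ((2 * g + (m + 2 + Z.card + W.card) + 2 + i : ℤ) : ℚ)) =
      ∏ i ∈ range Y.card, ((2 * (g + 1 : ℕ) + (m + Z.card + W.card) + 2 + i : ℤ) : ℚ) :=
    prod_congr rfl fun i _ => by push_cast; ring
  rw [hprod, pow_succ]
  field_simp

lemma topCoeff_sdiff_left {e : σ →₀ ℕ} (g : ℕ) (m : ℤ) {Z W Y : Finset σ} {z : σ} (hz : z ∈ Z)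
    (hzW : z ∉ W) (hzY : z ∉ Y) (h0 : e z = 0) :
    topCoeff e g (m + 1) (Z \ {z}) W Y = topCoeff e g m Z W Y := by
  have hS : (Z \ {z}) ∪ W ∪ Y = (Z ∪ W ∪ Y).erase z := by
    ext u
    by_cases hu : u = z
    · subst hu; simp [hzW, hzY]
    · simp [hu]
  have hw : expWeight Y e z = 1 := by simp [expWeight, hzY, h0]
  have hc : ((Z \ {z}).card : ℤ) = Z.card - 1 := by
    rw [sdiff_singleton_eq_erase, cast_card_erase_of_mem hz]
  rw [topCoeff, topCoeff, hS, ← mul_prod_erase (Z ∪ W ∪ Y) _ (by simp [hz] : z ∈ Z ∪ W ∪ Y), hw,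
    one_mul, hc]
  congr 2
  exact prod_congr rfl fun i _ => by push_cast; ring

lemma topCoeff_sdiff_right {e : σ →₀ ℕ} (g : ℕ) (m : ℤ) {Z W Y : Finset σ} {w : σ} (hw : w ∈ W)
    (hwZ : w ∉ Z) (hwY : w ∉ Y) (h0 : e w = 0) :
    topCoeff e g (m + 1) Z (W \ {w}) Y = -topCoeff e g m Z W Y := by
  have hS : Z ∪ (W \ {w}) ∪ Y = (Z ∪ W ∪ Y).erase w := by
    ext u
    by_cases hu : u = w
    · subst hu; simp [hwZ, hwY]
    · simp [hu]
  have hw1 : expWeight Y e w = 1 := by simp [expWeight, hwY, h0]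
  have hc : W.card = (W \ {w}).card + 1 := by
    rw [sdiff_singleton_eq_erase, card_erase_add_one hw]
  rw [topCoeff, topCoeff, hS, ← mul_prod_erase (Z ∪ W ∪ Y) _ (by simp [hw] : w ∈ Z ∪ W ∪ Y), hw1,
    one_mul, hc, pow_succ, ← neg_div]
  congr 1
  rw [mul_neg_one, neg_mul, neg_neg]
  congr 1
  exact prod_congr rfl fun i _ => by push_cast; ring

lemma topCoeff_insert {e : σ →₀ ℕ} (g : ℕ) (m : ℤ) {Z W Y : Finset σ} {x : σ} (hxZ : x ∉ Z)
    (hxW : x ∉ W) (hxY : x ∉ Y) (h1 : e x = 1) :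
    topCoeff e g m Z W (insert x Y) = ((2 * g + (m + (Z.card + W.card + Y.card + 2)) : ℤ) : ℚ) *
      topCoeff (e - Finsupp.single x 1) g m Z W Y := by
  have hp : ∏ v ∈ Z ∪ W ∪ insert x Y, expWeight (insert x Y) e v =
      ∏ v ∈ Z ∪ W ∪ Y, expWeight Y (e - Finsupp.single x 1 : σ →₀ ℕ) v := by
    rw [union_insert, prod_insert (by simp [hxZ, hxW, hxY])]
    rw [show expWeight (insert x Y) e x = 1 by simp [expWeight, h1], one_mul]
    refine prod_congr rfl fun v hv => ?_
    have hvx : v ≠ x := by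
      rintro rfl
      simp [hxZ, hxW, hxY] at hv
    have : (e - Finsupp.single x 1 : σ →₀ ℕ) v = e v := by
      rw [Finsupp.tsub_apply, Finsupp.single_eq_of_ne hvx, Nat.sub_zero]
    simp only [expWeight, this, mem_insert, hvx, false_or]
  rw [topCoeff, topCoeff, hp, card_insert_of_notMem hxY, prod_range_succ]
  push_cast
  ring

theorem coeff_tau (g : ℕ) (m : ℤ) (Z W Y : Finset σ) (hZY : Disjoint Z Y) (hWY : Disjoint W Y)
    (hZW : Disjoint Z W) (e : σ →₀ ℕ) (hY : ∀ v ∈ Y, 1 ≤ e v)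
    (hsupp : ∀ v, v ∉ Z ∪ W ∪ Y → e v = 0)
    (hsum : ∑ v ∈ Z, e v + ∑ v ∈ W, e v + ∑ v ∈ Y, e v = g + Y.card) :
    coeff e (PowerSeries.coeff g (tau (X : σ → MvPolynomial σ ℚ) m Z W Y)) =
      topCoeff e g m Z W Y := by
  induction hN : g + Z.card + W.card + Y.card using Nat.strong_induction_on
    generalizing g m Z W Y e with
  | _ N ih =>
  by_cases h1 : ∃ x ∈ Y, e x = 1
  · obtain ⟨x, hx, hx1⟩ := h1
    obtain ⟨Y, hxY, rfl⟩ : ∃ Y', x ∉ Y' ∧ insert x Y' = Y :=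
      ⟨Y.erase x, notMem_erase _ _, insert_erase hx⟩
    obtain ⟨hxZ, hZY⟩ := disjoint_insert_right.1 hZY
    obtain ⟨hxW, hWY⟩ := disjoint_insert_right.1 hWY
    obtain ⟨f, hf⟩ := tau_insert_sub_dvd (c := (X : σ → MvPolynomial σ ℚ)) m Z W Y hxZ hxW hxY hZY
      hWY rfl g
    have hm := tau_mem_supported g m Z W Y (Z ∪ W ∪ Y) hZY hWY
      (fun _ h => by simp [h]) (fun _ h => by simp [h]) (fun _ h => by simp [h])
    have hT : (varSum (X : σ → MvPolynomial σ ℚ) Z + varSum X W + varSum X Y) ∈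
        supported ℚ ((Z ∪ W ∪ Y : Finset σ) : Set σ) :=
      add_mem (add_mem (varSum_X_mem_supported fun _ h => by simp [h])
        (varSum_X_mem_supported fun _ h => by simp [h]))
        (varSum_X_mem_supported fun _ h => by simp [h])
    have hT0 := coeff_mul_eq_zero_of_totalDegree_lt (f := 1) (K := {x}) (e := e)
      (mul_mem hT hm) (by simp [hxZ, hxW, hxY]) (by simp [hx1])
    rw [one_mul] at hT0
    have hcf := congrArg (coeff e) hf
    rw [coeff_sub, add_mul, coeff_add, hT0, zero_add, pow_two, mul_assoc (X x) (X x) f,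
      coeff_X_mul', if_pos (by simp [hx1]), coeff_X_mul', if_neg (by simp [hx1]), sub_eq_zero,
      mul_assoc, coeff_X_mul', if_pos (by simp [hx1]),
      ← map_intCast (C : ℚ →+* MvPolynomial σ ℚ), coeff_C_mul] at hcf
    have hne : ∀ v, v ≠ x → (e - Finsupp.single x 1 : σ →₀ ℕ) v = e v := fun v hvx => by
      rw [Finsupp.tsub_apply, Finsupp.single_eq_of_ne hvx, Nat.sub_zero]
    have hS : ∀ I : Finset σ, x ∉ I → ∑ v ∈ I, (e - Finsupp.single x 1 : σ →₀ ℕ) v = ∑ v ∈ I, e v :=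
      fun I hI => sum_congr rfl fun v hv => hne v (by rintro rfl; exact hI hv)
    rw [card_insert_of_notMem hxY] at hN hsum
    rw [sum_insert hxY, hx1] at hsum
    rw [hcf, topCoeff_insert g m hxZ hxW hxY hx1,
      ih _ (by omega) g m Z W Y hZY hWY hZW _ _ _ _ rfl]
    · intro v hv
      rw [hne v (by rintro rfl; exact hxY hv)]
      exact hY v (mem_insert_of_mem hv)
    · intro v hv
      by_cases hvx : v = x
      · subst hvx; simp [hx1]
      · rw [hne v hvx]
        exact hsupp v (by simpa [hvx] using hv)
    · rw [hS _ hxZ, hS _ hxW, hS _ hxY]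
      omega
  have hY2 : ∀ v ∈ Y, 2 ≤ e v := fun v hv => by
    have := hY v hv
    have : e v ≠ 1 := fun h => h1 ⟨v, hv, h⟩
    omega
  have hYc : 2 * Y.card ≤ ∑ v ∈ Y, e v := by
    rw [mul_comm, ← smul_eq_mul]
    exact card_nsmul_le_sum _ _ _ hY2
  by_cases h0 : N = 0
  · obtain ⟨rfl, hZ0, hW0, hY0⟩ : g = 0 ∧ Z.card = 0 ∧ W.card = 0 ∧ Y.card = 0 := by omega
    rw [card_eq_zero] at hZ0 hW0 hY0
    subst hZ0 hW0 hY0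
    have : e = 0 := Finsupp.ext fun v => hsupp v (by simp)
    simp [coeff_zero_tau_empty, this, topCoeff]
  set k : σ → ℚ := fun v => if v ∈ Y then 2 * (e v : ℚ) - 1 else 2 * e v + 1 with hk
  have hlow : ∀ v ∈ Z ∪ W ∪ Y, e v ≠ 0 → ∃ g', g = g' + 1 ∧
      coeff (e - Finsupp.single v 1) (PowerSeries.coeff g' (tau (X : σ → MvPolynomial σ ℚ)
        (m + 2) Z W Y)) = 4 * k v * topCoeff e g m Z W Y := by
    intro v hv hev
    have hsS : ∑ u ∈ Z ∪ W ∪ Y, e u = g + Y.card := by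
      rw [sum_union (disjoint_union_left.2 ⟨hZY, hWY⟩), sum_union hZW, hsum]
    have hg : g ≠ 0 := by
      rintro rfl
      have hYe : Y.card = 0 := by omega
      have := single_le_sum (f := fun u => e u) (fun _ _ => Nat.zero_le _) hv
      omega
    obtain ⟨g, rfl⟩ := Nat.exists_eq_succ_of_ne_zero hg
    refine ⟨g, rfl, ?_⟩
    have hne : ∀ u, u ≠ v → (e - Finsupp.single v 1 : σ →₀ ℕ) u = e u := fun u huv => by
      rw [Finsupp.tsub_apply, Finsupp.single_eq_of_ne huv, Nat.sub_zero]
    have hvv : (e - Finsupp.single v 1 : σ →₀ ℕ) v = e v - 1 := by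
      rw [Finsupp.tsub_apply, Finsupp.single_eq_same]
    rw [ih _ (by omega) g (m + 2) Z W Y hZY hWY hZW _ _ _ _ rfl,
      topCoeff_lower g m hv hev (hY2 v)]
    · intro u hu
      have := hY2 u hu
      by_cases huv : u = v
      · subst huv; omega
      · rw [hne u huv]; omega
    · intro u hu
      rw [hne u (by rintro rfl; exact hu hv)]
      exact hsupp u hu
    · have hadd : ∑ u ∈ Z ∪ W ∪ Y, (e - Finsupp.single v 1 : σ →₀ ℕ) u + 1 =
          ∑ u ∈ Z ∪ W ∪ Y, e u := by
        have hse : ∑ u ∈ (Z ∪ W ∪ Y).erase v, (e - Finsupp.single v 1 : σ →₀ ℕ) u =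
            ∑ u ∈ (Z ∪ W ∪ Y).erase v, e u := sum_congr rfl fun u hu => hne u (ne_of_mem_erase hu)
        rw [← add_sum_erase _ _ hv, ← add_sum_erase _ (fun u => e u) hv, hvv, hse]
        omega
      rw [← sum_union hZW, ← sum_union (disjoint_union_left.2 ⟨hZY, hWY⟩)]
      omega
  have hXg : coeff e (PowerSeries.coeff g (PowerSeries.X * (PowerSeries.C
      (3 * (varSum X Z + varSum X W + varSum X Y)) *
        tau (X : σ → MvPolynomial σ ℚ) (m + 2) Z W Y))) =
      3 * (∑ v ∈ Z, if e v ≠ 0 then 4 * k v * topCoeff e g m Z W Y else 0) +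
      3 * (∑ v ∈ W, if e v ≠ 0 then 4 * k v * topCoeff e g m Z W Y else 0) +
      3 * (∑ v ∈ Y, if e v ≠ 0 then 4 * k v * topCoeff e g m Z W Y else 0) := by
    cases g with
    | zero =>
      have hz : ∀ v ∈ Z ∪ W ∪ Y, e v = 0 := fun v hv => by
        by_contra h
        obtain ⟨g', h', -⟩ := hlow v hv h
        omega
      rw [PowerSeries.coeff_zero_X_mul, coeff_zero, sum_eq_zero, sum_eq_zero, sum_eq_zero]
      · simp
      all_goals
        intro v hv
        rw [if_neg (not_not.2 (hz v (by simp [hv])))]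
    | succ g =>
      rw [PowerSeries.coeff_succ_X_mul, PowerSeries.coeff_C_mul, mul_assoc,
        ← map_ofNat (C : ℚ →+* MvPolynomial σ ℚ) 3, coeff_C_mul, add_mul, add_mul, coeff_add,
        coeff_add, coeff_varSum_X_mul, coeff_varSum_X_mul, coeff_varSum_X_mul, mul_add, mul_add]
      have hs : ∀ I : Finset σ, I ⊆ Z ∪ W ∪ Y → (∑ v ∈ I, if e v ≠ 0 then
          coeff (e - Finsupp.single v 1) (PowerSeries.coeff g
            (tau (X : σ → MvPolynomial σ ℚ) (m + 2) Z W Y)) else 0) =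
          ∑ v ∈ I, if e v ≠ 0 then 4 * k v * topCoeff e (g + 1) m Z W Y else 0 := by
        intro I hI
        refine sum_congr rfl fun v hv => ?_
        split_ifs with h
        · obtain ⟨g', h', h''⟩ := hlow v (hI hv) h
          obtain rfl : g = g' := by omega
          exact h''
        · rfl
      rw [hs Z (fun _ h => by simp [h]), hs W (fun _ h => by simp [h]),
        hs Y (fun _ h => by simp [h])]
  have hR := coeff_rho g m Z W Y hZY hWY hZW e hY2
  have hRZ : ∀ z ∈ Z, (if e z = 0 then coeff e (PowerSeries.coeff g
      (tau (X : σ → MvPolynomial σ ℚ) (m + 1) (Z \ {z}) W Y)) else 0) =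
      if e z = 0 then topCoeff e g m Z W Y else 0 := by
    intro z hz
    split_ifs with hez
    · have hc : (Z \ {z}).card + 1 = Z.card := by
        rw [sdiff_singleton_eq_erase, card_erase_add_one hz]
      rw [ih _ (by omega) g (m + 1) (Z \ {z}) W Y (hZY.mono_left sdiff_subset) hWY
        (hZW.mono_left sdiff_subset) e hY _ _ rfl, topCoeff_sdiff_left g m hz
        (disjoint_left.1 hZW hz) (disjoint_left.1 hZY hz) hez]
      · intro v hv
        by_cases hvz : v = z
        · rw [hvz, hez]
        · exact hsupp v (by simpa [hvz] using hv)
      · rw [← hsum, sdiff_singleton_eq_erase, ← add_sum_erase Z _ hz, hez, zero_add]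
    · rfl
  have hRW : ∀ w ∈ W, (if e w = 0 then coeff e (PowerSeries.coeff g
      (tau (X : σ → MvPolynomial σ ℚ) (m + 1) Z (W \ {w}) Y)) else 0) =
      if e w = 0 then -topCoeff e g m Z W Y else 0 := by
    intro w hw
    split_ifs with hew
    · have hc : (W \ {w}).card + 1 = W.card := by
        rw [sdiff_singleton_eq_erase, card_erase_add_one hw]
      rw [ih _ (by omega) g (m + 1) Z (W \ {w}) Y hZY (hWY.mono_left sdiff_subset)
        (hZW.mono_right sdiff_subset) e hY _ _ rfl, topCoeff_sdiff_right g m hw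
        (disjoint_right.1 hZW hw) (disjoint_left.1 hWY hw) hew]
      · intro v hv
        by_cases hvw : v = w
        · rw [hvw, hew]
        · exact hsupp v (by simpa [hvw] using hv)
      · rw [← hsum, sdiff_singleton_eq_erase, ← add_sum_erase W _ hw, hew, zero_add]
    · rfl
  rw [sum_congr rfl hRZ, sum_congr rfl hRW] at hR
  have h12 : (12 : PowerSeries (MvPolynomial σ ℚ)) = PowerSeries.C (C 12) := by
    rw [map_ofNat, map_ofNat]
  have hcard : ((Y.card + Z.card + W.card : ℕ) : PowerSeries (MvPolynomial σ ℚ))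
      = PowerSeries.C (C ((Y.card + Z.card + W.card : ℕ) : ℚ)) := by
    rw [map_natCast, map_natCast]
  have hg2 : (2 * g : MvPolynomial σ ℚ) = C (2 * g : ℚ) := by
    simp only [map_mul, map_natCast, map_ofNat]
  have eq := congrArg (fun p => coeff e (PowerSeries.coeff g p))
    (tau_equation (c := (X : σ → MvPolynomial σ ℚ)) m Z W Y hZY hWY rfl)
  simp only [map_add, h12, hcard, PowerSeries.coeff_C_mul, coeff_genusD, coeff_add, coeff_C_mul,
    hg2, hXg, hR] at eq
  have hkZ : (∑ z ∈ Z, (2 * (e z : ℚ) + 1)) * topCoeff e g m Z W Y =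
      (∑ v ∈ Z, if e v ≠ 0 then k v * topCoeff e g m Z W Y else 0) +
        ∑ z ∈ Z, if e z = 0 then topCoeff e g m Z W Y else 0 := by
    rw [sum_mul, ← sum_add_distrib]
    refine sum_congr rfl fun z hz => ?_
    rw [hk]
    simp only [disjoint_left.1 hZY hz, if_false]
    by_cases h : e z = 0 <;> simp [h]
  have hkW : (∑ w ∈ W, (2 * (e w : ℚ) + 1)) * topCoeff e g m Z W Y =
      (∑ v ∈ W, if e v ≠ 0 then k v * topCoeff e g m Z W Y else 0) -
        ∑ w ∈ W, if e w = 0 then -topCoeff e g m Z W Y else 0 := by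
    rw [sum_mul, ← sum_sub_distrib]
    refine sum_congr rfl fun z hz => ?_
    rw [hk]
    simp only [disjoint_left.1 hWY hz, if_false]
    by_cases h : e z = 0 <;> simp [h]
  have hkY : (∑ v ∈ Y, (2 * (e v : ℚ) - 1)) * topCoeff e g m Z W Y =
      ∑ v ∈ Y, if e v ≠ 0 then k v * topCoeff e g m Z W Y else 0 := by
    rw [sum_mul]
    refine sum_congr rfl fun v hv => ?_
    have := hY v hv
    rw [hk, if_pos (by omega)]
    simp only [hv, if_true]
  have h4 : ∀ I : Finset σ, (∑ v ∈ I, if e v ≠ 0 then 4 * k v * topCoeff e g m Z W Y else 0) =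
      4 * ∑ v ∈ I, if e v ≠ 0 then k v * topCoeff e g m Z W Y else 0 := fun I => by
    rw [mul_sum]
    refine sum_congr rfl fun v _ => ?_
    split_ifs <;> ring
  rw [h4, h4, h4] at eq
  have hsumQ : (∑ z ∈ Z, (2 * (e z : ℚ) + 1)) + (∑ w ∈ W, (2 * (e w : ℚ) + 1)) +
      (∑ v ∈ Y, (2 * (e v : ℚ) - 1)) = 2 * g + (Y.card + Z.card + W.card : ℕ) := by
    simp only [sum_add_distrib, sum_sub_distrib, ← mul_sum, sum_const, nsmul_eq_mul, mul_one]
    have : (∑ v ∈ Z, (e v : ℚ)) + ∑ v ∈ W, (e v : ℚ) + ∑ v ∈ Y, (e v : ℚ) = g + Y.card := by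
      exact_mod_cast hsum
    push_cast
    linear_combination 2 * this
  have hq : (12 * (2 * g + (Y.card + Z.card + W.card : ℕ)) : ℚ) ≠ 0 := by
    have : 0 < 12 * (2 * g + (Y.card + Z.card + W.card)) := by omega
    exact_mod_cast this.ne'
  refine mul_left_cancel₀ hq ?_
  linear_combination eq + 12 * topCoeff e g m Z W Y * hsumQ - 12 * hkZ - 12 * hkW - 12 * hkY

end TopCoefficient

section Expansions

lemma binomZ_neg_one (k : ℕ) : binomZ (-1) k = (-1) ^ k := by
  have h : ∏ i ∈ range k, (((-1 : ℤ) : ℚ) - i) = (-1) ^ k * (k.factorial : ℚ) := by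
    induction k with
    | zero => simp
    | succ k ih =>
      rw [prod_range_succ, ih, Nat.factorial_succ]
      push_cast
      ring
  rw [binomZ, h, mul_div_assoc, div_self (by exact_mod_cast k.factorial_ne_zero), mul_one]

lemma yV_add_mul_yExpAdd {N : ℕ} (c : R N) :
    (yV (R N) + HahnSeries.C c) * yExpAdd c (-1) = 1 := by
  have h2 : (1 + PowerSeries.C c * PowerSeries.X) *
      (PowerSeries.mk fun k => MvPolynomial.C (binomZ (-1) k) * c ^ k) = 1 := by
    ext k
    rw [add_mul, one_mul, map_add, mul_assoc, PowerSeries.coeff_C_mul]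
    cases k with
    | zero => simp [binomZ_neg_one]
    | succ k =>
      rw [PowerSeries.coeff_succ_X_mul, PowerSeries.coeff_mk, PowerSeries.coeff_mk,
        PowerSeries.coeff_one, if_neg k.succ_ne_zero]
      simp only [binomZ_neg_one, map_pow, map_neg, map_one]
      ring_nf
  rw [yV_add_C, yExpAdd, mul_mul_mul_comm, HahnSeries.single_mul_single, ← map_mul, h2]
  simp

lemma ptV_inl {N : ℕ} (ε : Bool) :
    ptV (X : Fin N → R N) (Sum.inl ε) = yLau N ε := by
  cases ε
  · simp only [ptV, yLau, yV, Bool.false_eq_true, if_false]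
    exact (neg_one_mul _).symm
  · simp only [ptV, yLau, yV, if_true, one_mul]

lemma yLau_sq {N : ℕ} (ε : Bool) : yLau N ε ^ 2 = HahnSeries.single (-2 : ℤ) (1 : R N) := by
  have h : yLau N ε ^ 2 = yV (R N) ^ 2 := by
    rw [← ptV_inl]
    cases ε <;> simp only [ptV]
    ring
  rw [h, yV, pow_two, HahnSeries.single_mul_single]
  norm_num

lemma yLau_add_mul_LExp {N : ℕ} (ε : Bool) (c : R N) :
    (yLau N ε + HahnSeries.C c) * LExp ε c (-1) = 1 := by
  cases ε
  · have h := yV_add_mul_yExpAdd (-c)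
    have h1 : ¬ Even (-1 : ℤ) := by decide
    rw [LExp, yLau]
    simp only [Bool.false_eq_true, if_false, h1, neg_one_mul (α := R N)]
    rw [map_neg, yV] at h
    linear_combination h
  · have h := yV_add_mul_yExpAdd c
    rw [LExp, yLau]
    simp only [if_true, one_mul]
    exact h

lemma uFun_zero_of_card_eq_two {ι B : Type*} [DecidableEq ι] [CommRing B] [Algebra ℚ B]
    (x : ι → B) {I : Finset ι} (h : I.card = 2) : uFun x I 0 = varSum x I := by
  obtain ⟨i, j, hij, rfl⟩ := card_eq_two.1 h
  have e := congrArg (PowerSeries.coeff 0) (uSer_insert_equation x {j} (by simpa using hij))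
  have h12 : (12 : PowerSeries B) = PowerSeries.C 12 := (map_ofNat PowerSeries.C 12).symm
  have hs : ({j} : Finset ι).powerset = {∅, {j}} := by
    ext s; simp [subset_singleton_iff]
  rw [h12, PowerSeries.coeff_C_mul, map_add, coeff_genusD, hs, sum_pair (by simp), uSer_empty,
    zero_mul, zero_add, card_singleton, Nat.cast_one, one_mul, mul_assoc (PowerSeries.X), map_add,
    PowerSeries.coeff_zero_X_mul, zero_add, mul_assoc (PowerSeries.C (12 : B)),
    PowerSeries.coeff_C_mul, PowerSeries.coeff_C_mul, PowerSeries.coeff_mul,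
    Finset.Nat.antidiagonal_zero, sum_singleton, coeff_uSer, coeff_uSer, coeff_uSer,
    uFun_zero_of_card_eq_one _ (card_singleton j), Finset.sdiff_self, insert_empty_eq,
    uFun_zero_of_card_eq_one _ (card_singleton i)] at e
  refine ratCast_smul_cancel (k := 12) (by norm_num) ?_
  simp only [Algebra.smul_def, map_ofNat]
  simpa using e

lemma sq_varSum_mul_FExp {N : ℕ} (ε : Bool) (g : ℕ) (I : Finset (Fin N)) :
    varSum (ptV (X : Fin N → R N))
        (insert (Sum.inl ε : Bool ⊕ Fin N) (I.map Function.Embedding.inr)) ^ 2 *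
      FExp ε g I = PowerSeries.coeff g (yuSer (X : Fin N → R N) ε I) := by
  have hS : varSum (ptV (X : Fin N → R N))
      (insert (Sum.inl ε : Bool ⊕ Fin N) (I.map Function.Embedding.inr)) =
      yLau N ε + HahnSeries.C (∑ i ∈ I, X i) := by
    rw [varSum_insert _ (inl_notMem_map_inr ε I), varSum_ptV_map_inr, ptV_inl]
    rfl
  have hcard : (insert (Sum.inl ε) (I.map Function.Embedding.inr) :
      Finset (Bool ⊕ Fin N)).card = I.card + 1 := by
    rw [card_insert_of_notMem (inl_notMem_map_inr ε I), card_map]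
  rw [yuSer, coeff_uSer, FExp]
  split_ifs with h0 h1
  · obtain ⟨rfl, hI⟩ := h0
    rw [uFun_zero_of_card_eq_one _ (by omega), hS, card_eq_zero.1 hI]
    rw [sum_empty, map_zero, add_zero, yLau_sq, HahnSeries.single_mul_single]
    simp
  · obtain ⟨rfl, hI⟩ := h1
    rw [uFun_zero_of_card_eq_two _ (by omega), hS, pow_two, mul_assoc, yLau_add_mul_LExp, mul_one]
  · set x : Fin (I.card + 1) → Lau N := Fin.cons (yLau N ε)
      (fun i : Fin I.card => HahnSeries.C (X ((I.orderIsoOfFin rfl) i : Fin N))) with hx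
    have h := eval_polyOf (I.card + 1) g (by omega) (by omega)
      (eval₂Hom ((HahnSeries.C).comp (algebraMap ℚ (R N))) x) x (fun i => eval₂Hom_X' _ _ _)
    let ψ : Fin (I.card + 1) → Bool ⊕ Fin N := Fin.cons (Sum.inl ε) fun i => Sum.inr (ordEmb I i)
    have hψ : Function.Injective ψ := by
      rw [Fin.cons_injective_iff]
      exact ⟨by simp, Sum.inr_injective.comp (ordEmb I).injective⟩
    have hmap : (univ : Finset (Fin (I.card + 1))).map ⟨ψ, hψ⟩ =
        insert (Sum.inl ε : Bool ⊕ Fin N) (I.map Function.Embedding.inr) := by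
      refine eq_of_subset_of_card_le ?_ (by rw [hcard, card_map, card_univ, Fintype.card_fin])
      intro v hv
      obtain ⟨i, -, rfl⟩ := mem_map.1 hv
      refine Fin.cases ?_ (fun j => ?_) i
      · exact mem_insert_self _ _
      · refine mem_insert_of_mem (mem_map_of_mem _ ?_)
        exact ((I.orderIsoOfFin rfl) j).2
    have hxp : ∀ i ∈ (univ : Finset (Fin (I.card + 1))),
        ptV (X : Fin N → R N) ((⟨ψ, hψ⟩ : Fin (I.card + 1) ↪ Bool ⊕ Fin N) i) =
          RingHom.id (Lau N) (x i) := by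
      intro i _
      refine Fin.cases ?_ (fun j => ?_) i
      · exact ptV_inl ε
      · rfl
    have hu := uFun_map (RingHom.id (Lau N)) ⟨ψ, hψ⟩ x (ptV (X : Fin N → R N)) univ hxp g
    have hv : varSum x univ = varSum (ptV (X : Fin N → R N))
        (insert (Sum.inl ε : Bool ⊕ Fin N) (I.map Function.Embedding.inr)) := by
      rw [← hmap, varSum, varSum, sum_map]
      exact sum_congr rfl fun i hi => (hxp i hi).symm
    rw [hmap] at hu
    rw [hv] at h
    rw [← hu, RingHom.id_apply, ← h]
    rfl

lemma FExp_true {N : ℕ} (g : ℕ) (I : Finset (Fin N)) : FExp true g I =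
    yPow (varSum X I) (-2) * PowerSeries.coeff g (yuSer (X : Fin N → R N) true I) := by
  rw [← sq_varSum_mul_FExp, varSum_ptV_true, pow_two, ← yPow_add, ← mul_assoc, ← yPow_add]
  simp [yPow_zero]

lemma FExp_false {N : ℕ} (g : ℕ) (I : Finset (Fin N)) : FExp false g I =
    yPow (-varSum X I) (-2) * PowerSeries.coeff g (yuSer (X : Fin N → R N) false I) := by
  rw [← sq_varSum_mul_FExp, varSum_ptV_false, neg_pow_two, pow_two, ← yPow_add, ← mul_assoc,
    ← yPow_add]
  simp [yPow_zero]

end Expansions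

section Indices

variable (a b n : ℕ)

/-- The embedding of the indices of the variables `z`. -/
def zEmb : Fin a ↪ Fin (a + b + n) where
  toFun := zIdx a b n
  inj' _ _ h := Fin.ext (congrArg (fun v => v.1) h :)

/-- The embedding of the indices of the variables `w`. -/
def wEmb : Fin b ↪ Fin (a + b + n) where
  toFun := wIdx a b n
  inj' _ _ h := Fin.ext (Nat.add_left_cancel (congrArg Fin.val h))

/-- The embedding of the indices of the variables `x`. -/
def xEmb : Fin n ↪ Fin (a + b + n) where
  toFun := xIdx a b n
  inj' _ _ h := Fin.ext (Nat.add_left_cancel (congrArg Fin.val h))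

lemma zEmb_val (i : Fin a) : (zEmb a b n i).1 = i.1 := rfl

lemma wEmb_val (i : Fin b) : (wEmb a b n i).1 = a + i.1 := rfl

lemma xEmb_val (i : Fin n) : (xEmb a b n i).1 = a + b + i.1 := rfl

lemma disjoint_zEmb_wEmb : Disjoint (univ.map (zEmb a b n)) (univ.map (wEmb a b n)) := by
  simp only [disjoint_left, mem_map, mem_univ, true_and, not_exists]
  rintro _ ⟨i, rfl⟩ j h
  have h := congrArg Fin.val h
  rw [zEmb_val, wEmb_val] at h
  omega

lemma disjoint_zEmb_xEmb : Disjoint (univ.map (zEmb a b n)) (univ.map (xEmb a b n)) := by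
  simp only [disjoint_left, mem_map, mem_univ, true_and, not_exists]
  rintro _ ⟨i, rfl⟩ j h
  have h := congrArg Fin.val h
  rw [zEmb_val, xEmb_val] at h
  omega

lemma disjoint_wEmb_xEmb : Disjoint (univ.map (wEmb a b n)) (univ.map (xEmb a b n)) := by
  simp only [disjoint_left, mem_map, mem_univ, true_and, not_exists]
  rintro _ ⟨i, rfl⟩ j h
  have h := congrArg Fin.val h
  rw [wEmb_val, xEmb_val] at h
  omega

lemma mem_indices (v : Fin (a + b + n)) :
    v ∈ univ.map (zEmb a b n) ∪ univ.map (wEmb a b n) ∪ univ.map (xEmb a b n) := by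
  simp only [mem_union, mem_map, mem_univ, true_and, Fin.ext_iff, zEmb_val, wEmb_val, xEmb_val]
  have hv := v.2
  by_cases h1 : v.1 < a
  · exact Or.inl (Or.inl ⟨⟨v.1, h1⟩, rfl⟩)
  by_cases h2 : v.1 < a + b
  · exact Or.inl (Or.inr ⟨⟨v.1 - a, by omega⟩, Nat.add_sub_of_le (by omega)⟩)
  · exact Or.inr ⟨⟨v.1 - (a + b), by omega⟩, Nat.add_sub_of_le (by omega)⟩

variable {a b n} (r : Fin a → ℕ) (s : Fin b → ℕ) (d : Fin n → ℕ)

lemma expVec_zEmb (i : Fin a) : expVec a b n r s d (zEmb a b n i) = r i :=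
  dif_pos i.2

lemma expVec_wEmb (i : Fin b) : expVec a b n r s d (wEmb a b n i) = s i := by
  have h := i.2
  have hv := wEmb_val a b n i
  rw [expVec, dif_neg (by omega), dif_pos (by omega)]
  exact congrArg s (Fin.ext (by simp only [hv]; omega))

lemma expVec_xEmb (i : Fin n) : expVec a b n r s d (xEmb a b n i) = d i := by
  have h := i.2
  have hv := xEmb_val a b n i
  rw [expVec, dif_neg (by omega), dif_neg (by omega)]
  exact congrArg d (Fin.ext (by simp only [hv]; omega))

end Indices

lemma LLm_eq (g n a b : ℕ) : LLm g n a b = PowerSeries.coeff g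
    (mSer₂ (X : Fin (a + b + n) → R (a + b + n))
      (-(varSum X (univ.map (zEmb a b n)) + varSum X (univ.map (wEmb a b n)) +
        varSum X (univ.map (xEmb a b n)))) (-2) (-2) (univ.map (zEmb a b n))
        (univ.map (wEmb a b n)) (univ.map (xEmb a b n))) := by
  have hz : univ.image (zIdx a b n) = univ.map (zEmb a b n) := (map_eq_image (zEmb a b n) _).symm
  have hw : univ.image (wIdx a b n) = univ.map (wEmb a b n) := (map_eq_image (wEmb a b n) _).symm
  have hx : ∀ I, Finset.image (xIdx a b n) I = I.map (xEmb a b n) := fun I =>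
    (map_eq_image (xEmb a b n) I).symm
  rw [LLm, sum_comm, mSer₂, sum_powerset_map, powerset_univ, map_sum]
  refine sum_congr rfl fun I _ => ?_
  simp only [hz, hw, hx]
  rw [← Finset.map_sdiff, ← compl_eq_univ_sdiff]
  have hs : varSum (X : Fin (a + b + n) → R (a + b + n))
      (univ.map (zEmb a b n) ∪ I.map (xEmb a b n)) +
      -(varSum X (univ.map (zEmb a b n)) + varSum X (univ.map (wEmb a b n)) +
        varSum X (univ.map (xEmb a b n))) =
      -varSum X (univ.map (wEmb a b n) ∪ Iᶜ.map (xEmb a b n)) := by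
    have hsub : ∀ J : Finset (Fin n), J.map (xEmb a b n) ⊆ univ.map (xEmb a b n) := fun J =>
      map_subset_map.2 (subset_univ J)
    have hu : varSum (X : Fin (a + b + n) → R (a + b + n)) (univ.map (xEmb a b n)) =
        varSum X (I.map (xEmb a b n)) + varSum X (Iᶜ.map (xEmb a b n)) := by
      simp only [varSum, sum_map]
      exact (sum_add_sum_compl I _).symm
    rw [varSum_union _ ((disjoint_zEmb_xEmb a b n).mono_right (hsub _)),
      varSum_union _ ((disjoint_wEmb_xEmb a b n).mono_right (hsub _)), hu]
    ring
  rw [hs, pC, pC, ← map_mul, PowerSeries.coeff_C_mul, PowerSeries.coeff_mul,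
    Finset.Nat.sum_antidiagonal_eq_sum_range_succ_mk, mul_sum]
  refine sum_congr rfl fun h _ => ?_
  rw [FExp_true, FExp_false]
  ring

/-- For `r_j, s_j ≥ 0`, `d_j ≥ 1` with `Σ r_j + Σ s_j + Σ d_j = g + n`, the coefficient of
`y^{2g−4+a+b} Π z_j^{r_j} Π w_j^{s_j} Π x_j^{d_j}` in `L_g(y; z; w; x)` equals
`(1/(Π (2r_j+1)!! Π (2s_j+1)!!)) · (−1)^b (2g−3+n+a+b)!/(4^g (2g−3+a+b)! Π (2d_j−1)!!)`,
the quotient of factorials being read as `Π_{i=1}^n (2g−3+a+b+i)`. -/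
theorem Lmulti_top_coeff (g n a b : ℕ) (hn : 1 ≤ n)
    (r : Fin a → ℕ) (s : Fin b → ℕ) (d : Fin n → ℕ) (hd : ∀ j, 1 ≤ d j)
    (hsum : ∑ j, r j + ∑ j, s j + ∑ j, d j = g + n) :
    coeffL (LLm g n a b) (2*(g : ℤ) - 4 + a + b) (expVec a b n r s d)
      = (1 / ((∏ j, (Nat.doubleFactorial (2*(r j)+1) : ℚ)) *
              (∏ j, (Nat.doubleFactorial (2*(s j)+1) : ℚ))))
        * ((-1 : ℚ)^b * (∏ i ∈ Finset.range n, (((2*(g : ℤ) - 3 + a + b + i + 1) : ℤ) : ℚ)) /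
            (4^g * ∏ j, (Nat.doubleFactorial (2*(d j)-1) : ℚ))) := by
  have hZY := disjoint_zEmb_xEmb a b n
  have hWY := disjoint_wEmb_xEmb a b n
  have hZW := disjoint_zEmb_wEmb a b n
  have htop := ((mTop (c := (X : Fin (a + b + n) → R (a + b + n))) (univ.map (zEmb a b n))
    (univ.map (wEmb a b n)) (univ.map (xEmb a b n)) hZY hWY).pascal
      (-(varSum X (univ.map (zEmb a b n)) + varSum X (univ.map (wEmb a b n)) +
        varSum X (univ.map (xEmb a b n)))) (-2) (-2)).1 g
  rw [← LLm_eq] at htop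
  have hdeg : (2 * (g : ℤ) - 4 + a + b) = 2 * g + (-2 + -2 + (univ.map (zEmb a b n)).card +
      (univ.map (wEmb a b n)).card) := by
    simp only [card_map, card_univ, Fintype.card_fin]
    ring
  rw [coeffL, hdeg, htop.coeff_eq, coeff_tau g _ _ _ _ hZY hWY hZW, topCoeff,
    prod_union (disjoint_union_left.2 ⟨hZY, hWY⟩), prod_union hZW, prod_map, prod_map, prod_map]
  · have e1 : ∀ i, expWeight (univ.map (xEmb a b n))
        (Finsupp.equivFunOnFinite.symm (expVec a b n r s d)) (zEmb a b n i) =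
          ((2 * r i + 1).doubleFactorial : ℚ) := fun i => by
      rw [expWeight, if_neg (disjoint_left.1 hZY (mem_map_of_mem _ (mem_univ i))),
        Finsupp.equivFunOnFinite_symm_apply_apply, expVec_zEmb]
    have e2 : ∀ i, expWeight (univ.map (xEmb a b n))
        (Finsupp.equivFunOnFinite.symm (expVec a b n r s d)) (wEmb a b n i) =
          ((2 * s i + 1).doubleFactorial : ℚ) := fun i => by
      rw [expWeight, if_neg (disjoint_left.1 hWY (mem_map_of_mem _ (mem_univ i))),
        Finsupp.equivFunOnFinite_symm_apply_apply, expVec_wEmb]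
    have e3 : ∀ i, expWeight (univ.map (xEmb a b n))
        (Finsupp.equivFunOnFinite.symm (expVec a b n r s d)) (xEmb a b n i) =
          ((2 * d i - 1).doubleFactorial : ℚ) := fun i => by
      rw [expWeight, if_pos (mem_map_of_mem _ (mem_univ i)),
        Finsupp.equivFunOnFinite_symm_apply_apply, expVec_xEmb]
    simp only [e1, e2, e3, card_map, card_univ, Fintype.card_fin]
    have hp : (∏ i ∈ range n, ((2 * g + (-2 + -2 + a + b) + 2 + i : ℤ) : ℚ)) =
        ∏ i ∈ range n, (((2 * (g : ℤ) - 3 + a + b + i + 1) : ℤ) : ℚ) :=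
      prod_congr rfl fun i _ => by congr 1; ring
    rw [hp, div_mul_div_comm, one_mul]
    congr 1
    ring
  · intro v hv
    obtain ⟨i, -, rfl⟩ := mem_map.1 hv
    rw [Finsupp.equivFunOnFinite_symm_apply_apply, expVec_xEmb]
    exact hd i
  · intro v hv
    exact absurd (mem_indices a b n v) hv
  · simp only [sum_map, Finsupp.equivFunOnFinite_symm_apply_apply, expVec_zEmb, expVec_wEmb,
      expVec_xEmb, card_map, card_univ, Fintype.card_fin]
    exact hsum

end
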